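/- Let g ≥ 0 and n ≥ 1 be integers. There exists a polynomial P ∈ ℤ[X] such that for every finite field F_q and every element ζ ∈ F_q^× of multiplicative order exactly n, the number of 2g-tuples (A_1,B_1,…,A_g,B_g) ∈ GL(n,F_q)^{2g} satisfying [A_1,B_1][A_2,B_2]⋯[A_g,B_g] = ζ·I_n equals (|GL(n,F_q)|/(q−1)) · P(q). In particular this count is independent of the choice of ζ, and the twisted GL_n-character variety has polynomial count. -/

import Mathlib

open scoped MatrixGroups
namespace TCV
open Finset
set_option linter.unusedSectionVars false
set_option linter.unusedSimpArgs false
set_option linter.unusedVariables false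

/-- abstract structure constants of a truncated positive self-adjoint Hopf algebra -/
structure PSH (J : Type) [Fintype J] [DecidableEq J] (Z : Type) [CommGroup Z] (n q : ℕ) where
  two_le_q : 2 ≤ q
  deg : J → ℕ
  deg_le : ∀ w, deg w ≤ n
  o : J
  deg_eq_zero : ∀ w, deg w = 0 ↔ w = o
  c : J → J → J → ℕ
  c_deg : ∀ {a b w}, c a b w ≠ 0 → deg w = deg a + deg b
  c_o_left : ∀ a w, c o a w = if a = w then 1 else 0
  c_o_right : ∀ a w, c a o w = if a = w then 1 else 0
  c_assoc : ∀ a b d w, ∑ x, c a b x * c x d w = ∑ x, c b d x * c a x w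
  hopf : ∀ a b u v, deg a + deg b ≤ n → ∑ w, c a b w * c u v w =
    ∑ p, ∑ r, ∑ p', ∑ r', c p r a * c p' r' b * (c p p' u * c r r' v)
  δ : J → ℚ
  δ_pos : ∀ w, 0 < δ w
  δ_o : δ o = 1
  δ_mul : ∀ a b, deg a + deg b ≤ n → ∑ w, (c a b w : ℚ) * δ w = δ a * δ b
  γ : J → ℕ
  γ_le : ∀ w, γ w ≤ 1
  γ_eq : ∀ w, (q : ℚ) ^ deg w * δ w = ∑ a, ∑ b, (c a b w : ℚ) * (δ a * γ b)
  ω : J → Z →* ℂ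
  ω_mul : ∀ {a b w}, c a b w ≠ 0 → ω w = ω a * ω b
  sum_sq : ∀ z : Z, z ≠ 1 → ∀ m, 1 ≤ m → m ≤ n →
    ∑ w with deg w = m, ω w z * (δ w : ℂ) ^ 2 = 0
  sum_sq_one : 1 ≤ n → ∑ w with deg w = 1, (δ w) ^ 2 = 1 / ((q : ℚ) - 1)

namespace PSH
variable {J : Type} [Fintype J] [DecidableEq J] {Z : Type} [CommGroup Z] {n q : ℕ}
  (D : PSH J Z n q)

lemma γ_o : D.γ D.o = 1 := by
  have h := D.γ_eq D.o
  rw [(D.deg_eq_zero D.o).2 rfl, pow_zero, one_mul, D.δ_o] at h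
  have h2 : ∀ a b, (D.c a b D.o : ℚ) * (D.δ a * D.γ b) =
      if a = D.o then (if b = D.o then (D.γ D.o : ℚ) else 0) else 0 := by
    intro a b
    by_cases hc : D.c a b D.o = 0
    · split_ifs with h1 h2
      · subst h1 h2
        rw [D.c_o_left] at hc; simp at hc
      all_goals simp [hc]
    · have := D.c_deg hc
      rw [(D.deg_eq_zero D.o).2 rfl] at this
      have ha := (D.deg_eq_zero a).1 (by omega)
      have hb := (D.deg_eq_zero b).1 (by omega)
      subst ha hb
      simp [D.c_o_left, D.δ_o]
  simp only [h2] at h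
  simp at h
  exact_mod_cast h.symm

lemma c_comm_aux (N : ℕ) : ∀ a b w, D.deg w = N → D.c a b w = D.c b a w := by
  induction N using Nat.strong_induction_on with
  | _ N ih =>
  intro a b w hw
  by_cases ha : a = D.o
  · subst ha; rw [D.c_o_left, D.c_o_right]
  by_cases hb : b = D.o
  · subst hb; rw [D.c_o_left, D.c_o_right]
  have ha' : D.deg a ≠ 0 := fun h => ha ((D.deg_eq_zero a).1 h)
  have hb' : D.deg b ≠ 0 := fun h => hb ((D.deg_eq_zero b).1 h)
  by_cases hN : D.deg a + D.deg b = N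
  swap
  · have h1 : D.c a b w = 0 := by
      by_contra h; have := D.c_deg h; omega
    have h2 : D.c b a w = 0 := by
      by_contra h; have := D.c_deg h; omega
    rw [h1, h2]
  have hn := D.deg_le w
  have hA : ∀ p r, D.c p r a = D.c r p a := fun p r => ih (D.deg a) (by omega) p r a rfl
  have hB : ∀ p r, D.c p r b = D.c r p b := fun p r => ih (D.deg b) (by omega) p r b rfl
  -- the cross term
  have key : ∀ a b, D.deg a + D.deg b ≤ n → (∀ p r, D.c p r a = D.c r p a) →
      (∀ p r, D.c p r b = D.c r p b) →
      ∑ w, D.c a b w * D.c b a w = ∑ w, D.c a b w * D.c a b w := by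
    intro a b hab hA hB
    rw [D.hopf a b b a hab, D.hopf a b a b hab, sum_comm]
    refine sum_congr rfl fun r _ => sum_congr rfl fun p _ => ?_
    rw [sum_comm]
    refine sum_congr rfl fun r' _ => sum_congr rfl fun p' _ => ?_
    rw [hA p r, hB p' r']; ring
  have k1 := key a b (by omega) hA hB
  have k2 := key b a (by omega) hB hA
  have h0 : ∑ w, ((D.c a b w : ℤ) - D.c b a w) ^ 2 = 0 := by
    have e : ∀ w, ((D.c a b w : ℤ) - D.c b a w) ^ 2 =
      ((D.c a b w * D.c a b w : ℕ) : ℤ) + ((D.c b a w * D.c b a w : ℕ) : ℤ)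
       - ((D.c a b w * D.c b a w : ℕ) : ℤ) - ((D.c b a w * D.c a b w : ℕ) : ℤ) := by
      intro w; push_cast; ring
    simp only [e, sum_sub_distrib, sum_add_distrib, ← Nat.cast_sum, k1, k2]
    ring
  have := (sum_eq_zero_iff_of_nonneg (fun w _ => sq_nonneg _)).1 h0 w (mem_univ _)
  have := pow_eq_zero_iff (two_ne_zero) |>.1 this
  omega

lemma c_comm (a b w) : D.c a b w = D.c b a w := D.c_comm_aux _ a b w rfl

/-- convolution algebra -/
def Cv (_ : PSH J Z n q) (A : Type) : Type := J → A

variable {A : Type} [CommRing A]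

instance : AddCommGroup (D.Cv A) := inferInstanceAs (AddCommGroup (J → A))

instance : Mul (D.Cv A) := ⟨fun f g w => ∑ a, ∑ b, (D.c a b w : A) * (f a * g b)⟩
instance : One (D.Cv A) := ⟨fun w => if w = D.o then 1 else 0⟩

lemma mul_apply (f g : D.Cv A) (w : J) :
    (f * g) w = ∑ a, ∑ b, (D.c a b w : A) * (f a * g b) := rfl
lemma one_apply (w : J) : (1 : D.Cv A) w = if w = D.o then 1 else 0 := rfl
lemma add_apply (f g : D.Cv A) (w : J) : (f + g) w = f w + g w := rfl
lemma zero_apply (w : J) : (0 : D.Cv A) w = 0 := rfl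
lemma neg_apply (f : D.Cv A) (w : J) : (-f) w = -f w := rfl
@[ext] lemma Cv.ext {f g : D.Cv A} (h : ∀ w, f w = g w) : f = g := funext h

lemma cv_mul_comm (f g : D.Cv A) : f * g = g * f := by
  ext w
  rw [mul_apply, mul_apply, sum_comm]
  refine sum_congr rfl fun a _ => sum_congr rfl fun b _ => ?_
  rw [D.c_comm, mul_comm (f b)]

lemma cv_one_mul (f : D.Cv A) : 1 * f = f := by
  ext w
  simp only [mul_apply, one_apply]
  rw [sum_eq_single D.o (fun b _ hb => by simp [hb]) (by simp), sum_eq_single w (fun b _ hb => by simp [hb, D.c_o_left]) (by simp)]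
  simp [D.c_o_left]

lemma cv_mul_assoc (f g h : D.Cv A) : f * g * h = f * (g * h) := by
  ext w
  simp only [mul_apply]
  have l : ∀ x d, (D.c x d w : A) * ((∑ a, ∑ b, (D.c a b x : A) * (f a * g b)) * h d) =
      ∑ a, ∑ b, ((D.c a b x * D.c x d w : ℕ) : A) * (f a * g b * h d) := by
    intro x d
    rw [sum_mul, mul_sum]
    refine sum_congr rfl fun a _ => ?_
    rw [sum_mul, mul_sum]
    refine sum_congr rfl fun b _ => ?_
    push_cast; ring
  have r : ∀ a x, (D.c a x w : A) * (f a * (∑ b, ∑ d, (D.c b d x : A) * (g b * h d))) =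
      ∑ b, ∑ d, ((D.c b d x * D.c a x w : ℕ) : A) * (f a * g b * h d) := by
    intro a x
    rw [mul_sum, mul_sum]
    refine sum_congr rfl fun b _ => ?_
    rw [mul_sum, mul_sum]
    refine sum_congr rfl fun d _ => ?_
    push_cast; ring
  simp only [l, r]
  have L : ∑ x, ∑ d, ∑ a, ∑ b, ((D.c a b x * D.c x d w : ℕ) : A) * (f a * g b * h d) =
     ∑ a, ∑ b, ∑ d, ((∑ x, D.c a b x * D.c x d w : ℕ) : A) * (f a * g b * h d) := by
    simp only [Nat.cast_sum, sum_mul]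
    rw [sum_comm]
    rw [sum_congr rfl fun d _ => sum_comm]
    rw [sum_comm]
    refine sum_congr rfl fun a _ => ?_
    rw [sum_congr rfl fun d _ => sum_comm]
    rw [sum_comm]
  have R : ∑ a, ∑ x, ∑ b, ∑ d, ((D.c b d x * D.c a x w : ℕ) : A) * (f a * g b * h d) =
     ∑ a, ∑ b, ∑ d, ((∑ x, D.c b d x * D.c a x w : ℕ) : A) * (f a * g b * h d) := by
    simp only [Nat.cast_sum, sum_mul]
    refine sum_congr rfl fun a _ => ?_
    rw [sum_comm]
    refine sum_congr rfl fun b _ => ?_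
    rw [sum_comm]
  rw [L, R]
  simp only [D.c_assoc]

lemma cv_mul_add (f g h : D.Cv A) : f * (g + h) = f * g + f * h := by
  ext w
  simp only [mul_apply, add_apply, mul_add, sum_add_distrib]

instance : CommRing (D.Cv A) :=
  { (inferInstance : AddCommGroup (D.Cv A)) with
    mul := (· * ·)
    one := 1
    mul_assoc := D.cv_mul_assoc
    one_mul := D.cv_one_mul
    mul_one := fun f => by rw [cv_mul_comm, cv_one_mul]
    mul_comm := D.cv_mul_comm
    left_distrib := D.cv_mul_add
    right_distrib := fun f g h => by rw [cv_mul_comm, cv_mul_add, cv_mul_comm, D.cv_mul_comm h]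
    zero_mul := fun f => by ext w; simp [mul_apply, zero_apply]
    mul_zero := fun f => by ext w; simp [mul_apply, zero_apply] }

/-- evaluation at w as an additive hom -/
def evl (w : J) : D.Cv A →+ A where
  toFun f := f w
  map_zero' := rfl
  map_add' _ _ := rfl

lemma sum_apply {ι : Type*} (s : Finset ι) (f : ι → D.Cv A) (w : J) :
    (∑ i ∈ s, f i) w = ∑ i ∈ s, f i w := map_sum (D.evl w) f s

lemma mul_ne_zero_elim {f g : D.Cv A} {w : J} (h : (f * g) w ≠ 0) :
    ∃ a b, D.c a b w ≠ 0 ∧ f a ≠ 0 ∧ g b ≠ 0 := by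
  rw [mul_apply] at h
  obtain ⟨a, _, h⟩ := exists_ne_zero_of_sum_ne_zero h
  obtain ⟨b, _, h⟩ := exists_ne_zero_of_sum_ne_zero h
  refine ⟨a, b, ?_, ?_, ?_⟩ <;> (intro h0; apply h; simp [h0])

/-- multiplicative functions -/
def IsHom (h : D.Cv A) : Prop :=
  h D.o = 1 ∧ ∀ a b, D.deg a + D.deg b ≤ n → ∑ w, (D.c a b w : A) * h w = h a * h b

lemma IsHom.one : D.IsHom (1 : D.Cv A) := by
  refine ⟨by simp [one_apply], fun a b _ => ?_⟩
  simp only [one_apply]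
  simp only [mul_ite, mul_one, mul_zero, sum_ite_eq', mem_univ, if_true]
  by_cases hc : D.c a b D.o = 0
  · rw [hc]
    split_ifs with h1 h2
    · subst h1 h2; simp [D.c_o_left] at hc
    all_goals simp
  · have := D.c_deg hc
    rw [(D.deg_eq_zero D.o).2 rfl] at this
    have ha := (D.deg_eq_zero a).1 (by omega)
    have hb := (D.deg_eq_zero b).1 (by omega)
    subst ha hb
    simp [D.c_o_left]

lemma mul_o (f g : D.Cv A) : (f * g) D.o = f D.o * g D.o := by
  rw [mul_apply]
  have h2 : ∀ a b, (D.c a b D.o : A) * (f a * g b) =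
      if a = D.o then (if b = D.o then f D.o * g D.o else 0) else 0 := by
    intro a b
    by_cases hc : D.c a b D.o = 0
    · split_ifs with h1 h2
      · subst h1 h2
        rw [D.c_o_left] at hc; simp at hc
      all_goals simp [hc]
    · have := D.c_deg hc
      rw [(D.deg_eq_zero D.o).2 rfl] at this
      have ha := (D.deg_eq_zero a).1 (by omega)
      have hb := (D.deg_eq_zero b).1 (by omega)
      subst ha hb
      simp [D.c_o_left]
  simp [h2]

/-- the basic Hopf computation -/
lemma hopf_pair (f g : D.Cv A) (a b : J) (hab : D.deg a + D.deg b ≤ n) :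
    ∑ w, (D.c a b w : A) * (f * g) w =
    ∑ p, ∑ r, ∑ p', ∑ r', ((D.c p r a : A) * D.c p' r' b) *
      ((∑ u, (D.c p p' u : A) * f u) * (∑ v, (D.c r r' v : A) * g v)) := by
  have e1 : ∀ w, (D.c a b w : A) * (f * g) w =
      ∑ u, ∑ v, ((D.c a b w * D.c u v w : ℕ) : A) * (f u * g v) := by
    intro w
    rw [mul_apply, mul_sum]
    refine sum_congr rfl fun u _ => ?_
    rw [mul_sum]
    refine sum_congr rfl fun v _ => ?_
    push_cast; ring
  simp only [e1]
  rw [sum_comm, sum_congr rfl fun u _ => sum_comm]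
  simp only [← sum_mul, ← Nat.cast_sum, D.hopf a b _ _ hab]
  have e2 : ∀ p r p' r', ((D.c p r a : A) * D.c p' r' b) *
      ((∑ u, (D.c p p' u : A) * f u) * (∑ v, (D.c r r' v : A) * g v)) =
      ∑ u, ∑ v, ((D.c p r a * D.c p' r' b * (D.c p p' u * D.c r r' v) : ℕ) : A) * (f u * g v) := by
    intro p r p' r'
    rw [sum_mul_sum, mul_sum]
    refine sum_congr rfl fun u _ => ?_
    rw [mul_sum]
    refine sum_congr rfl fun v _ => ?_
    push_cast; ring
  simp only [e2]
  simp only [Nat.cast_sum, sum_mul]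
  -- reorder
  have sw : ∀ (X : J → J → J → J → J → J → A),
      ∑ u, ∑ v, ∑ p, ∑ r, ∑ p', ∑ r', X u v p r p' r' =
      ∑ p, ∑ r, ∑ p', ∑ r', ∑ u, ∑ v, X u v p r p' r' := by
    intro X
    have : ∀ (Y : J → J → J → J → J × J → A), ∑ uv, ∑ p, ∑ r, ∑ p', ∑ r', Y p r p' r' uv =
      ∑ p, ∑ r, ∑ p', ∑ r', ∑ uv, Y p r p' r' uv := by
      intro Y
      rw [sum_comm]; refine sum_congr rfl fun p _ => ?_
      rw [sum_comm]; refine sum_congr rfl fun p _ => ?_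
      rw [sum_comm]; refine sum_congr rfl fun p _ => ?_
      rw [sum_comm]
    have h := this (fun p r p' r' uv => X uv.1 uv.2 p r p' r')
    simp only [Fintype.sum_prod_type] at h
    exact h
  exact sw _

lemma mul_mul_pair (f g : D.Cv A) (a b : J) :
    (f * g) a * (f * g) b =
    ∑ p, ∑ r, ∑ p', ∑ r', ((D.c p r a : A) * D.c p' r' b) *
      ((f p * f p') * (g r * g r')) := by
  rw [mul_apply, mul_apply, sum_mul]
  refine sum_congr rfl fun p _ => ?_
  rw [sum_mul]
  refine sum_congr rfl fun r _ => ?_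
  rw [mul_sum]
  refine sum_congr rfl fun p' _ => ?_
  rw [mul_sum]
  refine sum_congr rfl fun r' _ => ?_
  ring

lemma IsHom.mul {f g : D.Cv A} (hf : D.IsHom f) (hg : D.IsHom g) : D.IsHom (f * g) := by
  refine ⟨by rw [mul_o, hf.1, hg.1, one_mul], fun a b hab => ?_⟩
  rw [D.hopf_pair f g a b hab, mul_mul_pair]
  refine sum_congr rfl fun p _ => sum_congr rfl fun r _ => sum_congr rfl fun p' _ =>
    sum_congr rfl fun r' _ => ?_
  by_cases h1 : D.c p r a = 0
  · simp [h1]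
  by_cases h2 : D.c p' r' b = 0
  · simp [h2]
  have d1 := D.c_deg h1
  have d2 := D.c_deg h2
  rw [hf.2 p p' (by omega), hg.2 r r' (by omega)]

lemma IsHom.prod {ι : Type*} (s : Finset ι) (f : ι → D.Cv A) (h : ∀ i ∈ s, D.IsHom (f i)) :
    D.IsHom (∏ i ∈ s, f i) := by
  classical
  induction s using Finset.induction_on with
  | empty => simpa using IsHom.one D
  | insert i s hi ih =>
    rw [prod_insert hi]
    exact IsHom.mul D (h i (mem_insert_self _ _)) (ih fun j hj => h j (mem_insert_of_mem hj))

def δc : D.Cv ℚ := fun w => D.δ w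
def γc : D.Cv ℚ := fun w => (D.γ w : ℚ)
def δt : D.Cv ℚ := fun w => (q : ℚ) ^ D.deg w * D.δ w

lemma δt_eq : D.δt = D.δc * D.γc := by
  ext w; exact D.γ_eq w

lemma δc_hom : D.IsHom D.δc := ⟨D.δ_o, D.δ_mul⟩

lemma δt_hom : D.IsHom D.δt := by
  refine ⟨by simp [δt, (D.deg_eq_zero D.o).2 rfl, D.δ_o], fun a b hab => ?_⟩
  have : ∀ w, (D.c a b w : ℚ) * D.δt w = q ^ (D.deg a + D.deg b) * ((D.c a b w : ℚ) * D.δ w) := by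
    intro w
    by_cases h : D.c a b w = 0
    · simp [h]
    · rw [δt, D.c_deg h]; ring
  rw [sum_congr rfl fun w _ => this w, ← mul_sum, D.δ_mul a b hab]
  simp only [δt]
  ring

lemma γ_mul_aux (N : ℕ) : ∀ a b, D.deg a + D.deg b = N → D.deg a + D.deg b ≤ n →
    ∑ w, (D.c a b w : ℚ) * D.γc w = D.γc a * D.γc b := by
  induction N using Nat.strong_induction_on with
  | _ N ih =>
  intro a b hN hab
  have h := D.δt_hom.2 a b hab
  rw [D.δt_eq, D.hopf_pair _ _ a b hab, mul_mul_pair] at h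
  rw [← sub_eq_zero] at h
  simp only [← sum_sub_distrib, ← mul_sub] at h
  have e : ∀ p r p' r', ((D.c p r a : ℚ) * D.c p' r' b) *
      ((∑ u, (D.c p p' u : ℚ) * D.δc u) * (∑ v, (D.c r r' v : ℚ) * D.γc v)
        - D.δc p * D.δc p' * (D.γc r * D.γc r')) =
      if p = D.o then if r = a then if p' = D.o then if r' = b then
        (∑ w, (D.c a b w : ℚ) * D.γc w) - D.γc a * D.γc b else 0 else 0 else 0 else 0 := by
    intro p r p' r'
    by_cases h1 : D.c p r a = 0
    · split_ifs with e1 e2 e3 e4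
      · subst e1 e2; simp [D.c_o_left] at h1
      all_goals simp [h1]
    by_cases h2 : D.c p' r' b = 0
    · split_ifs with e1 e2 e3 e4
      · subst e3 e4; simp [D.c_o_left] at h2
      all_goals simp [h2]
    have d1 := D.c_deg h1
    have d2 := D.c_deg h2
    rw [D.δc_hom.2 p p' (by omega), ← mul_sub]
    by_cases hlt : D.deg r + D.deg r' < N
    · rw [ih _ hlt r r' rfl (by omega)]
      split_ifs with e1 e2 e3 e4
      · subst e2 e4; omega
      all_goals simp
    · have hp := (D.deg_eq_zero p).1 (by omega)
      have hp' := (D.deg_eq_zero p').1 (by omega)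
      subst hp hp'
      rw [D.c_o_left] at h1 h2 ⊢
      rw [D.c_o_left]
      have e1 : r = a := by by_contra hh; simp [hh] at h1
      have e2 : r' = b := by by_contra hh; simp [hh] at h2
      subst e1 e2
      simp [D.δc_hom.1]
  simp only [e] at h
  simp only [sum_ite_eq', mem_univ, if_true, sum_const_zero, sum_ite_irrel] at h
  linarith

lemma γc_hom : D.IsHom D.γc :=
  ⟨by simp [γc, D.γ_o], fun a b hab => D.γ_mul_aux _ a b rfl hab⟩

lemma γ_hom (a b : J) (hab : D.deg a + D.deg b ≤ n) :
    ∑ w, D.c a b w * D.γ w = D.γ a * D.γ b := by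
  have := D.γc_hom.2 a b hab
  simp only [γc] at this
  exact_mod_cast this

end PSH
end TCV

open scoped MatrixGroups
namespace TCV
open Finset
set_option linter.unusedSectionVars false
set_option linter.unusedSimpArgs false
set_option linter.unusedVariables false

namespace PSH
variable {J : Type} [Fintype J] [DecidableEq J] {Z : Type} [CommGroup Z] {n q : ℕ}
  (D : PSH J Z n q) {A : Type} [CommRing A]

def Cusp (ρ : J) : Prop := 1 ≤ D.deg ρ ∧ ∀ a b, D.c a b ρ ≠ 0 → a = D.o ∨ b = D.o

lemma deg_o : D.deg D.o = 0 := (D.deg_eq_zero D.o).2 rfl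

lemma c_o_left_ne {a w : J} (h : D.c D.o a w ≠ 0) : a = w := by
  by_contra hh; simp [D.c_o_left, hh] at h
lemma c_o_right_ne {a w : J} (h : D.c a D.o w ≠ 0) : a = w := by
  by_contra hh; simp [D.c_o_right, hh] at h

lemma Cusp.ne_o {ρ : J} (h : D.Cusp ρ) : ρ ≠ D.o := by
  rintro rfl; have := h.1; rw [D.deg_o] at this; omega

lemma Cusp.gamma_delta {ρ : J} (h : D.Cusp ρ) :
    (D.γ ρ : ℚ) = ((q : ℚ) ^ D.deg ρ - 1) * D.δ ρ := by
  have e := D.γ_eq ρ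
  have hne := h.ne_o
  have e2 : ∀ a b, (D.c a b ρ : ℚ) * (D.δ a * D.γ b) =
      (if a = D.o then (if b = ρ then (D.γ ρ : ℚ) else 0) else 0) +
      (if a = ρ then (if b = D.o then D.δ ρ else 0) else 0) := by
    intro a b
    by_cases hc : D.c a b ρ = 0
    · have h1 : ¬ (a = D.o ∧ b = ρ) := by rintro ⟨rfl, rfl⟩; simp [D.c_o_left] at hc
      have h2 : ¬ (a = ρ ∧ b = D.o) := by rintro ⟨rfl, rfl⟩; simp [D.c_o_right] at hc
      simp only [hc, Nat.cast_zero, zero_mul, ← ite_and, if_neg h1, if_neg h2, add_zero]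
    · rcases h.2 a b hc with rfl | rfl
      · have := D.c_o_left_ne hc
        subst this
        simp [D.c_o_left, D.δ_o, hne.symm]
      · have := D.c_o_right_ne hc
        subst this
        simp [D.c_o_right, D.γ_o, hne]
  simp only [e2, sum_add_distrib] at e
  simp at e
  linarith

lemma one_lt_qpow (D : PSH J Z n q) {d : ℕ} (hd : 1 ≤ d) : (1 : ℚ) < (q : ℚ) ^ d := by
  have : (2 : ℚ) ≤ q := by exact_mod_cast D.two_le_q
  exact one_lt_pow₀ (by linarith) (by omega)

lemma Cusp.gamma {ρ : J} (h : D.Cusp ρ) : D.γ ρ = 1 := by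
  have e := h.gamma_delta
  have h1 := D.one_lt_qpow h.1
  have h2 := D.δ_pos ρ
  have : (0 : ℚ) < D.γ ρ := by rw [e]; exact mul_pos (by linarith) h2
  have : 0 < D.γ ρ := by exact_mod_cast this
  have := D.γ_le ρ
  omega

lemma gamma_of_c {a b w : J} (h : D.c a b w ≠ 0) (hw : D.γ w ≠ 0) :
    D.γ a = 1 ∧ D.γ b = 1 ∧ D.c a b w = 1 := by
  have d := D.c_deg h
  have e := D.γ_hom a b (by have := D.deg_le w; omega)
  have l : D.c a b w * D.γ w ≤ D.γ a * D.γ b := by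
    rw [← e]; exact single_le_sum (f := fun w => D.c a b w * D.γ w) (by simp) (mem_univ w)
  have ha := D.γ_le a
  have hb := D.γ_le b
  have hw' := D.γ_le w
  have hw1 : D.γ w = 1 := by omega
  rw [hw1, mul_one] at l
  have p : 0 < D.c a b w := Nat.pos_of_ne_zero h
  interval_cases D.γ a <;> interval_cases D.γ b <;> simp_all
  omega

lemma exists_of_gamma {a b : J} (ha : D.γ a = 1) (hb : D.γ b = 1) (h : D.deg a + D.deg b ≤ n) :
    ∃ w, D.c a b w ≠ 0 ∧ D.γ w = 1 := by
  have e := D.γ_hom a b h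
  rw [ha, hb] at e
  obtain ⟨w, _, hw⟩ := exists_ne_zero_of_sum_ne_zero (s := univ)
    (f := fun w => D.c a b w * D.γ w) (by rw [e]; simp)
  have := D.γ_le w
  refine ⟨w, left_ne_zero_of_mul hw, ?_⟩
  have := right_ne_zero_of_mul hw
  omega

lemma unique_of_gamma {a b w w' : J} (h : D.c a b w ≠ 0) (hw : D.γ w = 1)
    (h' : D.c a b w' ≠ 0) (hw' : D.γ w' = 1) : w = w' := by
  by_contra hne
  obtain ⟨ha, hb, hc⟩ := D.gamma_of_c h (by omega)
  obtain ⟨_, _, hc'⟩ := D.gamma_of_c h' (by omega)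
  have d := D.c_deg h
  have e := D.γ_hom a b (by have := D.deg_le w; omega)
  have l : ∑ x ∈ {w, w'}, D.c a b x * D.γ x ≤ D.γ a * D.γ b := by
    rw [← e]; exact sum_le_sum_of_subset (subset_univ _)
  rw [sum_pair hne, hc, hc', hw, hw', ha, hb] at l
  omega

/-- `w` occurs in `ρ ^ m` -/
def Reach (ρ : J) : ℕ → J → Prop
  | 0, w => w = D.o
  | m + 1, w => ∃ x, Reach ρ m x ∧ D.c ρ x w ≠ 0

variable {D} {ρ : J}

lemma Reach.deg : ∀ {m w}, D.Reach ρ m w → D.deg w = m * D.deg ρ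
  | 0, w, h => by rw [show w = D.o from h, D.deg_o, zero_mul]
  | m + 1, w, ⟨x, hx, hc⟩ => by rw [D.c_deg hc, hx.deg]; ring

lemma ω_o : D.ω D.o = 1 := by
  have h : D.c D.o D.o D.o ≠ 0 := by simp [D.c_o_left]
  have e := D.ω_mul h
  ext z
  have e1 : D.ω D.o z = D.ω D.o z * D.ω D.o z := by
    conv_lhs => rw [e]
    rfl
  have e2 : D.ω D.o z ≠ 0 := by
    have : D.ω D.o z * D.ω D.o z⁻¹ = 1 := by rw [← map_mul]; simp
    exact left_ne_zero_of_mul_eq_one this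
  exact mul_left_cancel₀ e2 (by rw [← e1]; simp)

lemma Reach.omega : ∀ {m w}, D.Reach ρ m w → D.ω w = D.ω ρ ^ m
  | 0, w, h => by rw [show w = D.o from h, ω_o, pow_zero]
  | m + 1, w, ⟨x, hx, hc⟩ => by rw [D.ω_mul hc, hx.omega, pow_succ']

lemma Reach.comul (hρ : D.Cusp ρ) : ∀ {m w a b}, D.Reach ρ m w → D.c a b w ≠ 0 →
    ∃ i j, i + j = m ∧ D.Reach ρ i a ∧ D.Reach ρ j b
  | 0, w, a, b, h, hc => by
    have hw : w = D.o := h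
    have := D.c_deg hc
    rw [hw, D.deg_o] at this
    exact ⟨0, 0, rfl, (D.deg_eq_zero a).1 (by omega), (D.deg_eq_zero b).1 (by omega)⟩
  | m + 1, w, a, b, ⟨x, hx, hcx⟩, hc => by
    have e := D.hopf ρ x a b (by have := D.c_deg hcx; have := D.deg_le w; omega)
    have hne : ∑ w, D.c ρ x w * D.c a b w ≠ 0 := by
      intro h0
      rw [sum_eq_zero_iff] at h0
      exact mul_ne_zero hcx hc (h0 w (mem_univ _))
    rw [e] at hne
    obtain ⟨p, _, hne⟩ := exists_ne_zero_of_sum_ne_zero hne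
    obtain ⟨r, _, hne⟩ := exists_ne_zero_of_sum_ne_zero hne
    obtain ⟨p', _, hne⟩ := exists_ne_zero_of_sum_ne_zero hne
    obtain ⟨r', _, hne⟩ := exists_ne_zero_of_sum_ne_zero hne
    have h1 := left_ne_zero_of_mul (left_ne_zero_of_mul hne)
    have h2 := right_ne_zero_of_mul (left_ne_zero_of_mul hne)
    have h3 := left_ne_zero_of_mul (right_ne_zero_of_mul hne)
    have h4 := right_ne_zero_of_mul (right_ne_zero_of_mul hne)
    obtain ⟨i, j, hij, hi, hj⟩ := hx.comul hρ h2
    rcases hρ.2 p r h1 with rfl | rfl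
    · have := D.c_o_left_ne h1
      subst this
      have := D.c_o_left_ne h3
      subst this
      exact ⟨i, j + 1, by omega, hi, r', hj, h4⟩
    · have := D.c_o_right_ne h1
      subst this
      have := D.c_o_left_ne h4
      subst this
      exact ⟨i + 1, j, by omega, ⟨p', hi, h3⟩, hj⟩

lemma Reach.mul : ∀ {i j a b w}, D.Reach ρ i a → D.Reach ρ j b → D.c a b w ≠ 0 →
    D.Reach ρ (i + j) w
  | 0, j, a, b, w, h, hj, hc => by
    rw [show a = D.o from h] at hc
    have := D.c_o_left_ne hc
    subst this
    rwa [zero_add]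
  | i + 1, j, a, b, w, ⟨x, hx, hcx⟩, hj, hc => by
    have e := D.c_assoc ρ x b w
    have hne : ∑ y, D.c ρ x y * D.c y b w ≠ 0 := by
      intro h0
      rw [sum_eq_zero_iff] at h0
      exact mul_ne_zero hcx hc (h0 a (mem_univ _))
    rw [e] at hne
    obtain ⟨y, _, hne⟩ := exists_ne_zero_of_sum_ne_zero hne
    have h1 := left_ne_zero_of_mul hne
    have h2 := right_ne_zero_of_mul hne
    rw [show i + 1 + j = (i + j) + 1 by ring]
    exact ⟨y, hx.mul hj h1, h2⟩

lemma exists_y (hρ : D.Cusp ρ) : ∀ m, m * D.deg ρ ≤ n → ∃ w, D.Reach ρ m w ∧ D.γ w = 1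
  | 0, _ => ⟨D.o, rfl, D.γ_o⟩
  | m + 1, h => by
    rw [add_mul, one_mul] at h
    obtain ⟨x, hx, gx⟩ := exists_y hρ m (by omega)
    obtain ⟨w, hw, gw⟩ := D.exists_of_gamma hρ.gamma gx (by rw [hx.deg]; omega)
    exact ⟨w, ⟨x, hx, hw⟩, gw⟩

lemma unique_y (hρ : D.Cusp ρ) : ∀ m {w w'}, D.Reach ρ m w → D.γ w = 1 → D.Reach ρ m w' →
    D.γ w' = 1 → w = w'
  | 0, w, w', h, _, h', _ => by rw [show w = D.o from h, show w' = D.o from h']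
  | m + 1, w, w', ⟨x, hx, hc⟩, g, ⟨x', hx', hc'⟩, g' => by
    obtain ⟨_, gx, _⟩ := D.gamma_of_c hc (by omega)
    obtain ⟨_, gx', _⟩ := D.gamma_of_c hc' (by omega)
    have := unique_y hρ m hx gx hx' gx'
    subst this
    exact D.unique_of_gamma hc g hc' g'

variable (D)
open Classical in
noncomputable def y (ρ : J) (m : ℕ) : J :=
  if h : ∃ w, D.Reach ρ m w ∧ D.γ w = 1 then h.choose else D.o
variable {D}

lemma y_spec (hρ : D.Cusp ρ) {m} (h : m * D.deg ρ ≤ n) :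
    D.Reach ρ m (D.y ρ m) ∧ D.γ (D.y ρ m) = 1 := by
  have := exists_y hρ m h
  rw [y, dif_pos this]
  exact this.choose_spec

lemma y_unique (hρ : D.Cusp ρ) {m w} (h : D.Reach ρ m w) (g : D.γ w = 1) : D.y ρ m = w := by
  have := y_spec hρ (m := m) (by rw [← h.deg]; exact D.deg_le w)
  exact unique_y hρ m this.1 this.2 h g

lemma y_zero (hρ : D.Cusp ρ) : D.y ρ 0 = D.o := y_unique hρ (show D.o = D.o from rfl) D.γ_o

lemma deg_y (hρ : D.Cusp ρ) {m} (h : m * D.deg ρ ≤ n) : D.deg (D.y ρ m) = m * D.deg ρ :=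
  (y_spec hρ h).1.deg

lemma y_inj (hρ : D.Cusp ρ) {i j} (hi : i * D.deg ρ ≤ n) (hj : j * D.deg ρ ≤ n)
    (h : D.y ρ i = D.y ρ j) : i = j := by
  have h1 := deg_y hρ hi
  rw [h, deg_y hρ hj] at h1
  exact (Nat.eq_of_mul_eq_mul_right hρ.1 h1).symm

/-- comultiplication of `y` -/
lemma mul_y (hρ : D.Cusp ρ) {m} (h : m * D.deg ρ ≤ n) (f g : D.Cv A) :
    (f * g) (D.y ρ m) = ∑ ij ∈ antidiagonal m, f (D.y ρ ij.1) * g (D.y ρ ij.2) := by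
  rw [mul_apply, ← Fintype.sum_prod_type'
    (f := fun a b => (D.c a b (D.y ρ m) : A) * (f a * g b))]
  obtain ⟨hr, hg⟩ := y_spec hρ h
  have hle : ∀ ij ∈ antidiagonal m, ij.1 * D.deg ρ ≤ n ∧ ij.2 * D.deg ρ ≤ n := by
    intro ij hij
    have := mem_antidiagonal.1 hij
    rw [← this, add_mul] at h
    constructor <;> omega
  have hinj : Set.InjOn (fun ij : ℕ × ℕ => (D.y ρ ij.1, D.y ρ ij.2)) (antidiagonal m : Set (ℕ × ℕ)) := by
    intro a ha b hb hab
    simp only [Prod.mk.injEq] at hab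
    exact Prod.ext (y_inj hρ (hle a ha).1 (hle b hb).1 hab.1)
      (y_inj hρ (hle a ha).2 (hle b hb).2 hab.2)
  rw [← sum_subset (subset_univ ((antidiagonal m).image fun ij : ℕ × ℕ => (D.y ρ ij.1, D.y ρ ij.2)))]
  · rw [sum_image hinj]
    refine sum_congr rfl fun ij hij => ?_
    have hh := hle ij hij
    have s1 := y_spec hρ hh.1
    have s2 := y_spec hρ hh.2
    have hm := mem_antidiagonal.1 hij
    obtain ⟨w, hw, gw⟩ := D.exists_of_gamma s1.2 s2.2
      (by rw [s1.1.deg, s2.1.deg, ← add_mul, hm]; exact h)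
    have := s1.1.mul s2.1 hw
    rw [hm] at this
    have hy := y_unique hρ this gw
    subst hy
    have := (D.gamma_of_c hw (by omega)).2.2
    simp only [this]; simp
  · rintro ⟨a, b⟩ _ hab
    simp only
    by_cases hc : D.c a b (D.y ρ m) = 0
    · simp [hc]
    · exfalso
      apply hab
      obtain ⟨i, j, hij, hi, hj⟩ := hr.comul hρ hc
      obtain ⟨ga, gb, _⟩ := D.gamma_of_c hc (by omega)
      exact mem_image.2 ⟨(i, j), mem_antidiagonal.2 hij, by
        simp only [y_unique hρ hi ga, y_unique hρ hj gb]⟩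

lemma Reach.cusp_eq {ρ' : J} (hρ : D.Cusp ρ) (hρ' : D.Cusp ρ') {i j w} (hi : 1 ≤ i)
    (h : D.Reach ρ i w) (h' : D.Reach ρ' j w) : ρ = ρ' := by
  obtain ⟨i, rfl⟩ : ∃ k, i = k + 1 := ⟨i - 1, by omega⟩
  obtain ⟨x, hx, hc⟩ := h
  obtain ⟨k, l, _, hk, _⟩ := h'.comul hρ' hc
  cases k with
  | zero => exact absurd hk hρ.ne_o
  | succ k =>
    obtain ⟨x', hx', hc'⟩ := hk
    rcases hρ.2 _ _ hc' with h | h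
    · exact absurd h hρ'.ne_o
    · subst h
      exact (D.c_o_right_ne hc').symm

variable (D)
/-- indicator of `y ρ m`, zero beyond the truncation -/
noncomputable def Yv (A : Type) [CommRing A] (ρ : J) (m : ℕ) : D.Cv A := fun w =>
  if m * D.deg ρ ≤ n ∧ w = D.y ρ m then 1 else 0

noncomputable def ev (ρ : J) (t : A) : D.Cv A := fun w =>
  ∑ m ∈ range (n + 1), t ^ m * D.Yv A ρ m w
variable {D}

lemma ev_y (hρ : D.Cusp ρ) (t : A) {m} (h : m * D.deg ρ ≤ n) : D.ev ρ t (D.y ρ m) = t ^ m := by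
  rw [ev]
  have hm : m ≤ n := le_trans (Nat.le_mul_of_pos_right m hρ.1) h
  rw [sum_eq_single m]
  · simp [Yv, h]
  · intro i _ hi
    rw [Yv, if_neg, mul_zero]
    rintro ⟨h1, h2⟩
    exact hi (y_inj hρ h1 h h2.symm)
  · intro h'; simp at h'; omega

lemma ev_ne (hρ : D.Cusp ρ) (t : A) {w} (h : ¬ ∃ m, D.Reach ρ m w ∧ D.γ w = 1) :
    D.ev ρ t w = 0 := by
  rw [ev]
  refine sum_eq_zero fun m _ => ?_
  rw [Yv, if_neg, mul_zero]
  rintro ⟨h1, rfl⟩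
  exact h ⟨m, y_spec hρ h1⟩

lemma ev_y_ne {ρ' : J} (hρ : D.Cusp ρ) (hρ' : D.Cusp ρ') (hne : ρ ≠ ρ') (t : A) {m}
    (h : m * D.deg ρ' ≤ n) : D.ev ρ t (D.y ρ' m) = if m = 0 then 1 else 0 := by
  split_ifs with h0
  · subst h0
    rw [y_zero hρ', ← y_zero hρ, ev_y hρ t (by simp), pow_zero]
  · apply ev_ne hρ
    rintro ⟨i, hi, _⟩
    exact hne ((y_spec hρ' h).1.cusp_eq hρ' hρ (by omega) hi).symm

lemma ev_hom (hρ : D.Cusp ρ) (t : A) : D.IsHom (D.ev ρ t) := by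
  constructor
  · rw [← y_zero hρ, ev_y hρ t (by simp), pow_zero]
  intro a b hab
  by_cases h : (∃ i, D.Reach ρ i a ∧ D.γ a = 1) ∧ (∃ j, D.Reach ρ j b ∧ D.γ b = 1)
  · obtain ⟨⟨i, hi, ga⟩, ⟨j, hj, gb⟩⟩ := h
    obtain ⟨w, hw, gw⟩ := D.exists_of_gamma ga gb hab
    have hij := hi.mul hj hw
    rw [sum_eq_single w]
    · rw [(D.gamma_of_c hw (by omega)).2.2]
      have ea := y_unique hρ hi ga
      have eb := y_unique hρ hj gb
      have ew := y_unique hρ hij gw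
      have da := hi.deg ▸ D.deg_le a
      have db := hj.deg ▸ D.deg_le b
      have dw := hij.deg ▸ D.deg_le w
      rw [← ea, ← eb, ← ew, ev_y hρ t da, ev_y hρ t db, ev_y hρ t dw, pow_add]
      simp
    · intro w' _ hne
      by_cases hc : D.c a b w' = 0
      · simp [hc]
      · rw [ev_ne hρ, mul_zero]
        rintro ⟨m, hm, gm⟩
        exact hne (D.unique_of_gamma hc gm hw gw)
    · simp
  · rw [sum_eq_zero]
    · symm
      rw [not_and_or] at h
      rcases h with h | h
      · rw [ev_ne hρ t h, zero_mul]
      · rw [ev_ne hρ t h, mul_zero]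
    · intro w _
      by_cases hc : D.c a b w = 0
      · simp [hc]
      · rw [ev_ne hρ, mul_zero]
        rintro ⟨m, hm, gm⟩
        apply h
        obtain ⟨i, j, _, hi, hj⟩ := hm.comul hρ hc
        obtain ⟨ga, gb, _⟩ := D.gamma_of_c hc (by omega)
        exact ⟨⟨i, hi, ga⟩, ⟨j, hj, gb⟩⟩

/-- δ on y -/
lemma δ_y_rec (hρ : D.Cusp ρ) {m} (h : m * D.deg ρ ≤ n) :
    ((q : ℚ) ^ D.deg ρ) ^ m * D.δ (D.y ρ m) = ∑ i ∈ range (m + 1), D.δ (D.y ρ i) := by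
  have e : D.δt (D.y ρ m) = _ := rfl
  have e2 := congrFun D.δt_eq (D.y ρ m)
  have e3 := mul_y hρ h D.δc D.γc
  rw [e3] at e2
  simp only [δt, deg_y hρ h] at e2
  rw [← pow_mul, mul_comm (D.deg ρ), e2, Nat.sum_antidiagonal_eq_sum_range_succ_mk]
  refine sum_congr rfl fun i hi => ?_
  have hi' : i ≤ m := by simp at hi; omega
  have : (m - i) * D.deg ρ ≤ n := le_trans (Nat.mul_le_mul_right _ (Nat.sub_le _ _)) h
  simp [δc, γc, (y_spec hρ this).2]

end PSH

/-- `D_k(Q) = Q^{C(k,2)}/ψ_k(Q)` -/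
noncomputable def psi (k : ℕ) (Q : ℚ) : ℚ := ∏ i ∈ Finset.range k, (Q ^ (i + 1) - 1)
noncomputable def Dk (Q : ℚ) (k : ℕ) : ℚ := Q ^ (k.choose 2) / psi k Q

lemma psi_pos {k : ℕ} {Q : ℚ} (hQ : 1 < Q) : 0 < psi k Q :=
  Finset.prod_pos fun i _ => by
    have := one_lt_pow₀ hQ (Nat.succ_ne_zero i)
    simp only [Nat.succ_eq_add_one] at this
    linarith

lemma psi_succ (k : ℕ) (Q : ℚ) : psi (k + 1) Q = psi k Q * (Q ^ (k + 1) - 1) := by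
  rw [psi, Finset.prod_range_succ, psi]

lemma sum_Dk {Q : ℚ} (hQ : 1 < Q) (m : ℕ) :
    ∑ i ∈ range (m + 1), Dk Q i = Q ^ m * Dk Q m := by
  induction m with
  | zero => simp [Dk, psi]
  | succ m ih =>
    rw [sum_range_succ, ih]
    have h1 : psi m Q ≠ 0 := (psi_pos hQ).ne'
    have h2 : Q ^ (m + 1) - 1 ≠ 0 := by
      have := one_lt_pow₀ hQ (Nat.succ_ne_zero m)
      simp only [Nat.succ_eq_add_one] at this
      linarith
    rw [Dk, Dk, psi_succ, Nat.choose_succ_succ' m 1, Nat.choose_one_right, pow_add]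
    field_simp
    ring

namespace PSH
variable {J : Type} [Fintype J] [DecidableEq J] {Z : Type} [CommGroup Z] {n q : ℕ}
  {D : PSH J Z n q} {ρ : J}

lemma δ_y (hρ : D.Cusp ρ) (m : ℕ) : m * D.deg ρ ≤ n →
    D.δ (D.y ρ m) = Dk ((q : ℚ) ^ D.deg ρ) m := by
  induction m using Nat.strong_induction_on with
  | _ m ih =>
  intro h
  have hQ := D.one_lt_qpow hρ.1
  cases m with
  | zero => simp [y_zero hρ, D.δ_o, Dk, psi]
  | succ m =>
    have e := δ_y_rec hρ h
    have e' := sum_Dk hQ (m + 1)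
    rw [sum_range_succ] at e e'
    have : ∑ i ∈ range (m + 1), D.δ (D.y ρ i) =
        ∑ i ∈ range (m + 1), Dk ((q : ℚ) ^ D.deg ρ) i := by
      refine sum_congr rfl fun i hi => ?_
      simp only [mem_range] at hi
      exact ih i hi (le_trans (Nat.mul_le_mul_right _ hi.le) h)
    rw [this] at e
    have h2 := one_lt_pow₀ hQ (Nat.succ_ne_zero m)
    simp only [Nat.succ_eq_add_one] at h2
    have h3 : (((q : ℚ) ^ D.deg ρ) ^ (m + 1) - 1) ≠ 0 := by linarith
    apply mul_left_cancel₀ h3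
    linarith

end PSH
end TCV

open scoped MatrixGroups
namespace TCV
open Finset
set_option linter.unusedSectionVars false
set_option linter.unusedSimpArgs false
set_option linter.unusedVariables false

/-! ### a coloured bialternant identity -/
section Bialt
variable {C : Type} [Fintype C] [DecidableEq C] {N : ℕ} {A : Type} [CommRing A]

noncomputable def geo (t : A) : PowerSeries A := PowerSeries.mk fun m => t ^ m

lemma geo_mul (t : A) : geo t * (1 - PowerSeries.C t * PowerSeries.X) = 1 := by
  ext m
  rw [mul_sub, mul_one, map_sub, ← mul_assoc]
  cases m with
  | zero => simp [geo]
  | succ m =>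
    rw [PowerSeries.coeff_succ_mul_X, PowerSeries.coeff_mul_C]
    simp [geo, PowerSeries.coeff_one, pow_succ]

noncomputable def Hs (t : Fin N × C → A) (ρ : C) : PowerSeries A :=
  ∏ x, if x.2 = ρ then geo (t x) else 1

noncomputable def Ep (t : Fin N × C → A) (i : Fin N × C) : Polynomial A :=
  ∏ x ∈ univ.erase i, if x.2 = i.2 then 1 - Polynomial.C (t x) * Polynomial.X else 1

lemma Ep_natDegree (t : Fin N × C → A) (i : Fin N × C) : (Ep t i).natDegree < N := by
  have h : (Ep t i).natDegree ≤ ∑ x ∈ univ.erase i, if x.2 = i.2 then 1 else 0 := by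
    refine (Polynomial.natDegree_prod_le _ _).trans (sum_le_sum fun x _ => ?_)
    split_ifs
    · refine (Polynomial.natDegree_sub_le _ _).trans ?_
      simp only [Polynomial.natDegree_one, zero_le, sup_of_le_right]
      exact Polynomial.natDegree_C_mul_le _ _ |>.trans Polynomial.natDegree_X_le
    · simp
  refine lt_of_le_of_lt h ?_
  have e : ∑ x ∈ (univ : Finset (Fin N × C)), (if x.2 = i.2 then 1 else 0) = N := by
    rw [Fintype.sum_prod_type]
    simp
  rw [← add_sum_erase _ _ (mem_univ i)] at e
  simp only [if_true] at e
  omega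

lemma Hs_mul_Ep (t : Fin N × C → A) (i : Fin N × C) :
    Hs t i.2 * (Ep t i : PowerSeries A) = geo (t i) := by
  have h : (Ep t i : PowerSeries A) = ∏ x ∈ univ.erase i,
      if x.2 = i.2 then 1 - PowerSeries.C (t x) * PowerSeries.X else 1 := by
    rw [Ep, ← Polynomial.coeToPowerSeries.ringHom_apply, map_prod]
    refine prod_congr rfl fun x _ => ?_
    split_ifs <;> simp [Polynomial.coeToPowerSeries.ringHom_apply]
  rw [h, Hs, ← mul_prod_erase _ _ (mem_univ i), if_pos rfl, mul_assoc, ← prod_mul_distrib]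
  rw [prod_eq_one, mul_one]
  intro x _
  split_ifs
  · exact geo_mul _
  · simp

/-- coloured Jacobi-Trudi matrix -/
noncomputable def JT (t : Fin N × C → A) (f : Fin N × C → ℕ) : Matrix (Fin N × C) (Fin N × C) A :=
  fun x' x => if x'.2 = x.2 ∧ (x'.1 : ℕ) ≤ f x then PowerSeries.coeff (f x - x'.1) (Hs t x.2) else 0

noncomputable def Al (t : Fin N × C → A) (f : Fin N × C → ℕ) : Matrix (Fin N × C) (Fin N × C) A :=
  fun i x => if i.2 = x.2 then t i ^ f x else 0

noncomputable def Em (t : Fin N × C → A) : Matrix (Fin N × C) (Fin N × C) A :=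
  fun i x' => if i.2 = x'.2 then (Ep t i).coeff x'.1 else 0

lemma Em_mul_JT (t : Fin N × C → A) (f : Fin N × C → ℕ) : Em t * JT t f = Al t f := by
  ext i x
  rw [Matrix.mul_apply, Al]
  split_ifs with hix
  · have key := congrArg (PowerSeries.coeff (f x)) (Hs_mul_Ep t i)
    rw [mul_comm, PowerSeries.coeff_mul, Nat.sum_antidiagonal_eq_sum_range_succ_mk] at key
    simp only [geo, PowerSeries.coeff_mk, Polynomial.coeff_coe] at key
    rw [← key, Fintype.sum_prod_type]
    have e1 : ∀ j : Fin N, ∑ ρ : C, Em t i (j, ρ) * JT t f (j, ρ) x =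
        if (j : ℕ) ≤ f x then (Ep t i).coeff j * PowerSeries.coeff (f x - j) (Hs t i.2) else 0 := by
      intro j
      rw [sum_eq_single x.2]
      · simp only [Em, JT, hix, if_true, true_and]
        split_ifs <;> simp
      · intro ρ _ hρ
        simp [JT, hρ]
      · simp
    simp only [e1]
    rw [Fin.sum_univ_eq_sum_range (fun j => if j ≤ f x then (Ep t i).coeff j *
      PowerSeries.coeff (f x - j) (Hs t i.2) else 0) N]
    have hz : ∀ j, N ≤ j → (Ep t i).coeff j = 0 := fun j hj =>
      Polynomial.coeff_eq_zero_of_natDegree_lt (lt_of_lt_of_le (Ep_natDegree t i) hj)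
    have s1 : ∑ j ∈ range N, (if j ≤ f x then (Ep t i).coeff j *
        PowerSeries.coeff (f x - j) (Hs t i.2) else 0) =
        ∑ j ∈ range (N + (f x + 1)), (if j ≤ f x then (Ep t i).coeff j *
        PowerSeries.coeff (f x - j) (Hs t i.2) else 0) := by
      refine sum_subset (by intro j; simp; omega) fun j _ hj => ?_
      rw [hz j (by simpa using hj)]; simp
    have s2 : ∑ j ∈ range (f x + 1), (Ep t i).coeff j * PowerSeries.coeff (f x - j) (Hs t i.2) =
        ∑ j ∈ range (N + (f x + 1)), (if j ≤ f x then (Ep t i).coeff j *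
        PowerSeries.coeff (f x - j) (Hs t i.2) else 0) := by
      have hsub : range (f x + 1) ⊆ range (N + (f x + 1)) := by intro j; simp; omega
      rw [← sum_subset hsub (f := fun j => if j ≤ f x then (Ep t i).coeff j *
        PowerSeries.coeff (f x - j) (Hs t i.2) else 0)]
      · refine sum_congr rfl fun j hj => ?_
        rw [if_pos (by simp at hj; omega)]
      · intro j _ hj
        exact if_neg (by simp at hj; omega)
    rw [s1, s2]
  · refine sum_eq_zero fun x' _ => ?_
    simp only [Em, JT]
    split_ifs with h1 h2
    · exact absurd (h1.trans h2.1) hix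
    all_goals simp

lemma perm_id_of_le {σ : Equiv.Perm (Fin N × C)} (h1 : ∀ x, (σ x).2 = x.2)
    (h2 : ∀ x, (σ x).1 ≤ x.1) : σ = 1 := by
  have e : ∑ x, ((σ x).1 : ℕ) = ∑ x : Fin N × C, (x.1 : ℕ) :=
    Equiv.sum_comp σ (fun x => (x.1 : ℕ))
  have := (sum_eq_sum_iff_of_le (fun x _ => Fin.le_def.1 (h2 x))).1 e
  ext x
  · simpa using this x (mem_univ x)
  · simpa using h1 x

lemma Hs_zero (t : Fin N × C → A) (ρ : C) : PowerSeries.coeff 0 (Hs t ρ) = 1 := by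
  rw [PowerSeries.coeff_zero_eq_constantCoeff_apply, Hs, map_prod]
  refine prod_eq_one fun x _ => ?_
  split_ifs
  · simp [geo, ← PowerSeries.coeff_zero_eq_constantCoeff_apply]
  · simp

lemma det_JT_delta (t : Fin N × C → A) : (JT t fun x => (x.1 : ℕ)).det = 1 := by
  rw [Matrix.det_apply, sum_eq_single 1]
  · simp [JT, Hs_zero]
  · intro σ _ hσ
    by_contra hne
    apply hσ
    have : ∀ x, JT t (fun x => (x.1 : ℕ)) (σ x) x ≠ 0 := by
      intro x hx
      apply hne
      rw [prod_eq_zero (i := x) (f := fun i => JT t (fun x => (x.1 : ℕ)) (σ i) i) (mem_univ x) hx, smul_zero]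
    apply perm_id_of_le
    · intro x
      by_contra h; exact this x (by simp [JT, h])
    · intro x
      by_contra h; exact this x (by simp only [JT]; rw [if_neg]; rintro ⟨_, h'⟩; exact h (Fin.le_def.2 h'))
  · simp

/-- the coloured bialternant formula -/
lemma bialternant (t : Fin N × C → A) (f : Fin N × C → ℕ) :
    (Al t fun x => (x.1 : ℕ)).det * (JT t f).det = (Al t f).det := by
  rw [← Em_mul_JT t f, ← Em_mul_JT t, Matrix.det_mul, Matrix.det_mul, det_JT_delta, mul_one]

/-- strictly increasing in every colour -/
def SM (f : Fin N × C → ℕ) : Prop := ∀ ρ, StrictMono fun j => f (j, ρ)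

lemma perm_id_of_SM {f f' : Fin N × C → ℕ} (hf : SM f) (hf' : SM f') {σ : Equiv.Perm (Fin N × C)}
    (hc : ∀ x, (σ x).2 = x.2) (h : ∀ x, f' x = f (σ x)) : σ = 1 := by
  have aux : ∀ {f f' : Fin N × C → ℕ} (hf : SM f) (hf' : SM f') {σ : Equiv.Perm (Fin N × C)}
    (hc : ∀ x, (σ x).2 = x.2) (h : ∀ x, f' x = f (σ x)), ∀ x, x.1 ≤ (σ x).1 := by
    intro f f' hf hf' σ hc h x
    have hm : StrictMono fun j => (σ (j, x.2)).1 := by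
      intro i j hij
      have h1 := hf' x.2 hij
      simp only [h] at h1
      have e1 : σ (i, x.2) = ((σ (i, x.2)).1, x.2) := Prod.ext rfl (hc _)
      have e2 : σ (j, x.2) = ((σ (j, x.2)).1, x.2) := Prod.ext rfl (hc _)
      rw [e1, e2] at h1
      exact (hf x.2).lt_iff_lt.1 h1
    exact hm.le_apply (x := x.1)
  have a1 := aux hf hf' hc h
  have : σ⁻¹ = 1 := by
    apply perm_id_of_le
    · intro x; have := hc (σ⁻¹ x); simpa using this.symm
    · intro x; have := a1 (σ⁻¹ x); simpa using this
  simpa using this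

/-- coefficients of alternants -/
lemma Al_det_eq (f : Fin N × C → ℕ) :
    (Al (A := MvPolynomial (Fin N × C) ℤ) MvPolynomial.X f).det =
    ∑ σ : Equiv.Perm (Fin N × C), if ∀ x, (σ x).2 = x.2 then
      Equiv.Perm.sign σ • MvPolynomial.monomial (Finsupp.equivFunOnFinite.symm fun x => f (σ x)) (1 : ℤ)
      else 0 := by
  rw [← Matrix.det_transpose, Matrix.det_apply]
  refine sum_congr rfl fun σ _ => ?_
  split_ifs with h
  · congr 1
    rw [MvPolynomial.monomial_eq, Finsupp.prod_fintype _ _ (by simp)]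
    simp only [map_one, one_mul]
    refine prod_congr rfl fun x _ => ?_
    simp [Al, h x, Matrix.transpose_apply]
  · push Not at h
    obtain ⟨x, hx⟩ := h
    rw [prod_eq_zero (mem_univ x), smul_zero]
    simp [Al, Matrix.transpose_apply, Ne.symm hx]

lemma coeff_Al {f f' : Fin N × C → ℕ} (hf : SM f) (hf' : SM f') :
    MvPolynomial.coeff (Finsupp.equivFunOnFinite.symm f')
      (Al (A := MvPolynomial (Fin N × C) ℤ) MvPolynomial.X f).det = if f = f' then 1 else 0 := by
  rw [Al_det_eq, MvPolynomial.coeff_sum, sum_eq_single 1]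
  · simp [MvPolynomial.coeff_monomial]
  · intro σ _ hσ
    split_ifs with h
    · rw [Units.smul_def, MvPolynomial.coeff_smul, MvPolynomial.coeff_monomial, if_neg, smul_zero]
      intro he
      apply hσ
      have he' := Finsupp.equivFunOnFinite.symm.injective he
      exact perm_id_of_SM hf hf' h fun x => (congrFun he' x).symm
    · simp
  · simp

end Bialt
end TCV

open scoped MatrixGroups
namespace TCV
open Finset
set_option linter.unusedSectionVars false
set_option linter.unusedSimpArgs false
set_option linter.unusedVariables false

namespace PSH
variable {J : Type} [Fintype J] [DecidableEq J] {Z : Type} [CommGroup Z] {n q : ℕ}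
  (D : PSH J Z n q) {A : Type} [CommRing A]

def Cu : Type := {ρ : J // D.Cusp ρ}
instance : DecidableEq D.Cu := inferInstanceAs (DecidableEq {ρ : J // D.Cusp ρ})
noncomputable instance : Fintype D.Cu := by
  classical exact inferInstanceAs (Fintype {ρ : J // D.Cusp ρ})

abbrev XX : Type := Fin n × D.Cu

/-- degree of colour of x -/
def dg (ρ : D.Cu) : ℕ := D.deg ρ.1

variable {D}

lemma dg_pos (ρ : D.Cu) : 1 ≤ D.dg ρ := ρ.2.1

/-- scalars -/
def cst (D : PSH J Z n q) : A →+* D.Cv A where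
  toFun a := fun w => if w = D.o then a else 0
  map_one' := rfl
  map_zero' := by ext w; simp [zero_apply]
  map_add' a b := by
    ext w
    change (if w = D.o then a + b else 0) = (if w = D.o then a else 0) + (if w = D.o then b else 0)
    split_ifs <;> simp
  map_mul' a b := by
    ext w
    change (if w = D.o then a * b else 0) = ∑ u, ∑ v, (D.c u v w : A) *
      ((if u = D.o then a else 0) * (if v = D.o then b else 0))
    rw [sum_eq_single D.o (fun x _ hx => by simp [hx]) (by simp),
      sum_eq_single D.o (fun x _ hx => by simp [hx]) (by simp)]
    simp [D.c_o_left, eq_comm]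

lemma cst_apply (a : A) (w : J) : D.cst a w = if w = D.o then a else 0 := rfl

lemma cst_mul (a : A) (f : D.Cv A) (w : J) : (D.cst a * f) w = a * f w := by
  rw [mul_apply]
  rw [sum_eq_single D.o (fun x _ hx => by simp [cst_apply, hx]) (by simp),
      sum_eq_single w (fun x _ hx => by simp [D.c_o_left, hx]) (by simp)]
  simp [D.c_o_left, cst_apply]

/-- base change -/
def cvMap (D : PSH J Z n q) (A : Type) [CommRing A] : D.Cv ℤ →+* D.Cv A where
  toFun f := fun w => (f w : A)
  map_one' := by ext w; simp [one_apply]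
  map_zero' := by ext w; simp [zero_apply]
  map_add' a b := by ext w; simp [add_apply]; rfl
  map_mul' a b := by ext w; simp [mul_apply]; rfl

lemma cvMap_apply (f : D.Cv ℤ) (w : J) : D.cvMap A f w = (f w : A) := rfl

lemma cvMap_Yv (ρ : J) (m : ℕ) : D.cvMap A (D.Yv ℤ ρ m) = D.Yv A ρ m := by
  ext w; simp [cvMap_apply, Yv]

/-! ### gradings -/

lemma prod_ne_zero_elim {M : Type*} [CommMonoid M] (κ : J → M) (h1 : κ D.o = 1)
    (hκ : ∀ {a b w}, D.c a b w ≠ 0 → κ w = κ a * κ b) {ι : Type*} (s : Finset ι) (f : ι → D.Cv A)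
    (m : ι → M) (hf : ∀ i ∈ s, ∀ w, f i w ≠ 0 → κ w = m i) :
    ∀ w, (∏ i ∈ s, f i) w ≠ 0 → κ w = ∏ i ∈ s, m i := by
  classical
  induction s using Finset.induction_on with
  | empty =>
    intro w hw
    rw [prod_empty, one_apply] at hw
    rw [prod_empty, ← h1]
    by_contra h
    apply hw
    rw [if_neg]; rintro rfl; exact h rfl
  | insert i s hi ih =>
    intro w hw
    rw [prod_insert hi] at hw ⊢
    obtain ⟨a, b, hc, ha, hb⟩ := D.mul_ne_zero_elim hw
    rw [hκ hc, hf i (mem_insert_self _ _) a ha, ih (fun j hj => hf j (mem_insert_of_mem hj)) b hb]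

lemma Yv_reach (ρ : D.Cu) {m : ℕ} {w : J} (h : D.Yv A ρ.1 m w ≠ 0) : D.Reach ρ.1 m w := by
  rw [Yv] at h
  have : m * D.deg ρ.1 ≤ n ∧ w = D.y ρ.1 m := by by_contra h'; exact h (if_neg h')
  rw [this.2]; exact (y_spec ρ.2 this.1).1

/-! ### pairing -/
def pair (f h : D.Cv A) : A := ∑ w, f w * h w

lemma pair_one {h : D.Cv A} (hh : D.IsHom h) : pair 1 h = 1 := by
  simp only [pair, one_apply]
  rw [sum_eq_single D.o (fun b _ hb => by simp [hb]) (by simp)]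
  simp [hh.1]

lemma pair_mul {f g h : D.Cv A} {a b : ℕ} (hf : ∀ w, f w ≠ 0 → D.deg w = a)
    (hg : ∀ w, g w ≠ 0 → D.deg w = b) (hab : a + b ≤ n) (hh : D.IsHom h) :
    pair (f * g) h = pair f h * pair g h := by
  have e : ∀ w, (f * g) w * h w = ∑ u, ∑ v, (f u * g v) * ((D.c u v w : A) * h w) := by
    intro w
    rw [mul_apply, sum_mul]
    refine sum_congr rfl fun u _ => ?_
    rw [sum_mul]
    refine sum_congr rfl fun v _ => ?_
    ring
  simp only [pair, e]
  rw [sum_comm, sum_mul_sum]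
  refine sum_congr rfl fun u _ => ?_
  rw [sum_comm]
  refine sum_congr rfl fun v _ => ?_
  rw [← mul_sum]
  by_cases h1 : f u = 0
  · simp [h1]
  by_cases h2 : g v = 0
  · simp [h2]
  rw [hh.2 u v (by rw [hf u h1, hg v h2]; exact hab)]
  ring

lemma deg_prod {ι : Type*} (s : Finset ι) (f : ι → D.Cv A) (m : ι → ℕ)
    (hf : ∀ i ∈ s, ∀ w, f i w ≠ 0 → D.deg w = m i) :
    ∀ w, (∏ i ∈ s, f i) w ≠ 0 → D.deg w = ∑ i ∈ s, m i := by
  intro w hw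
  have := prod_ne_zero_elim (M := Multiplicative ℕ) (fun w => Multiplicative.ofAdd (D.deg w))
    (by simp [D.deg_o]) (fun h => by rw [D.c_deg h]; rfl) s f
    (fun i => Multiplicative.ofAdd (m i)) (fun i hi w hw => by rw [hf i hi w hw]) w hw
  rw [← ofAdd_sum] at this
  exact Multiplicative.ofAdd.injective this

lemma pair_prod {ι : Type*} (s : Finset ι) (f : ι → D.Cv A) (m : ι → ℕ) {h : D.Cv A}
    (hh : D.IsHom h) (hf : ∀ i ∈ s, ∀ w, f i w ≠ 0 → D.deg w = m i) :
    ∑ i ∈ s, m i ≤ n → pair (∏ i ∈ s, f i) h = ∏ i ∈ s, pair (f i) h := by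
  classical
  induction s using Finset.induction_on with
  | empty => intro _; simp [pair_one hh]
  | insert i s hi ih =>
    intro hs
    rw [sum_insert hi] at hs
    rw [prod_insert hi, prod_insert hi, pair_mul (hf i (mem_insert_self _ _))
      (deg_prod s f m fun j hj => hf j (mem_insert_of_mem hj)) hs hh,
      ih (fun j hj => hf j (mem_insert_of_mem hj)) (by omega)]

lemma pair_Yv (ρ : J) {m : ℕ} (h : m * D.deg ρ ≤ n) (f : D.Cv A) :
    pair (D.Yv A ρ m) f = f (D.y ρ m) := by
  simp only [pair, Yv, h, true_and]
  rw [sum_eq_single (D.y ρ m) (fun b _ hb => by simp [hb]) (by simp)]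
  simp

/-! ### the elements `B f` -/
noncomputable def Bm (D : PSH J Z n q) (A : Type) [CommRing A] (f : D.XX → ℕ) :
    Matrix D.XX D.XX (D.Cv A) :=
  fun x' x => if x'.2 = x.2 ∧ (x'.1 : ℕ) ≤ f x then D.Yv A x.2.1 (f x - x'.1) else 0

noncomputable def B (D : PSH J Z n q) (A : Type) [CommRing A] (f : D.XX → ℕ) : D.Cv A :=
  (D.Bm A f).det

lemma cvMap_B (f : D.XX → ℕ) (w : J) : D.B A f w = (D.B ℤ f w : A) := by
  rw [← cvMap_apply, B, B, RingHom.map_det]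
  refine congrArg (fun M : Matrix D.XX D.XX (D.Cv A) => M.det w) ?_
  ext x' x : 2
  simp only [Bm, RingHom.mapMatrix_apply, Matrix.map_apply]
  split_ifs
  · rw [cvMap_Yv]
  · simp

lemma wt_perm {σ : Equiv.Perm D.XX} (h : ∀ x, (σ x).2 = x.2) {f : D.XX → ℕ}
    (hf : ∀ x, ((σ x).1 : ℕ) ≤ f x) :
    ∑ x, (f x - (σ x).1) * D.dg x.2 + ∑ x : D.XX, (x.1 : ℕ) * D.dg x.2 = ∑ x, f x * D.dg x.2 := by
  rw [← Equiv.sum_comp σ fun x : D.XX => (x.1 : ℕ) * D.dg x.2, ← sum_add_distrib]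
  refine sum_congr rfl fun x _ => ?_
  rw [h x, ← add_mul, Nat.sub_add_cancel (hf x)]

/-- pairing of `B f` with a multiplicative function is a determinant -/
lemma pair_B {f : D.XX → ℕ}
    (hw : ∑ x, f x * D.dg x.2 ≤ n + ∑ x : D.XX, (x.1 : ℕ) * D.dg x.2)
    {h : D.Cv A} (hh : D.IsHom h) (K : Matrix D.XX D.XX A)
    (hK : ∀ x' x, x'.2 = x.2 → (x'.1 : ℕ) ≤ f x → (f x - x'.1) * D.dg x.2 ≤ n →
      K x' x = h (D.y x.2.1 (f x - x'.1)))
    (hK0 : ∀ x' x, ¬ (x'.2 = x.2 ∧ (x'.1 : ℕ) ≤ f x) → K x' x = 0) :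
    pair (D.B A f) h = K.det := by
  have e : pair (D.B A f) h = ∑ σ : Equiv.Perm D.XX,
      Equiv.Perm.sign σ • pair (∏ x, D.Bm A f (σ x) x) h := by
    rw [B, Matrix.det_apply]
    simp only [pair, sum_apply, sum_mul, smul_sum]
    rw [sum_comm]
    refine sum_congr rfl fun σ _ => sum_congr rfl fun w _ => ?_
    rcases Int.units_eq_one_or (Equiv.Perm.sign σ) with h | h <;>
      simp [h, Units.smul_def, neg_apply]
  rw [e, Matrix.det_apply]
  refine sum_congr rfl fun σ _ => ?_
  congr 1
  by_cases hσ : ∀ x, (σ x).2 = x.2 ∧ ((σ x).1 : ℕ) ≤ f x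
  · have wt := wt_perm (fun x => (hσ x).1) (fun x => (hσ x).2)
    have hle : ∑ x, (f x - (σ x).1) * D.dg x.2 ≤ n := by omega
    have hB : ∀ x, D.Bm A f (σ x) x = D.Yv A x.2.1 (f x - (σ x).1) := fun x => by
      rw [Bm, if_pos (hσ x)]
    rw [pair_prod univ (fun x => D.Bm A f (σ x) x) (fun x => (f x - (σ x).1) * D.dg x.2) hh ?_ hle]
    · refine prod_congr rfl fun x _ => ?_
      have hx : (f x - (σ x).1) * D.dg x.2 ≤ n :=
        (single_le_sum (f := fun x => (f x - (σ x).1) * D.dg x.2) (by simp) (mem_univ x)).trans hle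
      rw [hB, pair_Yv _ hx, hK _ _ (hσ x).1 (hσ x).2 hx]
    · intro x _ w hw
      rw [hB] at hw
      exact (Yv_reach x.2 hw).deg
  · push Not at hσ
    obtain ⟨x, hx⟩ := hσ
    have hx' : ¬ ((σ x).2 = x.2 ∧ ((σ x).1 : ℕ) ≤ f x) := by rintro ⟨a, b⟩; have := hx a; omega
    rw [prod_eq_zero (i := x) (f := fun x => K (σ x) x) (mem_univ x) (hK0 _ _ hx'),
      prod_eq_zero (i := x) (f := fun x => D.Bm A f (σ x) x) (mem_univ x) (by rw [Bm, if_neg hx'])]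
    simp [pair, zero_apply]

/-! ### EV -/
noncomputable def EV (D : PSH J Z n q) (t : D.XX → A) : D.Cv A := ∏ x, D.ev x.2.1 (t x)

lemma EV_hom (t : D.XX → A) : D.IsHom (D.EV t) :=
  IsHom.prod D _ _ fun x _ => ev_hom x.2.2 _

lemma EV_y (t : D.XX → A) (ρ : D.Cu) {m : ℕ} (h : m * D.deg ρ.1 ≤ n) :
    D.EV t (D.y ρ.1 m) = PowerSeries.coeff m (Hs t ρ) := by
  have key : ∀ s : Finset D.XX, ∀ m, m * D.deg ρ.1 ≤ n →
      (∏ x ∈ s, D.ev x.2.1 (t x)) (D.y ρ.1 m) =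
      PowerSeries.coeff m (∏ x ∈ s, if x.2 = ρ then geo (t x) else 1) := by
    intro s
    induction s using Finset.induction_on with
    | empty =>
      intro m h
      rw [prod_empty, prod_empty, one_apply, PowerSeries.coeff_one, ← y_zero ρ.2]
      congr 1
      exact propext ⟨fun h' => y_inj ρ.2 h (by simp) h', fun h' => by rw [h']⟩
    | insert i s hi ih =>
      intro m h
      rw [prod_insert hi, prod_insert hi, mul_y ρ.2 h, PowerSeries.coeff_mul]
      refine sum_congr rfl fun ij hij => ?_
      have hm := mem_antidiagonal.1 hij
      have h1 : ij.1 * D.deg ρ.1 ≤ n := le_trans (Nat.mul_le_mul_right _ (by omega)) h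
      have h2 : ij.2 * D.deg ρ.1 ≤ n := le_trans (Nat.mul_le_mul_right _ (by omega)) h
      rw [ih ij.2 h2]
      congr 1
      split_ifs with hi2
      · rw [hi2, ev_y ρ.2 _ h1]; simp [geo]
      · rw [ev_y_ne i.2.2 ρ.2 (fun h => hi2 (Subtype.ext h)) _ h1, PowerSeries.coeff_one]
  exact key univ m h

lemma pair_B_EV {f : D.XX → ℕ}
    (hw : ∑ x, f x * D.dg x.2 ≤ n + ∑ x : D.XX, (x.1 : ℕ) * D.dg x.2) (t : D.XX → A) :
    pair (D.B A f) (D.EV t) = (JT t f).det := by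
  refine pair_B hw (EV_hom t) _ ?_ ?_
  · intro x' x h1 h2 h3
    rw [JT, if_pos ⟨h1, h2⟩, EV_y t x.2 h3]
  · intro x' x h
    rw [JT, if_neg h]

/-- expansion of EV in monomials -/
noncomputable def eα (D : PSH J Z n q) (α : D.XX → ℕ) : D.Cv ℤ := ∏ x, D.Yv ℤ x.2.1 (α x)

lemma eα_zero {α : D.XX → ℕ} {x : D.XX} (h : n < α x) : D.eα α = 0 := by
  refine prod_eq_zero (mem_univ x) ?_
  ext w
  rw [Yv, if_neg, zero_apply]
  rintro ⟨h1, _⟩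
  have := Nat.le_mul_of_pos_right (α x) x.2.2.1
  omega

lemma coeff_EV (w : J) (α : D.XX → ℕ) :
    MvPolynomial.coeff (Finsupp.equivFunOnFinite.symm α)
      (D.EV (A := MvPolynomial D.XX ℤ) MvPolynomial.X w) = D.eα α w := by
  have e1 : ∀ x : D.XX, D.ev x.2.1 (MvPolynomial.X (R := ℤ) x) =
      ∑ m ∈ range (n + 1), D.cst (MvPolynomial.X x ^ m) * D.Yv (MvPolynomial D.XX ℤ) x.2.1 m := by
    intro x
    ext w
    rw [sum_apply]
    simp only [ev, cst_mul]
  rw [EV]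
  simp only [e1]
  rw [prod_univ_sum, sum_apply, MvPolynomial.coeff_sum]
  have e2 : ∀ β : D.XX → ℕ, (∏ x, D.cst (MvPolynomial.X (R := ℤ) x ^ β x) *
      D.Yv (MvPolynomial D.XX ℤ) x.2.1 (β x)) w =
      MvPolynomial.monomial (Finsupp.equivFunOnFinite.symm β) (D.eα β w) := by
    intro β
    rw [prod_mul_distrib, ← map_prod, cst_mul]
    have : (∏ x : D.XX, D.Yv (MvPolynomial D.XX ℤ) x.2.1 (β x)) w = MvPolynomial.C (D.eα β w) := by
      rw [eq_intCast, ← cvMap_apply, eα, map_prod]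
      simp only [cvMap_Yv]
    rw [this, MvPolynomial.monomial_eq, Finsupp.prod_fintype _ _ (by simp), mul_comm]
    simp
  simp only [e2, MvPolynomial.coeff_monomial]
  by_cases hα : ∀ x, α x ≤ n
  · rw [sum_eq_single α]
    · simp
    · intro β _ hβ
      rw [if_neg]
      intro h; exact hβ (Finsupp.equivFunOnFinite.symm.injective h)
    · intro h
      exfalso; apply h
      rw [Fintype.mem_piFinset]
      intro x; simp; have := hα x; omega
  · push Not at hα
    obtain ⟨x, hx⟩ := hα
    rw [eα_zero hx, zero_apply]
    refine sum_eq_zero fun β hβ => if_neg ?_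
    intro h
    have := Finsupp.equivFunOnFinite.symm.injective h
    subst this
    rw [Fintype.mem_piFinset] at hβ
    have := hβ x
    simp at this; omega

/-- the alternating coefficient -/
lemma coeff_alt (w : J) (f : D.XX → ℕ) :
    MvPolynomial.coeff (Finsupp.equivFunOnFinite.symm f)
      ((Al (A := MvPolynomial D.XX ℤ) MvPolynomial.X fun x => (x.1 : ℕ)).det *
        D.EV (A := MvPolynomial D.XX ℤ) MvPolynomial.X w) = D.B ℤ f w := by
  rw [Al_det_eq, sum_mul, MvPolynomial.coeff_sum, B, Matrix.det_apply, sum_apply]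
  refine sum_congr rfl fun σ _ => ?_
  have sm : ∀ g : D.Cv ℤ, (Equiv.Perm.sign σ • g) w = Equiv.Perm.sign σ • g w := by
    intro g
    rcases Int.units_eq_one_or (Equiv.Perm.sign σ) with h | h <;>
      simp [h, Units.smul_def, neg_apply]
  rw [sm]
  by_cases hσ : ∀ x, (σ x).2 = x.2
  · rw [if_pos hσ, smul_mul_assoc, Units.smul_def, MvPolynomial.coeff_smul, ← Units.smul_def]
    congr 1
    rw [MvPolynomial.coeff_monomial_mul', one_mul]
    split_ifs with hle
    · have hle' : ∀ x, ((σ x).1 : ℕ) ≤ f x := fun x => hle x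
      have : (Finsupp.equivFunOnFinite.symm f - Finsupp.equivFunOnFinite.symm fun x => ((σ x).1 : ℕ))
        = Finsupp.equivFunOnFinite.symm (fun x => f x - (σ x).1) := by
        ext x; simp
      rw [this, coeff_EV, eα]
      refine congrArg (fun v : D.Cv ℤ => v w) ?_
      refine prod_congr rfl fun x _ => ?_
      rw [Bm, if_pos ⟨hσ x, hle' x⟩]
    · have : ∃ x, ¬ ((σ x).1 : ℕ) ≤ f x := by
        by_contra h; push Not at h; exact hle fun x => h x
      obtain ⟨x, hx⟩ := this
      rw [prod_eq_zero (i := x) (f := fun x => D.Bm ℤ f (σ x) x) (mem_univ x)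
        (by rw [Bm, if_neg]; rintro ⟨_, h⟩; exact hx h)]
      rfl
  · rw [if_neg hσ, zero_mul, MvPolynomial.coeff_zero]
    push Not at hσ
    obtain ⟨x, hx⟩ := hσ
    rw [prod_eq_zero (i := x) (f := fun x => D.Bm ℤ f (σ x) x) (mem_univ x)
        (by rw [Bm, if_neg]; rintro ⟨h, _⟩; exact hx h)]
    rw [zero_apply, smul_zero]

/-- weight condition -/
def Wt (f : D.XX → ℕ) : Prop := ∑ x, f x * D.dg x.2 ≤ n + ∑ x : D.XX, (x.1 : ℕ) * D.dg x.2

lemma B_orth {f f' : D.XX → ℕ} (hf : SM f) (hf' : SM f') (hw : Wt f) :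
    ∑ w, D.B ℤ f w * D.B ℤ f' w = if f = f' then 1 else 0 := by
  rw [← coeff_Al hf hf', ← bialternant, ← pair_B_EV hw, pair, mul_sum, MvPolynomial.coeff_sum]
  refine sum_congr rfl fun w _ => ?_
  rw [← coeff_alt w f', cvMap_B (A := MvPolynomial D.XX ℤ) f w, ← mul_assoc,
    mul_comm _ ((D.B ℤ f w : ℤ) : MvPolynomial D.XX ℤ), mul_assoc, ← zsmul_eq_mul,
    MvPolynomial.coeff_smul, smul_eq_mul]

/-- degree of the support of B -/
lemma B_ne_elim {f : D.XX → ℕ} {w : J} (h : D.B ℤ f w ≠ 0) :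
    ∃ σ : Equiv.Perm D.XX, (∀ x, (σ x).2 = x.2) ∧ (∀ x, ((σ x).1 : ℕ) ≤ f x) ∧
      (∏ x, D.Yv ℤ x.2.1 (f x - (σ x).1)) w ≠ 0 := by
  rw [B, Matrix.det_apply, sum_apply] at h
  obtain ⟨σ, _, hσ⟩ := exists_ne_zero_of_sum_ne_zero h
  have hne : (∏ x, D.Bm ℤ f (σ x) x) w ≠ 0 := by
    intro h0
    apply hσ
    rcases Int.units_eq_one_or (Equiv.Perm.sign σ) with h | h <;>
      simp [h, Units.smul_def, neg_apply, h0]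
  have hx : ∀ x, (σ x).2 = x.2 ∧ ((σ x).1 : ℕ) ≤ f x := by
    intro x
    by_contra hx
    apply hne
    rw [prod_eq_zero (i := x) (f := fun x => D.Bm ℤ f (σ x) x) (mem_univ x) (by rw [Bm, if_neg hx])]
    rfl
  refine ⟨σ, fun x => (hx x).1, fun x => (hx x).2, ?_⟩
  have : ∀ x, D.Bm ℤ f (σ x) x = D.Yv ℤ x.2.1 (f x - (σ x).1) := fun x => by rw [Bm, if_pos (hx x)]
  simpa only [this] using hne

lemma B_deg {f : D.XX → ℕ} {w : J} (h : D.B ℤ f w ≠ 0) :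
    D.deg w + ∑ x : D.XX, (x.1 : ℕ) * D.dg x.2 = ∑ x, f x * D.dg x.2 := by
  obtain ⟨σ, h1, h2, h3⟩ := B_ne_elim h
  rw [← wt_perm h1 h2]
  congr 1
  exact deg_prod _ _ _ (fun x _ w hw => (Yv_reach x.2 hw).deg) w h3

lemma B_omega {f : D.XX → ℕ} {w : J} (h : D.B ℤ f w ≠ 0) :
    D.ω w * ∏ x : D.XX, D.ω x.2.1 ^ (x.1 : ℕ) = ∏ x : D.XX, D.ω x.2.1 ^ f x := by
  obtain ⟨σ, h1, h2, h3⟩ := B_ne_elim h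
  have e := prod_ne_zero_elim (M := Z →* ℂ) D.ω D.ω_o (fun h => D.ω_mul h) univ (fun x : D.XX => D.Yv ℤ x.2.1 (f x - (σ x).1)) (fun x : D.XX => D.ω x.2.1 ^ (f x - (σ x).1))
    (fun x _ w hw => (Yv_reach x.2 hw).omega) w h3
  rw [e, ← Equiv.prod_comp σ fun x : D.XX => D.ω x.2.1 ^ (x.1 : ℕ), ← prod_mul_distrib]
  refine prod_congr rfl fun x _ => ?_
  rw [h1 x, ← pow_add, Nat.sub_add_cancel (h2 x)]

/-! ### completeness -/
lemma nonneg_mul {f g : D.Cv ℤ} (hf : ∀ w, 0 ≤ f w) (hg : ∀ w, 0 ≤ g w) (w : J) : 0 ≤ (f * g) w :=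
  sum_nonneg fun a _ => sum_nonneg fun b _ =>
    mul_nonneg (by positivity) (mul_nonneg (hf a) (hg b))

lemma pos_mul {f g : D.Cv ℤ} (hf : ∀ w, 0 ≤ f w) (hg : ∀ w, 0 ≤ g w) {a b w : J}
    (hc : D.c a b w ≠ 0) (ha : 0 < f a) (hb : 0 < g b) : 0 < (f * g) w := by
  rw [mul_apply]
  refine sum_pos' (fun a _ => sum_nonneg fun b _ =>
    mul_nonneg (by positivity) (mul_nonneg (hf a) (hg b))) ⟨a, mem_univ _, ?_⟩
  refine sum_pos' (fun b _ =>
    mul_nonneg (by positivity) (mul_nonneg (hf a) (hg b))) ⟨b, mem_univ _, ?_⟩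
  have : 0 < D.c a b w := Nat.pos_of_ne_zero hc
  positivity

lemma nonneg_prod {ι : Type*} (s : Finset ι) (f : ι → D.Cv ℤ) (h : ∀ i ∈ s, ∀ w, 0 ≤ f i w) :
    ∀ w, 0 ≤ (∏ i ∈ s, f i) w := by
  classical
  induction s using Finset.induction_on with
  | empty => intro w; rw [prod_empty, one_apply]; split_ifs <;> simp
  | insert i s hi ih =>
    rw [prod_insert hi]
    exact nonneg_mul (h i (mem_insert_self _ _)) (ih fun j hj => h j (mem_insert_of_mem hj))

lemma Yv_nonneg (ρ : J) (m : ℕ) (w : J) : 0 ≤ D.Yv ℤ ρ m w := by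
  rw [Yv]; split_ifs <;> simp

noncomputable def mono (D : PSH J Z n q) (k : D.Cu → ℕ) : D.Cv ℤ := ∏ ρ, D.Yv ℤ ρ.1 1 ^ k ρ

lemma mono_nonneg (k : D.Cu → ℕ) (w : J) : 0 ≤ D.mono k w := by
  refine nonneg_prod _ _ (fun ρ _ => ?_) w
  have := nonneg_prod (range (k ρ)) (fun _ => D.Yv ℤ ρ.1 1) (fun _ _ => Yv_nonneg _ _)
  simpa using this

lemma exists_mono (N : ℕ) : ∀ w, D.deg w = N → ∃ k : D.Cu → ℕ, 0 < D.mono k w := by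
  induction N using Nat.strong_induction_on with
  | _ N ih =>
  intro w hw
  by_cases h0 : w = D.o
  · refine ⟨0, ?_⟩
    simp [mono, one_apply, h0]
  by_cases hc : D.Cusp w
  · obtain ⟨r, hr⟩ : ∃ r : D.Cu, r.1 = w := ⟨⟨w, hc⟩, rfl⟩
    refine ⟨fun ρ => if ρ = r then 1 else 0, ?_⟩
    have hy : D.y w 1 = w := y_unique hc ⟨D.o, rfl, by simp [D.c_o_right]⟩ hc.gamma
    have : D.mono (fun ρ => if ρ = r then 1 else 0) = D.Yv ℤ w 1 := by
      rw [mono, prod_eq_single r]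
      · simp [hr]
      · intro b _ hb; simp [hb]
      · simp
    rw [this, Yv, hy]
    simp [D.deg_le w]
  · have hd : 1 ≤ D.deg w := by
      by_contra h; exact h0 ((D.deg_eq_zero w).1 (by omega))
    rw [Cusp] at hc
    push Not at hc
    obtain ⟨a, b, hab, ha, hb⟩ := hc hd
    have hda : D.deg a ≠ 0 := fun h => ha ((D.deg_eq_zero a).1 h)
    have hdb : D.deg b ≠ 0 := fun h => hb ((D.deg_eq_zero b).1 h)
    have := D.c_deg hab
    obtain ⟨k, hk⟩ := ih _ (by omega) a rfl
    obtain ⟨l, hl⟩ := ih _ (by omega) b rfl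
    refine ⟨k + l, ?_⟩
    have e : D.mono (k + l) = D.mono k * D.mono l := by
      simp [mono, pow_add, prod_mul_distrib]
    rw [e]
    exact pos_mul (mono_nonneg k) (mono_nonneg l) hab hk hl

lemma Yv_zero (ρ : D.Cu) : D.Yv ℤ ρ.1 0 = 1 := by
  ext w; rw [Yv, y_zero ρ.2, one_apply]; simp

lemma exists_eα (w : J) : ∃ α, D.eα α w ≠ 0 := by
  obtain ⟨k, hk⟩ := exists_mono (D := D) _ w rfl
  -- bound on k
  have hd : D.deg w = ∑ ρ, k ρ * D.dg ρ := by
    refine deg_prod _ _ _ (fun ρ _ w hw => ?_) w hk.ne'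
    have hw' : (∏ i ∈ range (k ρ), D.Yv ℤ ρ.1 1) w ≠ 0 := by simpa using hw
    have := deg_prod _ _ (fun _ => D.dg ρ) (fun i _ w hw => by
      have := (Yv_reach ρ hw).deg; rwa [one_mul] at this) w hw'
    simpa using this
  have hkn : ∀ ρ, k ρ ≤ n := by
    intro ρ
    have h1 := single_le_sum (f := fun ρ => k ρ * D.dg ρ) (by simp) (mem_univ ρ)
    have h2 := Nat.le_mul_of_pos_right (k ρ) (dg_pos ρ)
    have := D.deg_le w
    omega
  refine ⟨fun x => if (x.1 : ℕ) < k x.2 then 1 else 0, ?_⟩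
  have : D.eα (fun x => if (x.1 : ℕ) < k x.2 then 1 else 0) = D.mono k := by
    rw [eα, mono, Fintype.prod_prod_type_right]
    refine prod_congr rfl fun ρ _ => ?_
    have : ∀ j : Fin n, D.Yv ℤ ρ.1 (if (j : ℕ) < k ρ then 1 else 0) =
        (fun j : ℕ => if j < k ρ then D.Yv ℤ ρ.1 1 else 1) (j : ℕ) := by
      intro j; simp only; split_ifs
      · rfl
      · exact Yv_zero ρ
    simp only [this]
    rw [Fin.prod_univ_eq_prod_range (fun j : ℕ => if j < k ρ then D.Yv ℤ ρ.1 1 else 1) n,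
      ← prod_filter, prod_const]
    congr 1
    have : (range n).filter (fun j => j < k ρ) = range (k ρ) := by
      ext j; simp; have := hkn ρ; omega
    rw [this, card_range]
  rw [this]
  exact hk.ne'

lemma B_perm (f : D.XX → ℕ) (π : Equiv.Perm D.XX) (hπ : ∀ x, (π x).2 = x.2) :
    D.B ℤ (f ∘ π) = (Equiv.Perm.sign π : ℤ) • D.B ℤ f := by
  have : D.Bm ℤ (f ∘ π) = (D.Bm ℤ f).submatrix id π := by
    ext x' x : 2
    simp [Bm, hπ x]
  rw [B, this, Matrix.det_permute', B, zsmul_eq_mul]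

lemma B_inj {f : D.XX → ℕ} {w : J} (h : D.B ℤ f w ≠ 0) (ρ : D.Cu) :
    Function.Injective fun j => f (j, ρ) := by
  intro i j hij
  by_contra hne
  apply h
  rw [B, Matrix.det_zero_of_column_eq (i := (i, ρ)) (j := (j, ρ)) (by simpa using hne)]
  · rfl
  · intro x
    simp only at hij
    simp [Bm, hij]

lemma exists_B (w : J) : ∃ f : D.XX → ℕ, SM f ∧ D.B ℤ f w ≠ 0 := by
  obtain ⟨α, hα⟩ := exists_eα (D := D) w
  rw [← coeff_EV] at hα
  have h1 : D.EV (A := MvPolynomial D.XX ℤ) MvPolynomial.X w ≠ 0 := by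
    intro h; rw [h] at hα; simp at hα
  have hS : SM (C := D.Cu) (N := n) fun x => (x.1 : ℕ) := fun ρ i j hij => hij
  have h2 : (Al (C := D.Cu) (N := n) (A := MvPolynomial D.XX ℤ) MvPolynomial.X fun x => (x.1 : ℕ)).det ≠ 0 := by
    intro h
    have := coeff_Al hS hS
    rw [h] at this
    simp at this
  obtain ⟨m, hm⟩ := MvPolynomial.ne_zero_iff.1 (mul_ne_zero h2 h1)
  obtain ⟨f, rfl⟩ := Finsupp.equivFunOnFinite.symm.surjective m
  rw [coeff_alt] at hm
  let π : Equiv.Perm D.XX := 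
    { toFun := fun x => (Tuple.sort (fun j => f (j, x.2)) x.1, x.2)
      invFun := fun x => ((Tuple.sort (fun j => f (j, x.2))).symm x.1, x.2)
      left_inv := fun x => by simp
      right_inv := fun x => by simp }
  refine ⟨f ∘ π, ?_, ?_⟩
  · intro ρ
    have h1 : Monotone fun j => f (Tuple.sort (fun j => f (j, ρ)) j, ρ) :=
      Tuple.monotone_sort (fun j => f (j, ρ))
    refine h1.strictMono_of_injective ?_
    intro i j hij
    exact (Tuple.sort (fun j => f (j, ρ))).injective (B_inj hm ρ hij)
  · rw [B_perm f π fun x => rfl]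
    rcases Int.units_eq_one_or (Equiv.Perm.sign π) with h | h <;> simp [h, neg_apply, hm]

/-- B f is ± an indicator -/
lemma B_ind {f : D.XX → ℕ} (hf : SM f) (hw : Wt f) :
    ∃ w, (D.B ℤ f w = 1 ∨ D.B ℤ f w = -1) ∧ ∀ w', w' ≠ w → D.B ℤ f w' = 0 := by
  have e := B_orth hf hf hw
  rw [if_pos rfl] at e
  obtain ⟨w, _, h⟩ := exists_ne_zero_of_sum_ne_zero (s := univ)
    (f := fun w => D.B ℤ f w * D.B ℤ f w) (by rw [e]; simp)
  have hne : D.B ℤ f w ≠ 0 := left_ne_zero_of_mul h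
  have h1 : 1 ≤ D.B ℤ f w * D.B ℤ f w := by
    have := mul_self_pos.2 hne; omega
  rw [← add_sum_erase _ _ (mem_univ w)] at e
  have hs : 0 ≤ ∑ x ∈ univ.erase w, D.B ℤ f x * D.B ℤ f x := sum_nonneg fun x _ => mul_self_nonneg _
  have h2 : D.B ℤ f w * D.B ℤ f w = 1 := by linarith
  have h3 : ∑ x ∈ univ.erase w, D.B ℤ f x * D.B ℤ f x = 0 := by linarith
  refine ⟨w, ?_, ?_⟩
  · exact mul_self_eq_one_iff.1 h2
  · intro w' hw'
    have h4 := (sum_eq_zero_iff_of_nonneg (f := fun x => D.B ℤ f x * D.B ℤ f x)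
      (fun x _ => mul_self_nonneg _)).1 h3 w' (mem_erase.2 ⟨hw', mem_univ _⟩)
    exact mul_self_eq_zero.1 h4

end PSH
end TCV

open scoped MatrixGroups
namespace TCV
open Finset
set_option linter.unusedSectionVars false
set_option linter.unusedSimpArgs false
set_option linter.unusedVariables false


noncomputable def Lset (n : ℕ) : Finset (Fin n → ℕ) := by
  classical
  exact (Fintype.piFinset fun j : Fin n => range (j + n + 1)).filter fun l => StrictMono l

lemma mem_Lset {n : ℕ} {l : Fin n → ℕ} : l ∈ Lset n ↔ (∀ j, l j ≤ j + n) ∧ StrictMono l := by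
  classical
  simp [Lset, Fintype.mem_piFinset, Nat.lt_succ_iff]

def size {n : ℕ} (l : Fin n → ℕ) : ℕ := ∑ j, (l j - j)

lemma le_of_sm {n : ℕ} {l : Fin n → ℕ} (hl : StrictMono l) (j : Fin n) : (j : ℕ) ≤ l j := by
  obtain ⟨j, hj⟩ := j
  induction j with
  | zero => simp
  | succ j ih =>
    have := ih (by omega)
    have h2 : l ⟨j, by omega⟩ < l ⟨j + 1, hj⟩ := hl (by simp)
    simp only at *
    omega

/-- the matrix of `δ` -/
noncomputable def Md {n : ℕ} (Q : ℚ) (l : Fin n → ℕ) : Matrix (Fin n) (Fin n) ℚ :=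
  fun j' j => if (j' : ℕ) ≤ l j then Dk Q (l j - j') else 0

lemma Dk_ratio {Q : ℚ} (hQ : 1 < Q) (l r : ℕ) :
    (if r ≤ l then Dk Q (l - r) else 0) = Dk Q l * ∏ i ∈ range r, (Q - Q ^ (i + 1) / Q ^ l) := by
  have h0 : Q ≠ 0 := by positivity
  induction r with
  | zero => simp
  | succ r ih =>
    rw [prod_range_succ, ← mul_assoc, ← ih]
    by_cases h : r + 1 ≤ l
    · rw [if_pos h, if_pos (by omega)]
      obtain ⟨m, rfl⟩ : ∃ m, l = m + (r + 1) := ⟨l - (r + 1), by omega⟩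
      have e1 : m + (r + 1) - (r + 1) = m := by omega
      have e2 : m + (r + 1) - r = m + 1 := by omega
      have h1 : psi m Q ≠ 0 := (psi_pos hQ).ne'
      have h2 : Q ^ (m + 1) - 1 ≠ 0 := by
        have := one_lt_pow₀ hQ (n := m + 1) (by omega); linarith
      rw [e1, e2, Dk, Dk, psi_succ, Nat.choose_succ_succ' m 1, Nat.choose_one_right, pow_add]
      field_simp
      ring
    · rw [if_neg h]
      by_cases h' : r ≤ l
      · have : r = l := by omega
        subst this
        have : Q - Q ^ (r + 1) / Q ^ r = 0 := by field_simp; ring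
        rw [this, mul_zero]
      · rw [if_neg h', zero_mul]

noncomputable def Hp {n : ℕ} (l : Fin n → ℕ) : Polynomial ℤ :=
  ∏ j, ∏ m ∈ Icc 1 (l j) \ (Iio j).image (fun i => l j - l i), (Polynomial.X ^ m - 1)

lemma psi_Icc (k : ℕ) (Q : ℚ) : psi k Q = ∏ m ∈ Icc 1 k, (Q ^ m - 1) := by
  rw [psi, range_eq_Ico, prod_Ico_add' (fun m => Q ^ m - 1) 0 k 1]
  rfl

lemma Hp_eval {n : ℕ} {l : Fin n → ℕ} (hl : StrictMono l) (Q : ℚ) :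
    Polynomial.aeval Q (Hp l) * ∏ j, ∏ i ∈ Iio j, (Q ^ (l j - l i) - 1) = ∏ j, psi (l j) Q := by
  rw [Hp, map_prod, ← prod_mul_distrib]
  refine prod_congr rfl fun j _ => ?_
  rw [psi_Icc, map_prod]
  have hsub : (Iio j).image (fun i => l j - l i) ⊆ Icc 1 (l j) := by
    intro m hm
    simp only [mem_image, mem_Iio] at hm
    obtain ⟨i, hi, rfl⟩ := hm
    have := hl hi
    simp; omega
  rw [← prod_sdiff hsub]
  congr 1
  · refine prod_congr rfl fun m _ => by simp
  · rw [prod_image]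
    intro i hi i' hi' h
    simp only [coe_Iio, Set.mem_Iio] at hi hi'
    have h1 := hl hi
    have h2 := hl hi'
    apply hl.injective
    simp only at h
    omega

lemma choose_two_id {l j : ℕ} (h : j ≤ l) :
    (l - j).choose 2 + j * l = l.choose 2 + ∑ i ∈ range j, (i + 1) := by
  obtain ⟨m, rfl⟩ := Nat.exists_eq_add_of_le h
  induction j with
  | zero => simp
  | succ j ih =>
    have := ih (by omega)
    rw [sum_range_succ]
    have e : j + 1 + m - (j + 1) = j + m - j := by omega
    have e2 : (j + 1 + m).choose 2 = (j + m) + (j + m).choose 2 := by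
      rw [show j + 1 + m = (j + m) + 1 by ring, Nat.choose_succ_succ' _ 1, Nat.choose_one_right]
    rw [e, e2]
    nlinarith

lemma Md_det {n : ℕ} {l : Fin n → ℕ} (hl : StrictMono l) {Q : ℚ} (hQ : 1 < Q) :
    (Md Q l).det * Polynomial.aeval Q (Hp l) = Q ^ ∑ j : Fin n, (l j - j).choose 2 := by
  have h0 : Q ≠ 0 := by positivity
  let p : Fin n → Polynomial ℚ := fun j => ∏ i ∈ range j, (Polynomial.X - Polynomial.C (Q ^ i)⁻¹)
  have hp1 : ∀ j, (p j).natDegree = j := fun j => by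
    simp only [p]
    rw [Polynomial.natDegree_prod_of_monic _ _ fun i _ => Polynomial.monic_X_sub_C _]
    simp
  have hp2 : ∀ j, (p j).Monic := fun j =>
    Polynomial.monic_prod_of_monic _ _ fun i _ => Polynomial.monic_X_sub_C _
  have hv := Matrix.det_eval_matrixOfPolynomials_eq_det_vandermonde
    (fun j => (Q ^ l j)⁻¹) p hp1 hp2
  have hM : (Md Q l).transpose = Matrix.of fun j j' => Dk Q (l j) *
      (Matrix.of fun j j' : Fin n => (∏ i ∈ range j', (-Q ^ (i + 1))) *
        (Matrix.of fun i j => (p j).eval ((fun j => (Q ^ l j)⁻¹) i)) j j') j j' := by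
    ext j j'
    simp only [Matrix.transpose_apply, Matrix.of_apply, Md]
    rw [Dk_ratio hQ]
    congr 1
    simp only [p, Polynomial.eval_prod, ← prod_mul_distrib]
    refine prod_congr rfl fun i _ => ?_
    simp only [Polynomial.eval_sub, Polynomial.eval_X, Polynomial.eval_C]
    field_simp
    ring
  rw [← Matrix.det_transpose, hM, Matrix.det_mul_column, Matrix.det_mul_row, ← hv,
    Matrix.det_vandermonde]
  have sw : ∏ i : Fin n, ∏ j ∈ Ioi i, ((Q ^ l j)⁻¹ - (Q ^ l i)⁻¹) =
      ∏ j : Fin n, ∏ i ∈ Iio j, ((Q ^ l j)⁻¹ - (Q ^ l i)⁻¹) :=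
    prod_comm' (by simp)
  rw [sw]
  have hne : ∏ j, ∏ i ∈ Iio j, (Q ^ (l j - l i) - 1) ≠ 0 := by
    refine prod_ne_zero_iff.2 fun j _ => prod_ne_zero_iff.2 fun i hi => ?_
    have := hl (mem_Iio.1 hi)
    have := one_lt_pow₀ hQ (n := l j - l i) (by omega); linarith
  rw [← mul_left_inj' hne, mul_assoc, Hp_eval hl Q, ← prod_pow_eq_pow_sum, ← prod_mul_distrib,
    ← prod_mul_distrib, ← prod_mul_distrib, ← prod_mul_distrib]
  refine prod_congr rfl fun j _ => ?_
  have hps : psi (l j) Q ≠ 0 := (psi_pos hQ).ne'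
  have e1 : ∏ i ∈ range (j : ℕ), (-Q ^ (i + 1)) = ∏ i ∈ Iio j, (-Q ^ ((i : ℕ) + 1)) := by
    have : range (j : ℕ) = (Iio j).map Fin.valEmbedding := by
      rw [Fin.map_valEmbedding_Iio]; ext; simp
    rw [this, prod_map]; rfl
  have hb := choose_two_id (le_of_sm hl j)
  have e3 : ∑ i ∈ range (j : ℕ), (i + 1) = ∑ i ∈ Iio j, ((i : ℕ) + 1) := by
    have : range (j : ℕ) = (Iio j).map Fin.valEmbedding := by
      rw [Fin.map_valEmbedding_Iio]; ext; simp
    rw [this, sum_map]; rfl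
  rw [e1, Dk]
  have e2 : (∏ i ∈ Iio j, (-Q ^ ((i : ℕ) + 1))) * ∏ i ∈ Iio j, ((Q ^ l j)⁻¹ - (Q ^ l i)⁻¹) =
     (Q ^ (∑ i ∈ Iio j, ((i : ℕ) + 1)) / Q ^ (j * l j)) * ∏ i ∈ Iio j, (Q ^ (l j - l i) - 1) := by
    have : Q ^ ((j : ℕ) * l j) = ∏ i ∈ Iio j, Q ^ l j := by
      rw [prod_const, Fin.card_Iio, ← pow_mul, mul_comm]
    rw [this, ← prod_pow_eq_pow_sum, ← prod_div_distrib, ← prod_mul_distrib, ← prod_mul_distrib]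
    refine prod_congr rfl fun i hi => ?_
    have hij := hl (mem_Iio.1 hi)
    obtain ⟨m, hm⟩ := Nat.exists_eq_add_of_lt hij
    have e : l j - l i = m + 1 := by omega
    rw [e, hm, add_assoc, pow_add Q (l i)]
    field_simp
    ring
  have e4 : Q ^ (l j - ↑j).choose 2 * Q ^ ((j : ℕ) * l j) =
      Q ^ (l j).choose 2 * Q ^ ∑ i ∈ Iio j, ((i : ℕ) + 1) := by
    rw [← pow_add, ← pow_add, hb, e3]
  set R := ∏ i ∈ Iio j, (Q ^ (l j - l i) - 1)
  rw [e2, div_mul_eq_mul_div, div_mul_eq_mul_div, div_mul_eq_mul_div, div_eq_iff hps,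
    mul_div_assoc', div_mul_eq_mul_div, div_eq_iff (by positivity)]
  linear_combination (-R * psi (l j) Q) * e4

lemma choose_two_add (a b : ℕ) : a.choose 2 + b.choose 2 ≤ (a + b).choose 2 := by
  have := choose_two_id (l := a + b) (j := b) (by omega)
  have h := choose_two_id (l := b) (j := b) le_rfl
  simp at h
  simp only [Nat.add_sub_cancel, mul_add] at this
  have := Nat.zero_le (b * a)
  omega

lemma choose_two_sum {ι : Type*} (s : Finset ι) (f : ι → ℕ) :
    ∑ i ∈ s, (f i).choose 2 ≤ (∑ i ∈ s, f i).choose 2 := by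
  classical
  induction s using Finset.induction_on with
  | empty => simp
  | insert i s hi ih =>
    rw [sum_insert hi, sum_insert hi]
    exact (Nat.add_le_add_left ih _).trans (choose_two_add _ _)

/-- the matrix of `γ` -/
noncomputable def Mg {n : ℕ} (l : Fin n → ℕ) : Matrix (Fin n) (Fin n) ℚ :=
  fun j' j => if (j' : ℕ) ≤ l j then 1 else 0

lemma Mg_det_one {n : ℕ} {l : Fin n → ℕ} (h : ∀ j : Fin n, (j : ℕ) + 1 < n → l j = j)
    (hl : StrictMono l) : (Mg l).det = 1 := by
  rw [Matrix.det_of_isUpperTriangular]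
  · refine prod_eq_one fun j _ => ?_
    rw [Mg, if_pos (le_of_sm hl j)]
  · intro i j hij
    simp only [id] at hij
    rw [Mg, h j (by have := i.2; have : (j : ℕ) < i := hij; omega), if_neg]
    have : (j : ℕ) < i := hij
    omega

lemma Mg_det_zero {n : ℕ} {l : Fin n → ℕ} (hl : StrictMono l) {j : Fin n} (hj : (j : ℕ) + 1 < n)
    (h : l j ≠ j) : (Mg l).det = 0 := by
  have hj1 := le_of_sm hl j
  have key : ∀ k : ℕ, ∀ hk : j + k < n, j + k + 1 ≤ l ⟨j + k, hk⟩ := by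
    intro k
    induction k with
    | zero => intro hk; simp; omega
    | succ k ih =>
      intro hk
      have := ih (by omega)
      have h2 : l ⟨j + k, by omega⟩ < l ⟨j + (k + 1), hk⟩ := hl (by simp)
      omega
  let a : Fin n := ⟨n - 2, by omega⟩
  let b : Fin n := ⟨n - 1, by omega⟩
  have ha : n - 1 ≤ l a := by
    have := key (n - 2 - j) (by omega)
    have e : (⟨j + (n - 2 - j), by omega⟩ : Fin n) = a := by simp [a]; omega
    rw [e] at this
    omega
  have hb : n - 1 ≤ l b := by
    have : l a < l b := hl (by simp [a, b]; omega)
    omega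
  refine Matrix.det_zero_of_column_eq (i := a) (j := b) (by simp [a, b]; omega) fun i => ?_
  have := i.2
  rw [Mg, Mg, if_pos (by omega), if_pos (by omega)]

end TCV

open scoped MatrixGroups
namespace TCV
open Finset
set_option linter.unusedSectionVars false
set_option linter.unusedSimpArgs false
set_option linter.unusedVariables false

namespace PSH
variable {J : Type} [Fintype J] [DecidableEq J] {Z : Type} [CommGroup Z] {n q : ℕ}
  {D : PSH J Z n q}

def flat (fam : D.Cu → Fin n → ℕ) : D.XX → ℕ := fun x => fam x.2 x.1

lemma flat_SM {fam : D.Cu → Fin n → ℕ} (h : ∀ ρ, StrictMono (fam ρ)) : SM (flat fam) := h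

lemma flat_sum {fam : D.Cu → Fin n → ℕ} (h : ∀ ρ, StrictMono (fam ρ)) :
    ∑ x, flat fam x * D.dg x.2 =
      ∑ ρ, D.dg ρ * size (fam ρ) + ∑ x : D.XX, (x.1 : ℕ) * D.dg x.2 := by
  rw [Fintype.sum_prod_type_right, Fintype.sum_prod_type_right, ← sum_add_distrib]
  refine sum_congr rfl fun ρ _ => ?_
  rw [size, mul_sum, ← sum_add_distrib]
  refine sum_congr rfl fun j _ => ?_
  have := le_of_sm (h ρ) j
  obtain ⟨m, hm⟩ := Nat.exists_eq_add_of_le this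
  simp only [flat, hm, Nat.add_sub_cancel_left]
  ring

lemma flat_Wt {fam : D.Cu → Fin n → ℕ} (h : ∀ ρ, StrictMono (fam ρ))
    (hs : ∑ ρ, D.dg ρ * size (fam ρ) ≤ n) : Wt (flat fam) := by
  rw [Wt, flat_sum h]; omega

lemma sum_formula {k : ℕ} (hk : k ≤ n) (G : J → ℂ) (Gr : D.Cu → (Fin n → ℕ) → ℂ)
    (hG : ∀ fam : D.Cu → Fin n → ℕ, (∀ ρ, fam ρ ∈ Lset n) → ∑ ρ, D.dg ρ * size (fam ρ) ≤ n →
      ∀ w, D.B ℤ (flat fam) w ≠ 0 → G w = ∏ ρ, Gr ρ (fam ρ)) :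
    ∑ w with D.deg w = k, G w = Polynomial.coeff (∏ ρ : D.Cu, ∑ l ∈ Lset n,
      Polynomial.C (Gr ρ l) * Polynomial.X ^ (D.dg ρ * size l)) k := by
  classical
  rw [prod_univ_sum, Polynomial.finsetSum_coeff]
  have e : ∀ fam : D.Cu → Fin n → ℕ, Polynomial.coeff (∏ ρ : D.Cu,
      Polynomial.C (Gr ρ (fam ρ)) * Polynomial.X ^ (D.dg ρ * size (fam ρ))) k =
      if ∑ ρ, D.dg ρ * size (fam ρ) = k then ∏ ρ, Gr ρ (fam ρ) else 0 := by
    intro fam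
    rw [prod_mul_distrib, ← map_prod, prod_pow_eq_pow_sum, Polynomial.coeff_C_mul,
      Polynomial.coeff_X_pow]
    simp [eq_comm]
  simp only [e]
  rw [← sum_filter]
  have hsm : ∀ fam ∈ (Fintype.piFinset fun _ : D.Cu => Lset n).filter
      (fun fam => ∑ ρ, D.dg ρ * size (fam ρ) = k), (∀ ρ, fam ρ ∈ Lset n) ∧
        (∀ ρ, StrictMono (fam ρ)) ∧ ∑ ρ, D.dg ρ * size (fam ρ) = k := by
    intro fam hf
    rw [mem_filter, Fintype.mem_piFinset] at hf
    exact ⟨hf.1, fun ρ => (mem_Lset.1 (hf.1 ρ)).2, hf.2⟩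
  have hex : ∀ fam ∈ (Fintype.piFinset fun _ : D.Cu => Lset n).filter
      (fun fam => ∑ ρ, D.dg ρ * size (fam ρ) = k), ∃ w, D.B ℤ (flat fam) w ≠ 0 ∧
        ∀ w', w' ≠ w → D.B ℤ (flat fam) w' = 0 := by
    intro fam hf
    obtain ⟨h1, h2, h3⟩ := hsm fam hf
    obtain ⟨w, hw, hw'⟩ := B_ind (flat_SM h2) (flat_Wt h2 (by omega))
    exact ⟨w, by rcases hw with h | h <;> rw [h] <;> simp, hw'⟩
  choose W hW1 hW2 using hex
  symm
  refine sum_bij W ?_ ?_ ?_ ?_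
  · intro fam hf
    obtain ⟨h1, h2, h3⟩ := hsm fam hf
    have := B_deg (hW1 fam hf)
    rw [flat_sum h2] at this
    simp; omega
  · intro fam hf fam' hf' hww
    obtain ⟨h1, h2, h3⟩ := hsm fam hf
    obtain ⟨h1', h2', h3'⟩ := hsm fam' hf'
    have := B_orth (flat_SM h2) (flat_SM h2') (flat_Wt h2 (by omega))
    rw [sum_eq_single (W fam hf)] at this
    · have hne : flat fam = flat fam' := by
        by_contra hne
        rw [if_neg hne] at this
        have hh := hW1 fam' hf'
        rw [← hww] at hh
        exact mul_ne_zero (hW1 fam hf) hh this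
      funext ρ j
      exact congrFun hne (j, ρ)
    · intro w _ hw
      rw [hW2 fam hf w hw, zero_mul]
    · simp
  · intro w hw
    simp only [mem_filter, mem_univ, true_and] at hw
    obtain ⟨f, hf, hB⟩ := exists_B (D := D) w
    let fam : D.Cu → Fin n → ℕ := fun ρ j => f (j, ρ)
    have hff : flat fam = f := rfl
    have h2 : ∀ ρ, StrictMono (fam ρ) := hf
    have hd := B_deg hB
    rw [← hff, flat_sum h2] at hd
    have hs : ∑ ρ, D.dg ρ * size (fam ρ) = k := by omega
    have hmem : fam ∈ (Fintype.piFinset fun _ : D.Cu => Lset n).filter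
      (fun fam => ∑ ρ, D.dg ρ * size (fam ρ) = k) := by
      rw [mem_filter, Fintype.mem_piFinset]
      refine ⟨fun ρ => mem_Lset.2 ⟨fun j => ?_, h2 ρ⟩, hs⟩
      have a1 := single_le_sum (f := fun ρ => D.dg ρ * size (fam ρ)) (by simp) (mem_univ ρ)
      have a2 := single_le_sum (f := fun j : Fin n => fam ρ j - j) (by simp) (mem_univ j)
      have a3 := Nat.le_mul_of_pos_left (size (fam ρ)) (dg_pos ρ)
      rw [size] at a3 a1
      omega
    refine ⟨fam, hmem, ?_⟩
    by_contra hne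
    exact hB (hW2 fam hmem w (fun h => hne h.symm))
  · intro fam hf
    obtain ⟨h1, h2, h3⟩ := hsm fam hf
    exact (hG fam h1 (by omega) _ (hW1 fam hf)).symm

/-- value of a hom at W -/
lemma hom_val {fam : D.Cu → Fin n → ℕ} (h2 : ∀ ρ, StrictMono (fam ρ))
    (hs : ∑ ρ, D.dg ρ * size (fam ρ) ≤ n) {w : J} (hw : D.B ℤ (flat fam) w ≠ 0)
    {h : D.Cv ℚ} (hh : D.IsHom h) (M : D.Cu → Matrix (Fin n) (Fin n) ℚ)
    (hM : ∀ ρ (j' j : Fin n), (j' : ℕ) ≤ fam ρ j → (fam ρ j - j') * D.dg ρ ≤ n →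
      M ρ j' j = h (D.y ρ.1 (fam ρ j - j')))
    (hM0 : ∀ ρ (j' j : Fin n), ¬ (j' : ℕ) ≤ fam ρ j → M ρ j' j = 0) :
    h w ^ 2 = ∏ ρ, (M ρ).det ^ 2 := by
  obtain ⟨w0, h1, h3⟩ := B_ind (flat_SM h2) (flat_Wt h2 hs)
  have hww : w = w0 := by by_contra hne; exact hw (h3 w hne)
  subst hww
  have e := pair_B (flat_Wt h2 hs) hh (Matrix.blockDiagonal M) ?_ ?_
  · rw [Matrix.det_blockDiagonal, pair, sum_eq_single w] at e
    · rw [cvMap_B] at e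
      rw [prod_pow, ← e]
      rcases h1 with h | h <;> simp [h]
    · intro w' _ hne; rw [cvMap_B, h3 w' hne]; simp
    · simp
  · rintro ⟨j', ρ'⟩ ⟨j, ρ⟩ h1 h2 h3
    simp only at h1; subst h1
    rw [Matrix.blockDiagonal_apply_eq]
    exact hM _ _ _ h2 h3
  · rintro ⟨j', ρ'⟩ ⟨j, ρ⟩ h
    by_cases h1 : ρ' = ρ
    · subst h1
      rw [Matrix.blockDiagonal_apply_eq]
      exact hM0 _ _ _ fun h' => h ⟨rfl, h'⟩
    · rw [Matrix.blockDiagonal_apply_ne]; exact h1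

lemma delta_val {fam : D.Cu → Fin n → ℕ} (h2 : ∀ ρ, StrictMono (fam ρ))
    (hs : ∑ ρ, D.dg ρ * size (fam ρ) ≤ n) {w : J} (hw : D.B ℤ (flat fam) w ≠ 0) :
    D.δ w ^ 2 = ∏ ρ, (Md ((q : ℚ) ^ D.dg ρ) (fam ρ)).det ^ 2 := by
  refine hom_val h2 hs hw D.δc_hom _ ?_ ?_
  · intro ρ j' j h1 h2
    rw [Md, if_pos h1]
    exact (δ_y ρ.2 _ h2).symm
  · intro ρ j' j h1
    rw [Md, if_neg h1]

lemma gamma_val {fam : D.Cu → Fin n → ℕ} (h2 : ∀ ρ, StrictMono (fam ρ))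
    (hs : ∑ ρ, D.dg ρ * size (fam ρ) ≤ n) {w : J} (hw : D.B ℤ (flat fam) w ≠ 0) :
    (D.γ w : ℚ) ^ 2 = ∏ ρ, (Mg (fam ρ)).det ^ 2 := by
  refine hom_val h2 hs hw D.γc_hom _ ?_ ?_
  · intro ρ j' j h1 h2
    rw [Mg, if_pos h1, γc, (y_spec ρ.2 h2).2]; simp
  · intro ρ j' j h1
    rw [Mg, if_neg h1]

lemma omega_val {fam : D.Cu → Fin n → ℕ} (h2 : ∀ ρ, StrictMono (fam ρ)) {w : J}
    (hw : D.B ℤ (flat fam) w ≠ 0) (z : Z) :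
    D.ω w z = ∏ ρ : D.Cu, D.ω ρ.1 z ^ size (fam ρ) := by
  have e := congrArg (fun χ : Z →* ℂ => χ z) (B_omega hw)
  simp only [MonoidHom.mul_apply] at e
  have ev : ∀ φ : D.XX → (Z →* ℂ), (∏ x, φ x) z = ∏ x, φ x z := fun φ => by
    rw [MonoidHom.finsetProd_apply]
  rw [ev, ev] at e
  have hne : ∀ ρ : D.Cu, D.ω ρ.1 z ≠ 0 := fun ρ => ((Group.isUnit z).map (D.ω ρ.1)).ne_zero
  have hne' : ∏ x : D.XX, (D.ω x.2.1 ^ (x.1 : ℕ)) z ≠ 0 := by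
    refine prod_ne_zero_iff.2 fun x _ => ?_
    simpa using pow_ne_zero _ (hne x.2)
  rw [← mul_left_inj' hne', e, Fintype.prod_prod_type_right, Fintype.prod_prod_type_right,
    ← prod_mul_distrib]
  refine prod_congr rfl fun ρ _ => ?_
  rw [size, ← prod_pow_eq_pow_sum, ← prod_mul_distrib]
  refine prod_congr rfl fun j _ => ?_
  have := le_of_sm (h2 ρ) j
  simp only [flat, MonoidHom.pow_apply]
  rw [← pow_add, Nat.sub_add_cancel this]

end PSH
end TCV

open scoped MatrixGroups
namespace TCV
open Finset
set_option linter.unusedSectionVars false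
set_option linter.unusedSimpArgs false
set_option linter.unusedVariables false

section universal
open Polynomial

/-- admissible families of polynomials -/
def Adm (s : ℕ) (p : ℕ → ℚ[X]) : Prop :=
  ∃ G : ℕ → ℤ[X], ∀ Q : ℕ, 2 ≤ Q → ∀ k,
    (p Q).coeff k * (Q : ℚ) ^ (s * k.choose 2) = aeval (Q : ℚ) (G k)

lemma Adm.mul {s : ℕ} {p p' : ℕ → ℚ[X]} (h : Adm s p) (h' : Adm s p') :
    Adm s fun Q => p Q * p' Q := by
  obtain ⟨G, hG⟩ := h
  obtain ⟨G', hG'⟩ := h'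
  refine ⟨fun k => ∑ x ∈ antidiagonal k, G x.1 * G' x.2 *
    X ^ (s * (k.choose 2 - x.1.choose 2 - x.2.choose 2)), fun Q hQ k => ?_⟩
  rw [coeff_mul, sum_mul, map_sum]
  refine sum_congr rfl fun x hx => ?_
  rw [map_mul, map_mul, ← hG Q hQ, ← hG' Q hQ, map_pow, aeval_X]
  have h1 := choose_two_add x.1 x.2
  rw [mem_antidiagonal.1 hx] at h1
  have e : s * k.choose 2 = s * x.1.choose 2 + s * x.2.choose 2 +
      s * (k.choose 2 - x.1.choose 2 - x.2.choose 2) := by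
    rw [← mul_add, ← mul_add]; congr 1; omega
  rw [e, pow_add, pow_add]
  ring

noncomputable def Ef (s : ℕ) (mj : ℕ × ℕ) (Q : ℕ) : ℚ[X] :=
  1 - C ((Q : ℚ) ^ mj.2 / (Q : ℚ) ^ (s * mj.1.choose 2)) * X ^ mj.1

lemma Adm.one (s : ℕ) : Adm s fun _ => 1 := by
  refine ⟨fun k => if k = 0 then 1 else 0, fun Q hQ k => ?_⟩
  rw [coeff_one]
  by_cases h : k = 0
  · subst h; simp
  · simp [h]

lemma Adm.ef (s : ℕ) (mj : ℕ × ℕ) : Adm s (Ef s mj) := by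
  refine ⟨fun k => (if k = 0 then 1 else 0) - (if k = mj.1 then X ^ mj.2 else 0), fun Q hQ k => ?_⟩
  have hQ0 : (Q : ℚ) ≠ 0 := by positivity
  rw [Ef, coeff_sub, coeff_one, coeff_C_mul, coeff_X_pow, sub_mul]
  by_cases h : k = 0
  · by_cases h' : k = mj.1
    · rw [← h']; simp [h]
    · subst h; simp [h']
  · by_cases h' : k = mj.1
    · rw [← h']; simp [h]; field_simp
    · simp [h, h']

lemma Adm.list (s : ℕ) (L : List (ℕ × ℕ)) : Adm s fun Q => (L.map fun mj => Ef s mj Q).prod := by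
  induction L with
  | nil => simpa using Adm.one s
  | cons a L ih => simpa using (Adm.ef s a).mul ih

lemma exists_lists (G : ℤ[X]) : ∃ P N : List ℕ, ∀ Q : ℚ,
    aeval Q G = (P.map fun j => Q ^ j).sum - (N.map fun j => Q ^ j).sum := by
  induction G using Polynomial.induction_on' with
  | add p q hp hq =>
    obtain ⟨P, N, h⟩ := hp
    obtain ⟨P', N', h'⟩ := hq
    refine ⟨P ++ P', N ++ N', fun Q => ?_⟩
    rw [map_add, h, h']; simp; ring
  | monomial j a =>
    refine ⟨List.replicate a.toNat j, List.replicate (-a).toNat j, fun Q => ?_⟩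
    have : ((a.toNat : ℤ) : ℚ) - ((-a).toNat : ℤ) = a := by
      rw [← Int.cast_sub]; congr 1; omega
    rw [aeval_monomial, eq_intCast, ← this]
    simp only [List.map_replicate, List.sum_replicate, nsmul_eq_mul, Int.cast_natCast]
    ring

lemma prod_one_sub {R : Type} [CommRing R] {ι : Type} (L : List ι) (c : ι → R) {m : ℕ} (hm : 1 ≤ m) :
    ∃ u : R[X], (L.map fun i => 1 - C (c i) * X ^ m).prod =
      1 - C (L.map c).sum * X ^ m + X ^ (m + 1) * u := by
  induction L with
  | nil => exact ⟨0, by simp⟩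
  | cons a L ih =>
    obtain ⟨u, hu⟩ := ih
    obtain ⟨m, rfl⟩ := Nat.exists_eq_add_of_le' hm
    refine ⟨C (c a) * C (L.map c).sum * X ^ m + u - C (c a) * X ^ (m + 1) * u, ?_⟩
    simp only [List.map_cons, List.prod_cons, List.sum_cons, hu, C_add]
    ring

lemma exists_X_of_coeff {R : Type} [CommRing R] {p : R[X]} (h : p.coeff 0 = 1) :
    ∃ v, p = 1 + X * v := by
  have : X ∣ p - 1 := by rw [X_dvd_iff]; simp [h]
  obtain ⟨v, hv⟩ := this
  exact ⟨v, by rw [← hv]; ring⟩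

lemma coeff0_list (s : ℕ) (L : List (ℕ × ℕ)) (hL : ∀ x ∈ L, 1 ≤ x.1) (Q : ℕ) :
    ((L.map fun mj => Ef s mj Q).prod).coeff 0 = 1 := by
  induction L with
  | nil => simp
  | cons a L ih =>
    rw [List.map_cons, List.prod_cons, mul_coeff_zero, ih fun x hx => hL x (by simp [hx])]
    have := hL a (by simp)
    have h2 : 0 ≠ a.1 := by omega
    simp [Ef, coeff_X_pow, h2]

lemma universal_fact {s : ℕ} {F : ℕ → ℚ[X]} (hF : Adm s F) (hF0 : ∀ Q, 2 ≤ Q → (F Q).coeff 0 = 1)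
    (k : ℕ) : ∃ Lp Lm : List (ℕ × ℕ), (∀ x ∈ Lp, 1 ≤ x.1 ∧ x.1 ≤ k) ∧ (∀ x ∈ Lm, 1 ≤ x.1 ∧ x.1 ≤ k) ∧
      ∀ Q, 2 ≤ Q → X ^ (k + 1) ∣ F Q * (Lp.map fun mj => Ef s mj Q).prod -
        (Lm.map fun mj => Ef s mj Q).prod := by
  induction k with
  | zero =>
    refine ⟨[], [], by simp, by simp, fun Q hQ => ?_⟩
    rw [zero_add, pow_one, X_dvd_iff]
    simp [hF0 Q hQ]
  | succ k ih =>
    obtain ⟨Lp, Lm, h1, h2, h3⟩ := ih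
    obtain ⟨G1, hG1⟩ := hF.mul (Adm.list s Lp)
    obtain ⟨G2, hG2⟩ := Adm.list s Lm
    obtain ⟨P, N, hPN⟩ := exists_lists (G1 (k + 1) - G2 (k + 1))
    refine ⟨P.map (fun j => (k + 1, j)) ++ Lp, N.map (fun j => (k + 1, j)) ++ Lm, ?_, ?_, ?_⟩
    · intro x hx
      rw [List.mem_append] at hx
      rcases hx with hx | hx
      · simp only [List.mem_map] at hx
        obtain ⟨j, _, rfl⟩ := hx; simp
      · have := h1 x hx; omega
    · intro x hx
      rw [List.mem_append] at hx
      rcases hx with hx | hx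
      · simp only [List.mem_map] at hx
        obtain ⟨j, _, rfl⟩ := hx; simp
      · have := h2 x hx; omega
    intro Q hQ
    have hQ0 : (Q : ℚ) ≠ 0 := by positivity
    obtain ⟨t, ht⟩ := h3 Q hQ
    have c1 : (F Q * (Lp.map fun mj => Ef s mj Q).prod).coeff 0 = 1 := by
      rw [mul_coeff_zero, hF0 Q hQ, coeff0_list s Lp (fun x hx => (h1 x hx).1), one_mul]
    have c2 := coeff0_list s Lm (fun x hx => (h2 x hx).1) Q
    obtain ⟨v1, hv1⟩ := exists_X_of_coeff c1
    obtain ⟨v2, hv2⟩ := exists_X_of_coeff c2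
    -- the coefficient
    have hd : t.coeff 0 * (Q : ℚ) ^ (s * (k + 1).choose 2) =
        (P.map fun j => (Q : ℚ) ^ j).sum - (N.map fun j => (Q : ℚ) ^ j).sum := by
      rw [← hPN, map_sub, ← hG1 Q hQ, ← hG2 Q hQ, ← sub_mul, ← coeff_sub, ht]
      congr 1
      rw [coeff_X_pow_mul']; simp
    have lst : ∀ M : List ℕ, ∃ u : ℚ[X], ((M.map fun j => (k + 1, j)).map fun mj => Ef s mj Q).prod =
        1 - C ((M.map fun j => (Q : ℚ) ^ j).sum / (Q : ℚ) ^ (s * (k + 1).choose 2)) * X ^ (k + 1) +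
         X ^ (k + 1 + 1) * u := by
      intro M
      obtain ⟨u, hu⟩ := prod_one_sub M (fun j => (Q : ℚ) ^ j / (Q : ℚ) ^ (s * (k + 1).choose 2))
        (m := k + 1) (by omega)
      refine ⟨u, ?_⟩
      rw [List.map_map]
      have e : (M.map fun j => (Q : ℚ) ^ j).sum / (Q : ℚ) ^ (s * (k + 1).choose 2) =
          (M.map fun j => (Q : ℚ) ^ j / (Q : ℚ) ^ (s * (k + 1).choose 2)).sum := by
        simp only [div_eq_mul_inv]
        rw [List.sum_map_mul_right]
      rw [e, ← hu]
      rfl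
    obtain ⟨u1, hu1⟩ := lst P
    obtain ⟨u2, hu2⟩ := lst N
    have ht0 : X ∣ t - C (t.coeff 0) := by rw [X_dvd_iff]; simp
    obtain ⟨t', ht'⟩ := ht0
    have hC : C (t.coeff 0) = C ((P.map fun j => (Q : ℚ) ^ j).sum / (Q : ℚ) ^ (s * (k + 1).choose 2)) -
       C ((N.map fun j => (Q : ℚ) ^ j).sum / (Q : ℚ) ^ (s * (k + 1).choose 2)) := by
      rw [← C_sub, ← sub_div, ← hd]
      congr 1
      field_simp
    simp only [List.map_append, List.prod_append]
    rw [hu1, hu2]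
    set a := C ((P.map fun j => (Q : ℚ) ^ j).sum / (Q : ℚ) ^ (s * (k + 1).choose 2))
    set b := C ((N.map fun j => (Q : ℚ) ^ j).sum / (Q : ℚ) ^ (s * (k + 1).choose 2))
    set A := (Lp.map fun mj => Ef s mj Q).prod
    set B := (Lm.map fun mj => Ef s mj Q).prod
    have ht2 : t = a - b + X * t' := by rw [← hC, ← ht']; ring
    rw [hv2, hv1, ht2] at ht
    refine ⟨t' - a * v1 + b * v2 + u1 * (1 + X * v1) - u2 * (1 + X * v2), ?_⟩
    rw [hv2]
    have : F Q * ((1 - a * X ^ (k + 1) + X ^ (k + 1 + 1) * u1) * A) =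
      (F Q * A) * (1 - a * X ^ (k + 1) + X ^ (k + 1 + 1) * u1) := by ring
    rw [this, hv1]
    linear_combination ht

/-- the local factor -/
noncomputable def Fp (n r : ℕ) (Q : ℕ) : ℚ[X] :=
  ∑ l ∈ Lset n, C (((Md (Q : ℚ) l).det ^ 2)⁻¹ ^ r) * X ^ size l

lemma Md_inv {n : ℕ} {l : Fin n → ℕ} (hl : StrictMono l) {Q : ℚ} (hQ : 1 < Q) :
    ((Md Q l).det)⁻¹ = aeval Q (Hp l) / Q ^ ∑ j : Fin n, (l j - j).choose 2 := by
  have h := Md_det hl hQ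
  have h0 : Q ≠ 0 := by positivity
  have h1 : (Md Q l).det ≠ 0 := by
    intro h'; rw [h', zero_mul] at h
    exact pow_ne_zero _ h0 h.symm
  rw [← h]
  have h2 : aeval Q (Hp l) ≠ 0 := by
    intro h'; rw [h', mul_zero] at h
    exact pow_ne_zero _ h0 h.symm
  field_simp

lemma Fp_adm (n r : ℕ) : Adm (2 * r) (Fp n r) := by
  classical
  refine ⟨fun k => ∑ l ∈ (Lset n).filter (fun l => size l = k), Hp l ^ (2 * r) *
    X ^ (2 * r * (k.choose 2 - ∑ j : Fin n, (l j - j).choose 2)), fun Q hQ k => ?_⟩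
  have hQ1 : (1 : ℚ) < Q := by exact_mod_cast hQ
  have hQ0 : (Q : ℚ) ≠ 0 := by positivity
  rw [Fp, finsetSum_coeff, map_sum, sum_filter, sum_mul]
  refine sum_congr rfl fun l hl => ?_
  rw [coeff_C_mul, coeff_X_pow]
  split_ifs with h h' h'
  · rw [map_mul, map_pow, map_pow, aeval_X, ← inv_pow, Md_inv (mem_Lset.1 hl).2 hQ1]
    have hle : ∑ j : Fin n, (l j - j).choose 2 ≤ k.choose 2 := by
      rw [h]; exact choose_two_sum _ _
    have e : 2 * r * k.choose 2 = 2 * r * (∑ j : Fin n, (l j - j).choose 2) +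
      2 * r * (k.choose 2 - ∑ j : Fin n, (l j - j).choose 2) := by rw [← mul_add]; congr 1; omega
    rw [e, pow_add, ← pow_mul, mul_one, div_pow, ← mul_assoc, ← pow_mul,
      mul_comm (∑ j : Fin n, (l j - j).choose 2), div_mul_cancel₀ _ (by positivity)]
  · exact absurd h.symm h'
  · exact absurd h'.symm h
  · simp

lemma size_zero {n : ℕ} {l : Fin n → ℕ} (hl : StrictMono l) (h : size l = 0) :
    l = fun j : Fin n => (j : ℕ) := by
  funext j
  rw [size, sum_eq_zero_iff] at h
  have := h j (mem_univ _)
  have := le_of_sm hl j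
  omega

lemma Fp_zero (n r : ℕ) (Q : ℕ) (hQ : 2 ≤ Q) : (Fp n r Q).coeff 0 = 1 := by
  classical
  have hQ1 : (1 : ℚ) < Q := by exact_mod_cast hQ
  have hm : (fun j : Fin n => (j : ℕ)) ∈ Lset n := mem_Lset.2 ⟨fun j => by omega, fun i j h => h⟩
  have hs : size (fun j : Fin n => (j : ℕ)) = 0 := by simp [size]
  rw [Fp, finsetSum_coeff, sum_eq_single (fun j : Fin n => (j : ℕ))]
  · rw [hs]
    have : (Md (Q : ℚ) fun j : Fin n => (j : ℕ)).det = 1 := by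
      rw [Matrix.det_of_isUpperTriangular]
      · refine prod_eq_one fun j _ => ?_
        rw [Md, if_pos le_rfl]; simp [Dk, psi]
      · intro i j hij
        have : (j : ℕ) < i := hij
        rw [Md, if_neg (by omega)]
    simp [this]
  · intro l hl hne
    rw [coeff_C_mul, coeff_X_pow, if_neg, mul_zero]
    intro h
    exact hne (size_zero (mem_Lset.1 hl).2 h.symm)
  · intro h; exact absurd hm h

end universal
end TCV

open scoped MatrixGroups
namespace TCV
open Finset
set_option linter.unusedSectionVars false
set_option linter.unusedSimpArgs false
set_option linter.unusedVariables false

namespace PSH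
variable {J : Type} [Fintype J] [DecidableEq J] {Z : Type} [CommGroup Z] {n q : ℕ}
  (D : PSH J Z n q)

/-- graded twisted pairing -/
noncomputable def Sg (z : Z) (f h : D.Cv ℚ) (k : ℕ) : ℂ :=
  ∑ w, if D.deg w = k then D.ω w z * ((f w : ℂ) * (h w : ℂ)) else 0

variable {D}

lemma Sg_comm (z : Z) (f h : D.Cv ℚ) (k : ℕ) : D.Sg z f h k = D.Sg z h f k := by
  simp only [Sg, mul_comm (_root_.Rat.cast (f _) : ℂ)]

lemma Sg_mul (z : Z) (f g h : D.Cv ℚ) (hh : D.IsHom h) {k : ℕ} (hk : k ≤ n) :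
    D.Sg z (f * g) h k = ∑ x ∈ antidiagonal k, D.Sg z f h x.1 * D.Sg z g h x.2 := by
  have e1 : ∀ w, (if D.deg w = k then D.ω w z * (((f * g) w : ℚ) * (h w : ℂ)) else 0) =
      ∑ a, ∑ b, ((f a : ℂ) * g b) * (if D.deg a + D.deg b = k then
        (D.ω a z * D.ω b z) * ((D.c a b w : ℂ) * h w) else 0) := by
    intro w
    split_ifs with hw
    · rw [mul_apply]
      push_cast
      rw [sum_mul, mul_sum]
      refine sum_congr rfl fun a _ => ?_
      rw [sum_mul, mul_sum]
      refine sum_congr rfl fun b _ => ?_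
      by_cases hc : D.c a b w = 0
      · simp [hc]
      · rw [if_pos (by rw [← D.c_deg hc, hw]), D.ω_mul hc, MonoidHom.mul_apply]
        ring
    · symm
      refine sum_eq_zero fun a _ => sum_eq_zero fun b _ => ?_
      split_ifs with hab
      · have : D.c a b w = 0 := by
          by_contra hc; exact hw (by rw [D.c_deg hc, hab])
        simp [this]
      · simp
  have e2 : ∀ a b, D.deg a + D.deg b = k → ∑ w, (D.c a b w : ℂ) * h w = h a * h b := by
    intro a b hab
    have := congrArg (fun x : ℚ => (x : ℂ)) (hh.2 a b (by omega))
    push_cast at this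
    exact this
  simp only [Sg]
  rw [sum_congr rfl fun w _ => e1 w, sum_comm]
  have e3 : ∀ x ∈ antidiagonal k, (∑ w, if D.deg w = x.1 then D.ω w z * ((f w : ℂ) * h w) else 0) *
      (∑ w, if D.deg w = x.2 then D.ω w z * ((g w : ℂ) * h w) else 0) =
      ∑ a, ∑ b, if x = (D.deg a, D.deg b) then
        (D.ω a z * ((f a : ℂ) * h a)) * (D.ω b z * ((g b : ℂ) * h b)) else 0 := by
    intro x hx
    rw [sum_mul_sum]
    refine sum_congr rfl fun a _ => sum_congr rfl fun b _ => ?_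
    by_cases h1 : D.deg a = x.1
    · by_cases h2 : D.deg b = x.2
      · rw [if_pos h1, if_pos h2, if_pos (by rw [h1, h2])]
      · rw [if_neg h2, mul_zero, if_neg]
        intro h; rw [h] at h2; exact h2 rfl
    · rw [if_neg h1, zero_mul, if_neg]
      intro h; rw [h] at h1; exact h1 rfl
  rw [sum_congr rfl e3]
  rw [sum_comm (s := antidiagonal k)]
  refine sum_congr rfl fun a _ => ?_
  rw [sum_comm (s := antidiagonal k), sum_comm]
  refine sum_congr rfl fun b _ => ?_
  rw [← mul_sum, sum_ite_eq']
  by_cases hab : D.deg a + D.deg b = k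
  · rw [if_pos (Finset.HasAntidiagonal.mem_antidiagonal.2 hab)]
    have e4 : ∀ w ∈ (univ : Finset J), (if D.deg a + D.deg b = k then
        (D.ω a z * D.ω b z) * ((D.c a b w : ℂ) * h w) else 0) =
        (D.ω a z * D.ω b z) * ((D.c a b w : ℂ) * h w) := fun w _ => if_pos hab
    rw [sum_congr rfl e4, ← mul_sum, e2 a b hab]; ring
  · rw [if_neg (fun hx => hab (Finset.HasAntidiagonal.mem_antidiagonal.1 hx))]
    have e4 : ∀ w ∈ (univ : Finset J), (if D.deg a + D.deg b = k then
        (D.ω a z * D.ω b z) * ((D.c a b w : ℂ) * h w) else 0) = 0 := fun w _ => if_neg hab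
    rw [sum_congr rfl e4, sum_const_zero, mul_zero]

lemma Sg_zero (z : Z) (f h : D.Cv ℚ) (hf : f D.o = 1) (hh : h D.o = 1) : D.Sg z f h 0 = 1 := by
  rw [Sg, sum_eq_single D.o]
  · rw [if_pos D.deg_o, hf, hh, D.ω_o]; simp
  · intro w _ hw
    rw [if_neg]; intro h; exact hw ((D.deg_eq_zero w).1 h)
  · simp

lemma Sg_t (z : Z) (h : D.Cv ℚ) (k : ℕ) : D.Sg z D.δt h k = (q : ℂ) ^ k * D.Sg z D.δc h k := by
  rw [Sg, Sg, mul_sum]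
  refine sum_congr rfl fun w _ => ?_
  split_ifs with hw
  · rw [δt, δc, hw]; push_cast; ring
  · simp

lemma Sg_rec (z : Z) {h : D.Cv ℚ} (hh : D.IsHom h) {k : ℕ} (hk : k ≤ n) :
    (q : ℂ) ^ k * D.Sg z D.δc h k =
      ∑ x ∈ antidiagonal k, D.Sg z D.δc h x.1 * D.Sg z D.γc h x.2 := by
  rw [← Sg_t, δt_eq, Sg_mul z _ _ h hh hk]

lemma Sg_step (z : Z) {h : D.Cv ℚ} (hh : D.IsHom h)
    (h0 : ∀ k ≤ n, D.Sg z D.δc h k = if k = 0 then 1 else 0) :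
    ∀ k ≤ n, D.Sg z D.γc h k = if k = 0 then 1 else 0 := by
  intro k hk
  have e := Sg_rec z hh hk
  rw [sum_eq_single (0, k), h0 0 (by omega), h0 k hk] at e
  · rw [if_pos rfl, one_mul] at e
    rw [← e]; split_ifs with h
    · rw [h]; simp
    · simp
  · rintro ⟨i, j⟩ hx hne
    have hx' := Finset.HasAntidiagonal.mem_antidiagonal.1 hx
    simp only at hx'
    rw [h0 i (by omega), if_neg, zero_mul]
    rintro rfl; apply hne; simp; omega
  · simp

lemma Sg_gg {z : Z} (hz : z ≠ 1) : ∀ k ≤ n, D.Sg z D.γc D.γc k = if k = 0 then 1 else 0 := by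
  refine Sg_step z D.γc_hom fun k hk => ?_
  rw [Sg_comm]
  revert k
  refine Sg_step z D.δc_hom fun k hk => ?_
  split_ifs with h
  · rw [h, Sg_zero] <;> exact D.δc_hom.1
  · have := D.sum_sq z hz k (by omega) hk
    rw [sum_filter] at this
    refine Eq.trans ?_ this
    rw [Sg]
    refine sum_congr rfl fun w _ => ?_
    rw [sq]; rfl

lemma Sg_gg_one (hn : 1 ≤ n) : D.Sg 1 D.γc D.γc 1 = (q : ℂ) - 1 := by
  have hq := D.two_le_q
  have hq1 : (q : ℂ) - 1 ≠ 0 := by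
    rw [sub_ne_zero]; norm_cast; omega
  have a1 : D.Sg 1 D.δc D.δc 1 = 1 / ((q : ℂ) - 1) := by
    have := congrArg (fun x : ℚ => (x : ℂ)) (D.sum_sq_one hn)
    push_cast at this
    rw [sum_filter] at this
    rw [Sg, ← this]
    refine sum_congr rfl fun w _ => ?_
    rw [sq, map_one, one_mul]; rfl
  have e1 := Sg_rec (1 : Z) D.δc_hom hn
  have e2 := Sg_rec (1 : Z) D.γc_hom hn
  have aa : antidiagonal 1 = {(0, 1), (1, 0)} := rfl
  rw [aa, sum_pair (by simp)] at e1 e2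
  simp only [] at e1 e2
  rw [Sg_zero 1 D.δc D.δc D.δ_o D.δ_o, Sg_zero 1 D.γc D.δc D.γc_hom.1 D.δ_o, a1] at e1
  rw [Sg_zero 1 D.δc D.γc D.δ_o D.γc_hom.1, Sg_zero 1 D.γc D.γc D.γc_hom.1 D.γc_hom.1,
    Sg_comm 1 D.δc D.γc] at e2
  have g1 : D.Sg 1 D.γc D.δc 1 = 1 := by
    have : D.Sg 1 D.γc D.δc 1 = (q - 1 : ℂ) * (1 / ((q : ℂ) - 1)) := by linear_combination -e1
    rw [this]; field_simp
  rw [g1] at e2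
  linear_combination -e2

/-! ### Λ -/
section
open Polynomial
variable (D)
noncomputable def Lam (z : Z) : ℂ[X] := ∏ ρ : D.Cu, (1 - C (D.ω ρ.1 z) * X ^ D.dg ρ)

noncomputable def KK (z : Z) : ℂ[X] := ∏ ρ : D.Cu, ∑ l ∈ Lset n,
  C ((((Mg l).det ^ 2 : ℚ) : ℂ) * D.ω ρ.1 z ^ size l) * X ^ (D.dg ρ * size l)
variable {D}

lemma KK_coeff (z : Z) {k : ℕ} (hk : k ≤ n) : (D.KK z).coeff k = D.Sg z D.γc D.γc k := by
  rw [KK, ← sum_formula hk (fun w => D.ω w z * ((D.γc w : ℂ) * (D.γc w : ℂ))), sum_filter]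
  · rfl
  · intro fam h1 h2 w hw
    have h3 : ∀ ρ, StrictMono (fam ρ) := fun ρ => (mem_Lset.1 (h1 ρ)).2
    rw [omega_val h3 hw, prod_mul_distrib, mul_comm]
    congr 1
    have := congrArg (fun x : ℚ => (x : ℂ)) (gamma_val h3 h2 hw)
    push_cast at this ⊢
    rw [← this, sq]; simp [γc]

def lm (n m : ℕ) : Fin n → ℕ := fun j => if (j : ℕ) + 1 = n then j + m else j

lemma lm_sm (n m : ℕ) : StrictMono (lm n m) := by
  intro i j hij
  have h : (i : ℕ) < j := hij
  have := j.2
  simp only [lm]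
  rw [if_neg (by omega)]
  split_ifs <;> omega

lemma lm_size (hn : 1 ≤ n) (m : ℕ) : size (lm n m) = m := by
  rw [size, sum_eq_single (⟨n - 1, by omega⟩ : Fin n)]
  · simp only [lm]; rw [if_pos (by omega)]; omega
  · intro j _ hj
    have : (j : ℕ) + 1 ≠ n := fun h => hj (Fin.ext (by simp; omega))
    simp [lm, this]
  · simp

lemma sum_Mg (hn : 1 ≤ n) (y : ℂ[X]) :
    ∑ l ∈ Lset n, C (((Mg l).det ^ 2 : ℚ) : ℂ) * y ^ size l = ∑ m ∈ range (n + 1), y ^ m := by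
  classical
  have hinj : Set.InjOn (lm n) (range (n + 1)) := by
    intro a _ b _ h
    rw [← lm_size hn a, h, lm_size hn b]
  have e : ∑ m ∈ range (n + 1), y ^ m = ∑ l ∈ (range (n + 1)).image (lm n),
      C (((Mg l).det ^ 2 : ℚ) : ℂ) * y ^ size l := by
    rw [sum_image hinj]
    refine sum_congr rfl fun m _ => ?_
    rw [Mg_det_one (fun j hj => by simp only [lm]; rw [if_neg (by omega)]) (lm_sm n m), lm_size hn]
    simp
  rw [e]
  symm
  refine sum_subset ?_ ?_
  · intro l hl
    rw [mem_image] at hl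
    obtain ⟨m, hm, rfl⟩ := hl
    rw [mem_range] at hm
    refine mem_Lset.2 ⟨fun j => ?_, lm_sm n m⟩
    simp only [lm]; split_ifs <;> omega
  · intro l hl hl'
    obtain ⟨hl1, hl2⟩ := mem_Lset.1 hl
    by_cases h : ∀ j : Fin n, (j : ℕ) + 1 < n → l j = j
    · exfalso; apply hl'
      rw [mem_image]
      let t : Fin n := ⟨n - 1, by omega⟩
      have h1 := hl1 t
      have h2 := le_of_sm hl2 t
      refine ⟨l t - t, by rw [mem_range]; omega, ?_⟩
      funext j
      simp only [lm]
      split_ifs with hj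
      · have : j = t := Fin.ext (by simp [t]; omega)
        rw [this]; omega
      · exact (h j (by have := j.2; omega)).symm
    · push Not at h
      obtain ⟨j, hj, hne⟩ := h
      rw [Mg_det_zero hl2 hj hne]; simp

lemma KK_mul_Lam (hn : 1 ≤ n) (z : Z) : X ^ (n + 1) ∣ D.KK z * D.Lam z - 1 := by
  have e : ∀ ρ : D.Cu, X ^ (n + 1) ∣ (∑ l ∈ Lset n,
      C ((((Mg l).det ^ 2 : ℚ) : ℂ) * D.ω ρ.1 z ^ size l) * X ^ (D.dg ρ * size l)) *
      (1 - C (D.ω ρ.1 z) * X ^ D.dg ρ) - 1 := by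
    intro ρ
    have : ∀ l ∈ Lset n, C ((((Mg l).det ^ 2 : ℚ) : ℂ) * D.ω ρ.1 z ^ size l) *
        X ^ (D.dg ρ * size l) = C (((Mg l).det ^ 2 : ℚ) : ℂ) *
          (C (D.ω ρ.1 z) * X ^ D.dg ρ) ^ size l := by
      intro l _
      rw [C_mul, mul_pow, C_pow, pow_mul, mul_assoc]
    rw [sum_congr rfl this, sum_Mg hn, geom_sum_mul_neg]
    rw [sub_sub_cancel_left, dvd_neg, mul_pow, ← pow_mul]
    refine Dvd.dvd.mul_left (pow_dvd_pow _ ?_) _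
    exact Nat.le_mul_of_pos_left _ (dg_pos ρ)
  simp only [← Ideal.mem_span_singleton, ← Ideal.Quotient.eq] at e ⊢
  rw [KK, Lam, ← prod_mul_distrib, map_prod]
  rw [prod_congr rfl fun ρ _ => e ρ]
  simp

lemma Lam_ne {z : Z} (hn : 1 ≤ n) (hz : z ≠ 1) : X ^ (n + 1) ∣ D.Lam z - 1 := by
  have h1 := KK_mul_Lam (D := D) hn z
  have h2 : X ^ (n + 1) ∣ D.KK z - 1 := by
    rw [X_pow_dvd_iff]
    intro k hk
    rw [coeff_sub, KK_coeff z (by omega), Sg_gg hz k (by omega), coeff_one, sub_self]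
  have : D.Lam z - 1 = (D.KK z * D.Lam z - 1) - (D.KK z - 1) * D.Lam z := by ring
  rw [this]
  exact dvd_sub h1 (h2.mul_right _)

lemma Lam_one (hn : 1 ≤ n) : X ^ 2 ∣ D.Lam 1 - (1 - C ((q : ℂ) - 1) * X) := by
  have h1 : X ^ 2 ∣ D.KK 1 * D.Lam 1 - 1 :=
    (pow_dvd_pow _ (by omega)).trans (KK_mul_Lam (D := D) hn 1)
  have h2 : X ^ 2 ∣ D.KK 1 - (1 + C ((q : ℂ) - 1) * X) := by
    rw [X_pow_dvd_iff]
    intro k hk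
    rw [coeff_sub, KK_coeff 1 (by omega)]
    interval_cases k
    · rw [Sg_zero _ _ _ D.γc_hom.1 D.γc_hom.1]; simp
    · rw [Sg_gg_one hn]; simp [coeff_one]
  obtain ⟨u, hu⟩ := h1
  obtain ⟨v, hv⟩ := h2
  set c := C ((q : ℂ) - 1)
  refine ⟨c ^ 2 * D.Lam 1 + (u - v * D.Lam 1) * (1 - c * X), ?_⟩
  have e1 : D.KK 1 = 1 + c * X + X ^ 2 * v := by rw [← hv]; ring
  rw [e1] at hu
  linear_combination (1 - c * X) * hu

end
end PSH
end TCV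

open scoped MatrixGroups
namespace TCV
open Finset
set_option linter.unusedSectionVars false
set_option linter.unusedSimpArgs false
set_option linter.unusedVariables false

namespace PSH
section
open Polynomial
variable {J : Type} [Fintype J] [DecidableEq J] {Z : Type} [CommGroup Z] {n q : ℕ}
  (D : PSH J Z n q)

noncomputable def ph (z : Z) (ρ : D.Cu) : ℚ[X] →+* ℂ[X] :=
  eval₂RingHom ((C : ℂ →+* ℂ[X]).comp (algebraMap ℚ ℂ)) (C (D.ω ρ.1 z) * X ^ D.dg ρ)

variable {D}

lemma ph_X (z : Z) (ρ : D.Cu) : D.ph z ρ X = C (D.ω ρ.1 z) * X ^ D.dg ρ := by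
  simp [ph]

lemma ph_C (z : Z) (ρ : D.Cu) (x : ℚ) : D.ph z ρ (C x) = C (x : ℂ) := by
  simp [ph]

lemma ph_Ef (s : ℕ) (z : Z) (m j : ℕ) :
    ∏ ρ : D.Cu, D.ph z ρ (Ef s (m, j) (q ^ D.dg ρ)) =
      (D.Lam (z ^ m)).comp (C ((q : ℂ) ^ j / (q : ℂ) ^ (s * m.choose 2)) * X ^ m) := by
  rw [Lam, Polynomial.prod_comp]
  refine prod_congr rfl fun ρ _ => ?_
  simp only [Ef, map_sub, map_one, map_mul, map_pow, ph_X, ph_C, sub_comp, one_comp, mul_comp,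
    C_comp, pow_comp, X_comp]
  congr 1
  have e : (((((q ^ D.dg ρ : ℕ) : ℚ) ^ j / ((q ^ D.dg ρ : ℕ) : ℚ) ^ (s * m.choose 2) : ℚ)) : ℂ) =
      ((q : ℂ) ^ j / (q : ℂ) ^ (s * m.choose 2)) ^ D.dg ρ := by
    push_cast
    rw [div_pow, ← pow_mul, ← pow_mul, ← pow_mul, ← pow_mul, mul_comm j, mul_comm (s * _)]
  rw [e]
  generalize (q : ℂ) ^ j / (q : ℂ) ^ (s * m.choose 2) = c0
  rw [C_pow]
  ring

/-- coefficient attached to a pair -/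
noncomputable def cmj (n q s : ℕ) (mj : ℕ × ℕ) : ℂ :=
  if mj.1 = n then ((q : ℂ) - 1) * ((q : ℂ) ^ mj.2 / (q : ℂ) ^ (s * n.choose 2)) else 0

lemma ph_Ef_mod (hn : 1 ≤ n) (s : ℕ) {z : Z} (hz : orderOf z = n) (mj : ℕ × ℕ) (h1 : 1 ≤ mj.1)
    (h2 : mj.1 ≤ n) :
    X ^ (n + 1) ∣ ∏ ρ : D.Cu, D.ph z ρ (Ef s mj (q ^ D.dg ρ)) -
      (1 - C (cmj n q s mj) * X ^ n) := by
  obtain ⟨m, j⟩ := mj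
  simp only at h1 h2
  rw [ph_Ef]
  set c0 := (q : ℂ) ^ j / (q : ℂ) ^ (s * m.choose 2) with hc0
  by_cases hm : m = n
  · have hz1 : z ^ m = 1 := by rw [hm, ← hz, pow_orderOf_eq_one]
    rw [hz1]
    obtain ⟨u, hu⟩ := Lam_one (D := D) hn
    have := congrArg (fun p : ℂ[X] => p.comp (C c0 * X ^ m)) hu
    simp only [sub_comp, mul_comp, one_comp, C_comp, X_comp, pow_comp] at this
    have e : cmj n q s (m, j) = ((q : ℂ) - 1) * c0 := by
      simp [cmj, hm, hc0]
    have e' : C (((q : ℂ) - 1) * c0) * X ^ n = C ((q : ℂ) - 1) * (C c0 * X ^ m) := by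
      rw [C_mul, hm, mul_assoc]
    rw [e, e', this, mul_pow, ← pow_mul]
    refine Dvd.dvd.mul_right (Dvd.dvd.mul_left (pow_dvd_pow _ (by omega)) _) _
  · have hz1 : z ^ m ≠ 1 := by
      intro h
      have := Nat.le_of_dvd (by omega) (orderOf_dvd_of_pow_eq_one h)
      omega
    obtain ⟨u, hu⟩ := Lam_ne (D := D) hn hz1
    have := congrArg (fun p : ℂ[X] => p.comp (C c0 * X ^ m)) hu
    simp only [sub_comp, mul_comp, one_comp, C_comp, X_comp, pow_comp] at this
    have e : cmj n q s (m, j) = 0 := by simp [cmj, hm]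
    rw [e, C_0, zero_mul, sub_zero, this, mul_pow, ← pow_mul]
    refine Dvd.dvd.mul_right (Dvd.dvd.mul_left (pow_dvd_pow _ ?_) _) _
    exact Nat.le_mul_of_pos_left _ h1

lemma list_prod_mod (hn : 1 ≤ n) (s : ℕ) {z : Z} (hz : orderOf z = n) (L : List (ℕ × ℕ))
    (hL : ∀ x ∈ L, 1 ≤ x.1 ∧ x.1 ≤ n) :
    X ^ (n + 1) ∣ ∏ ρ : D.Cu, D.ph z ρ ((L.map fun mj => Ef s mj (q ^ D.dg ρ)).prod) -
      (1 - C ((L.map (cmj n q s)).sum) * X ^ n) := by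
  obtain ⟨u, hu⟩ := prod_one_sub L (cmj n q s) hn
  have e1 : ∏ ρ : D.Cu, D.ph z ρ ((L.map fun mj => Ef s mj (q ^ D.dg ρ)).prod) =
      (L.map fun mj => ∏ ρ : D.Cu, D.ph z ρ (Ef s mj (q ^ D.dg ρ))).prod := by
    clear hL hu
    induction L with
    | nil => simp
    | cons a L ih => simp only [List.map_cons, List.prod_cons, map_mul, prod_mul_distrib, ih]
  have e2 : X ^ (n + 1) ∣ (L.map fun mj => ∏ ρ : D.Cu, D.ph z ρ (Ef s mj (q ^ D.dg ρ))).prod -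
      (L.map fun i => 1 - C (cmj n q s i) * X ^ n).prod := by
    rw [← Ideal.mem_span_singleton, ← Ideal.Quotient.eq, map_list_prod, map_list_prod, List.map_map,
      List.map_map]
    congr 1
    refine List.map_congr_left fun a ha => ?_
    have := ph_Ef_mod (D := D) hn s hz a (hL a ha).1 (hL a ha).2
    rw [← Ideal.mem_span_singleton, ← Ideal.Quotient.eq] at this
    exact this
  rw [e1]
  rw [hu] at e2
  have := dvd_add e2 (Dvd.intro u rfl)
  refine this.trans (dvd_of_eq ?_)
  ring

noncomputable def Pl (n : ℕ) (L : List (ℕ × ℕ)) : ℤ[X] :=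
  (L.map fun mj => if mj.1 = n then X ^ mj.2 else 0).sum

lemma Pl_eval (n q s : ℕ) (hq : 2 ≤ q) (L : List (ℕ × ℕ)) :
    (q : ℂ) ^ (s * n.choose 2) * (L.map (cmj n q s)).sum =
      ((q : ℂ) - 1) * (((Pl n L).eval (q : ℤ) : ℤ) : ℂ) := by
  have hq0 : (q : ℂ) ≠ 0 := by norm_cast; omega
  induction L with
  | nil => simp [Pl]
  | cons a L ih =>
    simp only [Pl, List.map_cons, List.sum_cons, eval_add] at ih ⊢
    push_cast
    rw [mul_add, ih, mul_add]
    congr 1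
    simp only [cmj]
    split_ifs with h
    · simp; field_simp
    · simp

theorem abstract_main (n : ℕ) (hn : 1 ≤ n) (r : ℕ) : ∃ P0 : ℤ[X], ∀ (J : Type) [Fintype J]
    [DecidableEq J] (Z : Type) [CommGroup Z] (q : ℕ) (D : PSH J Z n q) (z : Z), orderOf z = n →
    (q : ℂ) ^ (2 * r * n.choose 2) *
      ∑ w with D.deg w = n, D.ω w z * (((D.δ w ^ 2)⁻¹ ^ r : ℚ) : ℂ) =
    ((q : ℂ) - 1) * ((P0.eval (q : ℤ) : ℤ) : ℂ) := by
  obtain ⟨Lp, Lm, hp, hm, hU⟩ := universal_fact (Fp_adm n r) (Fp_zero n r) n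
  refine ⟨Pl n Lp - Pl n Lm, ?_⟩
  intro J _ _ Z _ q D z hz
  have hq := D.two_le_q
  -- the generating polynomial
  have hS : ∀ k ≤ n, ∑ w with D.deg w = k, D.ω w z * (((D.δ w ^ 2)⁻¹ ^ r : ℚ) : ℂ) =
      (∏ ρ : D.Cu, D.ph z ρ (Fp n r (q ^ D.dg ρ))).coeff k := by
    intro k hk
    rw [sum_formula hk (fun w => D.ω w z * (((D.δ w ^ 2)⁻¹ ^ r : ℚ) : ℂ))
      (fun ρ l => D.ω ρ.1 z ^ size l * (((((Md ((q : ℚ) ^ D.dg ρ) l).det ^ 2)⁻¹ ^ r : ℚ)) : ℂ))]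
    · congr 1
      refine prod_congr rfl fun ρ _ => ?_
      rw [Fp, map_sum]
      refine sum_congr rfl fun l _ => ?_
      have e : D.ph z ρ (C (((Md ((q ^ D.dg ρ : ℕ) : ℚ) l).det ^ 2)⁻¹ ^ r) * X ^ size l) =
        C (((((Md ((q ^ D.dg ρ : ℕ) : ℚ) l).det ^ 2)⁻¹ ^ r : ℚ)) : ℂ) *
          (C (D.ω ρ.1 z) * X ^ D.dg ρ) ^ size l := by
        rw [map_mul, map_pow (D.ph z ρ), ph_X, ph_C]
      rw [e, Nat.cast_pow, mul_pow, C_mul, C_pow, ← pow_mul]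
      ring
    · intro fam h1 h2 w hw
      have h3 : ∀ ρ, StrictMono (fam ρ) := fun ρ => (mem_Lset.1 (h1 ρ)).2
      rw [omega_val h3 hw, delta_val h3 h2 hw, prod_mul_distrib]
      congr 1
      rw [← prod_inv_distrib, ← prod_pow]
      push_cast
      rfl
  set T : ℂ[X] := ∏ ρ : D.Cu, D.ph z ρ (Fp n r (q ^ D.dg ρ)) with hT
  have h1 : X ^ (n + 1) ∣ T * (∏ ρ : D.Cu, D.ph z ρ ((Lp.map fun mj =>
      Ef (2 * r) mj (q ^ D.dg ρ)).prod)) -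
      ∏ ρ : D.Cu, D.ph z ρ ((Lm.map fun mj => Ef (2 * r) mj (q ^ D.dg ρ)).prod) := by
    rw [hT, ← prod_mul_distrib, ← Ideal.mem_span_singleton, ← Ideal.Quotient.eq, map_prod, map_prod]
    refine prod_congr rfl fun ρ _ => ?_
    rw [Ideal.Quotient.eq, Ideal.mem_span_singleton, ← map_mul, ← map_sub]
    have hQ : 2 ≤ q ^ D.dg ρ := by
      calc 2 ≤ q := hq
        _ = q ^ 1 := (pow_one _).symm
        _ ≤ _ := Nat.pow_le_pow_right (by omega) (dg_pos ρ)
    have := map_dvd (D.ph z ρ) (hU (q ^ D.dg ρ) hQ)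
    refine Dvd.dvd.trans ?_ this
    rw [map_pow, ph_X, mul_pow, ← pow_mul]
    exact Dvd.dvd.mul_left (pow_dvd_pow _ (Nat.le_mul_of_pos_left _ (dg_pos ρ))) _
  have h2 := list_prod_mod (D := D) hn (2 * r) hz Lp hp
  have h3 := list_prod_mod (D := D) hn (2 * r) hz Lm hm
  set A := ∏ ρ : D.Cu, D.ph z ρ ((Lp.map fun mj => Ef (2 * r) mj (q ^ D.dg ρ)).prod)
  set B := ∏ ρ : D.Cu, D.ph z ρ ((Lm.map fun mj => Ef (2 * r) mj (q ^ D.dg ρ)).prod)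
  set a := (Lp.map (cmj n q (2 * r))).sum with ha
  set b := (Lm.map (cmj n q (2 * r))).sum with hb
  have h4 : X ^ (n + 1) ∣ T * (1 - C a * X ^ n) - (1 - C b * X ^ n) := by
    have e : T * (1 - C a * X ^ n) - (1 - C b * X ^ n) = (T * A - B) - T * (A - (1 - C a * X ^ n)) +
      (B - (1 - C b * X ^ n)) := by ring
    rw [e]
    exact dvd_add (dvd_sub h1 (h2.mul_left _)) h3
  rw [X_pow_dvd_iff] at h4
  have h5 := h4 n (by omega)
  have hT0 : T.coeff 0 = 1 := by
    rw [← hS 0 (by omega), sum_eq_single D.o]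
    · rw [D.ω_o, D.δ_o]; simp
    · intro w hw hne
      exact absurd ((D.deg_eq_zero w).1 (mem_filter.1 hw).2) hne
    · intro h; exact absurd (mem_filter.2 ⟨mem_univ D.o, D.deg_o⟩) h
  have h6 : T.coeff n = a - b := by
    rw [mul_sub, mul_one, ← mul_assoc, coeff_sub, coeff_sub, coeff_sub, coeff_mul_X_pow',
      coeff_C_mul_X_pow, coeff_one, if_pos le_rfl, if_pos rfl, if_neg (by omega), Nat.sub_self,
      coeff_mul_C, hT0] at h5
    linear_combination h5
  rw [hS n le_rfl, h6, mul_sub, ha, hb, Pl_eval n q _ hq, Pl_eval n q _ hq, eval_sub]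
  push_cast
  ring
end
end PSH
end TCV

open scoped MatrixGroups
namespace TCV
open Finset
set_option linter.unusedSectionVars false
set_option linter.unusedSimpArgs false
set_option linter.unusedVariables false

/-! ## Representation theory of a finite group through Wedderburn -/

/-- Wedderburn data of a finite group -/
structure WD (G : Type) [Group G] where
  N : ℕ
  d : Fin N → ℕ
  d_pos : ∀ i, 0 < d i
  e : MonoidAlgebra ℂ G ≃ₐ[ℂ] ((i : Fin N) → Matrix (Fin (d i)) (Fin (d i)) ℂ)

theorem WD.exists (G : Type) [Group G] [Finite G] : Nonempty (WD G) := by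
  have : NeZero (Nat.card G : ℂ) := ⟨by simp [Nat.card_pos.ne']⟩
  obtain ⟨N, d, hd, ⟨e⟩⟩ :=
    IsSemisimpleRing.exists_algEquiv_pi_matrix_of_isAlgClosed ℂ (MonoidAlgebra ℂ G)
  exact ⟨⟨N, d, fun i => Nat.pos_of_ne_zero (hd i).out, e⟩⟩

/-- an idempotent complex matrix has natural trace -/
lemma trace_idem {d : ℕ} (E : Matrix (Fin d) (Fin d) ℂ) (h : E * E = E) : ∃ k : ℕ, E.trace = k := by
  have h1 : IsIdempotentElem (Matrix.toLin' E) := by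
    rw [IsIdempotentElem, Module.End.mul_eq_comp, ← Matrix.toLin'_mul, h]
  have h2 := (LinearMap.IsIdempotentElem.isProj_range _ h1).trace
  rw [Matrix.trace_toLin'_eq] at h2
  exact ⟨_, h2⟩

namespace WD
variable {G : Type} [Group G] [Fintype G] [DecidableEq G] (W : WD G)

noncomputable def π (i : Fin W.N) : G →* Matrix (Fin (W.d i)) (Fin (W.d i)) ℂ where
  toFun g := W.e (MonoidAlgebra.of ℂ G g) i
  map_one' := by rw [map_one, map_one]; rfl
  map_mul' a b := by rw [map_mul, map_mul]; rfl

noncomputable def χ (i : Fin W.N) (g : G) : ℂ := (W.π i g).trace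

/-- matrix unit at the corner -/
noncomputable def z0 (i : Fin W.N) : Fin (W.d i) := ⟨0, W.d_pos i⟩

noncomputable def blk (i : Fin W.N) (M : Matrix (Fin (W.d i)) (Fin (W.d i)) ℂ) : MonoidAlgebra ℂ G :=
  W.e.symm (Pi.single i M)

noncomputable def ε (i : Fin W.N) (g : G) : ℂ :=
  (W.blk i (Matrix.single (W.z0 i) (W.z0 i) 1)).coeff g

/-- linear extension of a function to the group algebra -/
noncomputable def ext {A : Type*} [AddCommGroup A] [Module ℂ A] (f : G → A) (a : MonoidAlgebra ℂ G) : A :=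
  ∑ g, a.coeff g • f g

section
variable {A : Type*} [AddCommGroup A] [Module ℂ A] 
lemma ext_add (f : G → A) (a b : MonoidAlgebra ℂ G) : ext f (a + b) = ext f a + ext f b := by
  simp [ext, add_smul, sum_add_distrib]

lemma ext_smul (f : G → A) (c : ℂ) (a : MonoidAlgebra ℂ G) : ext f (c • a) = c • ext f a := by
  simp [ext, mul_smul, smul_sum]

lemma ext_sum (f : G → A) {ι : Type*} (s : Finset ι) (a : ι → MonoidAlgebra ℂ G) :
    ext f (∑ i ∈ s, a i) = ∑ i ∈ s, ext f (a i) := by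
  classical
  induction s using Finset.induction_on with
  | empty => simp [ext]
  | insert i s hi ih => rw [sum_insert hi, sum_insert hi, ext_add, ih]

lemma ext_of (f : G → A) (g : G) : ext f (MonoidAlgebra.of ℂ G g) = f g := by
  rw [ext, sum_eq_single g]
  · simp
  · intro b _ hb; simp [MonoidAlgebra.of, Finsupp.single_apply, hb.symm]
  · simp

lemma eq_sum (a : MonoidAlgebra ℂ G) : a = ∑ g, a.coeff g • MonoidAlgebra.of ℂ G g := by
  apply MonoidAlgebra.coeff_injective
  ext x
  rw [MonoidAlgebra.coeff_sum, Finsupp.finsetSum_apply, sum_eq_single x]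
  · simp
  · intro b _ hb; simp [hb]
  · simp

lemma ext_mul_comm (f : G → A) (hf : ∀ g h, f (g * h) = f (h * g)) (a b : MonoidAlgebra ℂ G) :
    ext f (a * b) = ext f (b * a) := by
  rw [eq_sum a, eq_sum b, sum_mul_sum, sum_mul_sum, ext_sum, ext_sum, ]
  simp only [ext_sum]
  rw [sum_comm]
  refine sum_congr rfl fun x _ => sum_congr rfl fun y _ => ?_
  rw [smul_mul_smul_comm, smul_mul_smul_comm, ← map_mul, ← map_mul, ext_smul, ext_smul, ext_of, ext_of,
    hf, mul_comm]
end

lemma ext_hom {A : Type*} [Ring A] [Algebra ℂ A] (T : G →* A) (a b : MonoidAlgebra ℂ G) :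
    ext T (a * b) = ext T a * ext T b := by
  conv_lhs => rw [eq_sum a, eq_sum b]
  rw [sum_mul_sum, ext_sum, ext, ext, sum_mul_sum]
  refine sum_congr rfl fun x _ => ?_
  rw [ext_sum]
  refine sum_congr rfl fun y _ => ?_
  rw [smul_mul_smul_comm, smul_mul_smul_comm, ext_smul, ← map_mul, ext_of, map_mul]

lemma ext_π (i : Fin W.N) (a : MonoidAlgebra ℂ G) : ext (W.π i) a = W.e a i := by
  conv_rhs => rw [eq_sum a, map_sum, Finset.sum_apply]
  rw [ext]
  refine sum_congr rfl fun g _ => ?_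
  rw [map_smul]; rfl

lemma ext_χ (i : Fin W.N) (a : MonoidAlgebra ℂ G) : ext (W.χ i) a = (W.e a i).trace := by
  rw [← ext_π, ext, ext, Matrix.trace_sum]
  refine sum_congr rfl fun g _ => ?_
  rw [Matrix.trace_smul]; rfl

lemma e_blk (i j : Fin W.N) (M) : W.e (W.blk i M) j = if h : j = i then h ▸ M else 0 := by
  rw [blk, AlgEquiv.apply_symm_apply]
  split_ifs with h
  · subst h; simp
  · rw [Pi.single_eq_of_ne h]

lemma e_blk_same (i : Fin W.N) (M) : W.e (W.blk i M) i = M := by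
  rw [blk, AlgEquiv.apply_symm_apply, Pi.single_eq_same]

lemma e_blk_ne {i j : Fin W.N} (h : j ≠ i) (M) : W.e (W.blk i M) j = 0 := by
  rw [blk, AlgEquiv.apply_symm_apply, Pi.single_eq_of_ne h]

lemma blk_mul (i : Fin W.N) (M M') : W.blk i M * W.blk i M' = W.blk i (M * M') := by
  rw [blk, blk, blk, ← map_mul, Pi.single_mul]

lemma sum_ε {A : Type*} [AddCommGroup A] [Module ℂ A] (f : G → A) (i : Fin W.N) :
    ∑ g, W.ε i g • f g = ext f (W.blk i (Matrix.single (W.z0 i) (W.z0 i) 1)) := rfl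

/-- W1 -/
lemma class_blk (f : G → ℂ) (hf : ∀ g h, f (g * h) = f (h * g)) (i : Fin W.N) (M) :
    ext f (W.blk i M) = (∑ x, W.ε i x * f x) * M.trace := by
  have h1 : ∀ k l, ext f (W.blk i (Matrix.single k l 1)) =
      if k = l then ∑ x, W.ε i x * f x else 0 := by
    intro k l
    have e : (Matrix.single k l 1 : Matrix (Fin (W.d i)) (Fin (W.d i)) ℂ) =
      Matrix.single k (W.z0 i) 1 * Matrix.single (W.z0 i) l 1 := by simp
    rw [e, ← blk_mul, ext_mul_comm f hf, blk_mul]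
    split_ifs with h
    · subst h
      rw [Matrix.single_mul_single_same, mul_one, ← sum_ε]; rfl
    · rw [Matrix.single_mul_single_of_ne _ _ _ _ (Ne.symm h), blk, Pi.single_zero, map_zero]; simp [ext]
  have h2 : W.blk i M = ∑ k, ∑ l, M k l • W.blk i (Matrix.single k l 1) := by
    apply W.e.injective
    funext j
    rw [map_sum, Finset.sum_apply]
    simp only [map_sum, Finset.sum_apply, map_smul, Pi.smul_apply]
    by_cases h : j = i
    · subst h
      simp only [e_blk_same]
      conv_lhs => rw [Matrix.matrix_eq_sum_single M]
      refine sum_congr rfl fun k _ => sum_congr rfl fun l _ => ?_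
      rw [Matrix.smul_single, smul_eq_mul, mul_one]
    · simp [W.e_blk_ne h]
  rw [h2, ext_sum]
  simp only [ext_sum, ext_smul, h1, Matrix.trace, mul_sum, Matrix.diag]
  refine sum_congr rfl fun k _ => ?_
  rw [sum_eq_single k]
  · simp [mul_comm]
  · intro b _ hb; simp [hb.symm]
  · simp

lemma class_ext (f : G → ℂ) (hf : ∀ g h, f (g * h) = f (h * g)) (a : MonoidAlgebra ℂ G) :
    ext f a = ∑ i, (∑ x, W.ε i x * f x) * ext (W.χ i) a := by
  have h : a = ∑ i, W.blk i (W.e a i) := by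
    apply W.e.injective
    rw [map_sum]
    funext j
    rw [Finset.sum_apply, sum_eq_single j]
    · rw [e_blk_same]
    · intro b _ hb; exact W.e_blk_ne hb.symm _
    · simp
  conv_lhs => rw [h, ext_sum]
  refine sum_congr rfl fun i _ => ?_
  rw [W.class_blk f hf, ext_χ]

lemma class_expand (f : G → ℂ) (hf : ∀ g h, f (g * h) = f (h * g)) (g : G) :
    f g = ∑ i, (∑ x, W.ε i x * f x) * W.χ i g := by
  have := W.class_ext f hf (MonoidAlgebra.of ℂ G g)
  simpa only [ext_of] using this

lemma χ_class (i : Fin W.N) (g h : G) : W.χ i (g * h) = W.χ i (h * g) := by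
  rw [χ, χ, map_mul, map_mul, Matrix.trace_mul_comm]

/-- W1 dual -/
lemma ε_χ (i j : Fin W.N) : ∑ x, W.ε i x * W.χ j x = if i = j then 1 else 0 := by
  have : ∑ x, W.ε i x * W.χ j x = ext (W.χ j) (W.blk i (Matrix.single (W.z0 i) (W.z0 i) 1)) := rfl
  rw [this, ext_χ]
  split_ifs with h
  · subst h; rw [e_blk_same]; simp
  · rw [W.e_blk_ne (Ne.symm h)]; simp

lemma ε_idem {A : Type*} [Ring A] [Algebra ℂ A] (T : G →* A) (i : Fin W.N) :
    (∑ x, W.ε i x • T x) * (∑ x, W.ε i x • T x) = ∑ x, W.ε i x • T x := by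
  rw [W.sum_ε (A := A) (fun x => T x), ← ext_hom, blk_mul]
  congr 2
  simp

/-- surjectivity -/
lemma π_span (i : Fin W.N) (M) : ∃ a : G → ℂ, M = ∑ g, a g • W.π i g := by
  refine ⟨fun g => (W.blk i M).coeff g, ?_⟩
  have := W.ext_π i (W.blk i M)
  rw [e_blk_same] at this
  exact this.symm

/-- Schur -/
lemma schur (i : Fin W.N) (M : Matrix (Fin (W.d i)) (Fin (W.d i)) ℂ) (h : ∀ g, M * W.π i g = W.π i g * M) :
    M = (M.trace / (W.d i : ℂ)) • (1 : Matrix (Fin (W.d i)) (Fin (W.d i)) ℂ) := by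
  have hd : (W.d i : ℂ) ≠ 0 := by exact_mod_cast (W.d_pos i).ne'
  have h1 : ∀ X, M * X = X * M := by
    intro X
    obtain ⟨a, rfl⟩ := W.π_span i X
    rw [mul_sum, sum_mul]
    refine sum_congr rfl fun g _ => ?_
    rw [mul_smul_comm, smul_mul_assoc, h]
  have h2 : M ∈ Set.range (Matrix.scalar (Fin (W.d i))) := by
    rw [Matrix.mem_range_scalar_iff_commute_single']
    intro k l
    exact (h1 _).symm
  obtain ⟨c, rfl⟩ := h2
  have : (Matrix.scalar (Fin (W.d i)) c) = c • (1 : Matrix (Fin (W.d i)) (Fin (W.d i)) ℂ) := by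
    ext k l; simp [Matrix.scalar_apply, Matrix.diagonal_apply, Matrix.one_apply]
  rw [this, Matrix.trace_smul, Matrix.trace_one, Fintype.card_fin, smul_eq_mul,
    mul_div_cancel_right₀ _ hd]

lemma avg_conj (i : Fin W.N) (M : Matrix (Fin (W.d i)) (Fin (W.d i)) ℂ) : ∑ g, W.π i g * M * W.π i g⁻¹ =
    ((Fintype.card G : ℂ) * M.trace / (W.d i : ℂ)) • (1 : Matrix (Fin (W.d i)) (Fin (W.d i)) ℂ) := by
  have h := W.schur i (∑ g, W.π i g * M * W.π i g⁻¹) ?_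
  · rw [h]
    congr 2
    rw [Matrix.trace_sum]
    have : ∀ g, (W.π i g * M * W.π i g⁻¹).trace = M.trace := by
      intro g
      rw [Matrix.trace_mul_comm, ← mul_assoc, ← map_mul, inv_mul_cancel, map_one, one_mul]
    simp [this]
  · intro h
    rw [sum_mul, mul_sum]
    refine Fintype.sum_equiv (Equiv.mulLeft h⁻¹) _ _ fun g => ?_
    simp only [Equiv.coe_mulLeft, mul_inv_rev, inv_inv, map_mul]
    rw [← mul_assoc, ← mul_assoc, ← mul_assoc, ← mul_assoc, ← map_mul, mul_inv_cancel, map_one, one_mul]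

/-- value at one -/
noncomputable def av (i : Fin W.N) : ℂ := W.ε i 1

lemma coeff_eq (a : MonoidAlgebra ℂ G) (g : G) :
    a.coeff g = ∑ j, W.av j * (W.e a j * W.π j g⁻¹).trace := by
  have h := W.class_ext (fun x => if x = 1 then (1 : ℂ) else 0) ?_
    (a * MonoidAlgebra.of ℂ G g⁻¹)
  · have e1 : ext (fun x => if x = 1 then (1 : ℂ) else 0) (a * MonoidAlgebra.of ℂ G g⁻¹) = a.coeff g := by
      rw [ext, sum_eq_single 1]
      · simp
      · intro b _ hb; simp [hb]
      · simp
    rw [← e1, h]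
    refine sum_congr rfl fun j _ => ?_
    congr 1
    · simp [av]
    · rw [ext_χ, map_mul]; rfl
  · intro g h
    have : g * h = 1 ↔ h * g = 1 := mul_eq_one_comm
    simp only [this]

/-- Fourier inversion in a block -/
lemma blk_inv (i : Fin W.N) (M) : M = ∑ g, (W.av i * (M * W.π i g⁻¹).trace) • W.π i g := by
  have h := W.ext_π i (W.blk i M)
  rw [e_blk_same] at h
  conv_lhs => rw [← h]
  rw [ext]
  refine sum_congr rfl fun g _ => ?_
  congr 1
  rw [W.coeff_eq, sum_eq_single i]
  · rw [e_blk_same]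
  · intro b _ hb; rw [W.e_blk_ne hb]; simp
  · simp

lemma blk_coeff (i : Fin W.N) (M) (g : G) :
    (W.blk i M).coeff g = W.av i * (M * W.π i g⁻¹).trace := by
  rw [W.coeff_eq, sum_eq_single i]
  · rw [e_blk_same]
  · intro b _ hb; rw [W.e_blk_ne hb]; simp
  · simp

lemma av_eq (i : Fin W.N) : W.av i = W.d i / Fintype.card G := by
  have hd : (W.d i : ℂ) ≠ 0 := by exact_mod_cast (W.d_pos i).ne'
  have hG : (Fintype.card G : ℂ) ≠ 0 := by exact_mod_cast Fintype.card_ne_zero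
  set o := W.z0 i
  have h1 := congrFun (congrFun (W.blk_inv i (Matrix.single o o 1)) o) o
  have h2 := congrFun (congrFun (W.avg_conj i (Matrix.single o o 1)) o) o
  have e : ∀ g : G, (Matrix.single o o 1 * W.π i g⁻¹).trace = W.π i g⁻¹ o o := by
    intro g
    rw [Matrix.trace_single_mul]; simp
  have e2 : ∀ g : G, (W.π i g * (Matrix.single o o 1 : Matrix (Fin (W.d i)) (Fin (W.d i)) ℂ) * W.π i g⁻¹) o o = W.π i g⁻¹ o o * W.π i g o o := by
    intro g
    rw [Matrix.mul_apply, sum_eq_single o]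
    · rw [Matrix.mul_single_apply_same]; ring
    · intro b _ hb; rw [Matrix.mul_single_apply_of_ne _ _ _ _ _ hb]; simp
    · simp
  rw [Matrix.sum_apply] at h1 h2
  simp only [e, e2, Matrix.smul_apply, Matrix.single_apply_same, Matrix.one_apply_eq, smul_eq_mul,
    Matrix.trace_single_eq_same, mul_one] at h1 h2
  simp only [mul_assoc] at h1
  rw [← mul_sum, h2] at h1
  field_simp at h1 ⊢
  linear_combination -h1

/-- W2 -/
lemma reg (g : G) : ∑ i, (W.d i : ℂ) * W.χ i g = if g = 1 then (Fintype.card G : ℂ) else 0 := by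
  have hG : (Fintype.card G : ℂ) ≠ 0 := by exact_mod_cast Fintype.card_ne_zero
  have h := W.coeff_eq (MonoidAlgebra.of ℂ G g) 1
  have e : (MonoidAlgebra.of ℂ G g).coeff 1 = if g = 1 then (1 : ℂ) else 0 := by
    simp [MonoidAlgebra.of, Finsupp.single_apply]
  rw [e] at h
  have : ∀ i, W.av i * (W.e (MonoidAlgebra.of ℂ G g) i * W.π i 1⁻¹).trace =
      (W.d i : ℂ) * W.χ i g / Fintype.card G := by
    intro i
    rw [inv_one, map_one, mul_one, av_eq]
    change _ * W.χ i g = _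
    ring
  simp only [this] at h
  rw [← sum_div] at h
  rw [eq_div_iff hG] at h
  rw [← h]; split_ifs <;> simp

/-- W4 -/
lemma class_coeff (f : G → ℂ) (hf : ∀ g h, f (g * h) = f (h * g)) (i : Fin W.N) :
    ∑ x, W.ε i x * f x = (∑ g, f g * W.χ i g⁻¹) / Fintype.card G := by
  have hd : (W.d i : ℂ) ≠ 0 := by exact_mod_cast (W.d_pos i).ne'
  have hG : (Fintype.card G : ℂ) ≠ 0 := by exact_mod_cast Fintype.card_ne_zero
  have h := W.schur i (∑ g, f g • W.π i g⁻¹) ?_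
  · have h1 := congrFun (congrFun h (W.z0 i)) (W.z0 i)
    rw [Matrix.sum_apply, Matrix.trace_sum] at h1
    simp only [Matrix.smul_apply, smul_eq_mul, Matrix.one_apply_eq, mul_one, Matrix.trace_smul] at h1
    have e : ∀ x, W.ε i x * f x = (W.d i : ℂ) / Fintype.card G * (f x * W.π i x⁻¹ (W.z0 i) (W.z0 i)) := by
      intro x
      rw [ε, blk_coeff, av_eq, Matrix.trace_single_mul, one_smul]
      ring
    simp only [e]
    rw [← mul_sum, h1]
    simp only [χ]
    field_simp
  · intro h
    rw [sum_mul, mul_sum]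
    refine Fintype.sum_equiv (MulAut.conj h⁻¹).toEquiv _ _ fun g => ?_
    simp only [MulEquiv.toEquiv_eq_coe, EquivLike.coe_coe, MulAut.conj_apply, inv_inv, smul_mul_assoc, mul_smul_comm,
      ← map_mul, mul_inv_rev]
    congr 1
    · rw [mul_assoc, hf, mul_assoc, mul_inv_cancel, mul_one]
    · congr 1; group

/-- row orthogonality -/
lemma ortho (i j : Fin W.N) :
    (∑ g, W.χ j g * W.χ i g⁻¹) / Fintype.card G = if i = j then 1 else 0 := by
  rw [← W.class_coeff _ (W.χ_class j), ε_χ]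

/-- linear independence -/
lemma lin_indep (c c' : Fin W.N → ℂ) (h : ∀ g, ∑ i, c i * W.χ i g = ∑ i, c' i * W.χ i g) : c = c' := by
  have key : ∀ (c : Fin W.N → ℂ) i, ∑ x, W.ε i x * ∑ j, c j * W.χ j x = c i := by
    intro c i
    simp only [mul_sum]
    rw [sum_comm]
    have : ∀ j, ∑ x, W.ε i x * (c j * W.χ j x) = c j * ∑ x, W.ε i x * W.χ j x := by
      intro j; rw [mul_sum]; refine sum_congr rfl fun x _ => by ring
    simp only [this, ε_χ]; simp
  funext i
  rw [← key c i, ← key c' i]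
  refine sum_congr rfl fun x _ => by rw [h]

/-- commutator sum -/
lemma comm_sum (i : Fin W.N) : ∑ a, ∑ b, W.π i (a * b * a⁻¹ * b⁻¹) =
    (((Fintype.card G : ℂ) / W.d i) ^ 2) • (1 : Matrix (Fin (W.d i)) (Fin (W.d i)) ℂ) := by
  have hd : (W.d i : ℂ) ≠ 0 := by exact_mod_cast (W.d_pos i).ne'
  have hG : (Fintype.card G : ℂ) ≠ 0 := by exact_mod_cast Fintype.card_ne_zero
  rw [sum_comm]
  have e : ∀ b, ∑ a, W.π i (a * b * a⁻¹ * b⁻¹) =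
      (((Fintype.card G : ℂ)  / W.d i) * W.χ i b) • W.π i b⁻¹ := by
    intro b
    have : ∑ a, W.π i (a * b * a⁻¹ * b⁻¹) = (∑ a, W.π i a * W.π i b * W.π i a⁻¹) * W.π i b⁻¹ := by
      rw [sum_mul]; refine sum_congr rfl fun a _ => by simp only [map_mul]
    rw [this, avg_conj, smul_mul_assoc, one_mul, χ]
    congr 1; ring
  simp only [e]
  have h := W.blk_inv i 1
  rw [av_eq] at h
  simp only [one_mul] at h
  rw [h, smul_sum]
  refine Fintype.sum_equiv (Equiv.inv G) _ _ fun g => ?_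
  simp only [Equiv.inv_apply, inv_inv, smul_smul]
  congr 1
  rw [χ]
  field_simp

end WD
end TCV

open scoped MatrixGroups
namespace TCV
open Finset
set_option linter.unusedSectionVars false
set_option linter.unusedSimpArgs false
set_option linter.unusedVariables false

lemma sum_ofFn_prod {R α : Type*} [Semiring R] [Fintype α] (f : α → R) (g : ℕ) :
    ∑ p : Fin g → α, (List.ofFn fun i => f (p i)).prod = (∑ a, f a) ^ g := by
  induction g with
  | zero => simp
  | succ g ih =>
    rw [pow_succ', ← ih, sum_mul_sum, ← Fintype.sum_prod_type']
    symm
    refine Fintype.sum_equiv (Fin.consEquiv fun _ => α) _ _ fun x => ?_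
    simp [Fin.consEquiv, List.ofFn_succ]

namespace WD
variable {G : Type} [Group G] [Fintype G] [DecidableEq G] (W : WD G)

lemma count (g : ℕ) (ζ : G) :
    (Nat.card {p : (Fin g → G) × (Fin g → G) //
      (List.ofFn fun i => p.1 i * p.2 i * (p.1 i)⁻¹ * (p.2 i)⁻¹).prod = ζ} : ℂ) =
    ∑ i, ((W.d i : ℂ) / Fintype.card G) * (((Fintype.card G : ℂ) / W.d i) ^ 2) ^ g * W.χ i ζ⁻¹ := by
  classical
  have hG : (Fintype.card G : ℂ) ≠ 0 := by exact_mod_cast Fintype.card_ne_zero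
  set P : (Fin g → G) × (Fin g → G) → G := fun p =>
    (List.ofFn fun i => p.1 i * p.2 i * (p.1 i)⁻¹ * (p.2 i)⁻¹).prod with hP
  have e1 : (Nat.card {p : (Fin g → G) × (Fin g → G) // P p = ζ} : ℂ) =
      ∑ p, (∑ i, (W.d i : ℂ) * W.χ i (P p * ζ⁻¹)) / Fintype.card G := by
    rw [Nat.card_eq_fintype_card, Fintype.card_subtype, card_filter]
    push_cast
    refine sum_congr rfl fun p _ => ?_
    rw [reg]
    simp only [mul_inv_eq_one]
    split_ifs
    · rw [div_self hG]
    · simp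
  change (Nat.card {p : (Fin g → G) × (Fin g → G) // P p = ζ} : ℂ) = _
  rw [e1, ← sum_div, sum_comm, sum_div]
  refine sum_congr rfl fun i _ => ?_
  have e2 : ∑ p, W.π i (P p) = ((((Fintype.card G : ℂ) / W.d i) ^ 2) ^ g) •
      (1 : Matrix (Fin (W.d i)) (Fin (W.d i)) ℂ) := by
    have h := sum_ofFn_prod (fun x : G × G => W.π i (x.1 * x.2 * x.1⁻¹ * x.2⁻¹)) g
    rw [Fintype.sum_prod_type, comm_sum, smul_pow, one_pow] at h
    rw [← h]
    symm
    refine Fintype.sum_equiv (Equiv.arrowProdEquivProdArrow (Fin g) (fun _ => G) (fun _ => G)) _ _ fun p => ?_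
    rw [hP]
    simp only [map_list_prod, List.map_ofFn]
    rfl
  have e3 : ∑ p, W.χ i (P p * ζ⁻¹) = (((Fintype.card G : ℂ) / W.d i) ^ 2) ^ g * W.χ i ζ⁻¹ := by
    have : ∀ p, W.χ i (P p * ζ⁻¹) = (W.π i (P p) * W.π i ζ⁻¹).trace := by
      intro p; rw [χ, map_mul]
    simp only [this]
    rw [← Matrix.trace_sum, ← sum_mul, e2, smul_mul_assoc, one_mul, Matrix.trace_smul]; rfl
  rw [← mul_sum, e3]
  ring

/-- scalar by which a central element acts -/
lemma central (i : Fin W.N) {z : G} (hz : ∀ g, z * g = g * z) :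
    W.π i z = (W.χ i z / (W.d i : ℂ)) • (1 : Matrix (Fin (W.d i)) (Fin (W.d i)) ℂ) :=
  W.schur i _ fun g => by rw [← map_mul, hz, map_mul]

/-- central character through a hom into the centre -/
noncomputable def cen {Z : Type} [CommGroup Z] (ι : Z →* G) (hι : ∀ z g, ι z * g = g * ι z)
    (i : Fin W.N) : Z →* ℂ where
  toFun z := W.π i (ι z) (W.z0 i) (W.z0 i)
  map_one' := by simp
  map_mul' a b := by
    rw [map_mul, map_mul, W.central i (hι a), W.central i (hι b)]
    simp [mul_comm]

lemma cen_apply {Z : Type} [CommGroup Z] (ι : Z →* G) (hι : ∀ z g, ι z * g = g * ι z)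
    (i : Fin W.N) (z : Z) : W.π i (ι z) = (W.cen ι hι i z) • (1 : Matrix (Fin (W.d i)) (Fin (W.d i)) ℂ) := by
  have h := W.central i (hι z)
  have : W.cen ι hι i z = W.π i (ι z) (W.z0 i) (W.z0 i) := rfl
  rw [this]
  rw [h]; simp

lemma cen_mul {Z : Type} [CommGroup Z] (ι : Z →* G) (hι : ∀ z g, ι z * g = g * ι z)
    (i : Fin W.N) (z : Z) (g : G) : W.χ i (ι z * g) = W.cen ι hι i z * W.χ i g := by
  rw [χ, map_mul, cen_apply W ι hι, smul_mul_assoc, one_mul, Matrix.trace_smul]; rfl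

lemma χ_one (i : Fin W.N) : W.χ i 1 = W.d i := by
  rw [χ, map_one, Matrix.trace_one, Fintype.card_fin]

lemma cen_χ {Z : Type} [CommGroup Z] (ι : Z →* G) (hι : ∀ z g, ι z * g = g * ι z)
    (i : Fin W.N) (z : Z) : W.χ i (ι z) = W.cen ι hι i z * W.d i := by
  have := W.cen_mul ι hι i z 1
  rwa [mul_one, χ_one] at this
end WD

/-- idempotent of a character of a finite group mapped to an algebra -/
lemma theta_idem {H A : Type*} [Group H] [Fintype H] [Ring A] [Algebra ℂ A] (T : H →* A)
    (θ : H →* ℂ) :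
    (∑ h, ((Fintype.card H : ℂ)⁻¹ * θ h) • T h) * (∑ h, ((Fintype.card H : ℂ)⁻¹ * θ h) • T h) =
      ∑ h, ((Fintype.card H : ℂ)⁻¹ * θ h) • T h := by
  have hH : (Fintype.card H : ℂ) ≠ 0 := by exact_mod_cast Fintype.card_ne_zero
  rw [sum_mul_sum]
  have e : ∀ a : H, ∑ b, (((Fintype.card H : ℂ)⁻¹ * θ a) • T a) * (((Fintype.card H : ℂ)⁻¹ * θ b) • T b) =
      (Fintype.card H : ℂ)⁻¹ • ∑ h, ((Fintype.card H : ℂ)⁻¹ * θ h) • T h := by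
    intro a
    rw [smul_sum]
    refine Fintype.sum_equiv (Equiv.mulLeft a) _ _ fun b => ?_
    simp only [Equiv.coe_mulLeft, smul_mul_smul_comm, smul_smul, map_mul]
    congr 1; ring
  simp only [e]
  rw [sum_const, card_univ, ← Nat.cast_smul_eq_nsmul ℂ, smul_smul, mul_inv_cancel₀ hH, one_smul]

end TCV

open scoped MatrixGroups
namespace TCV
open Finset
set_option linter.unusedSectionVars false
set_option linter.unusedSimpArgs false
set_option linter.unusedVariables false

section
variable {F : Type} [Field F] [Fintype F] [DecidableEq F]

noncomputable instance fH {V V' : Type} [AddCommGroup V] [Module F V] [AddCommGroup V'] [Module F V']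
    [Finite V] [Finite V'] : Fintype (V →ₗ[F] V') :=
  @Fintype.ofFinite _ (DFunLike.finite _)

noncomputable instance fS {V : Type} [AddCommGroup V] [Module F V]
    [Finite V] : Fintype (Submodule F V) :=
  @Fintype.ofFinite _ (Finite.of_injective (fun W : Submodule F V => (W : Set V)) SetLike.coe_injective)

/-- the chosen Wedderburn data -/
noncomputable def wd (F : Type) [Field F] [Fintype F] [DecidableEq F] (m : ℕ) : WD (GL (Fin m) F) :=
  (WD.exists _).some

/-- index set of irreducible characters of `GL m` -/
abbrev Ir (F : Type) [Field F] [Fintype F] [DecidableEq F] (m : ℕ) : Type := Fin (wd F m).N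

/-- action of a group element -/
noncomputable def tl {m : ℕ} (g : GL (Fin m) F) : (Fin m → F) →ₗ[F] (Fin m → F) := Matrix.toLin' g.1

noncomputable def gl {m : ℕ} (e : (Fin m → F) ≃ₗ[F] (Fin m → F)) : GL (Fin m) F where
  val := LinearMap.toMatrix' e.toLinearMap
  inv := LinearMap.toMatrix' e.symm.toLinearMap
  val_inv := by rw [← LinearMap.toMatrix'_comp]; simp
  inv_val := by rw [← LinearMap.toMatrix'_comp]; simp

lemma tl_gl {m : ℕ} (e : (Fin m → F) ≃ₗ[F] (Fin m → F)) : tl (gl e) = e.toLinearMap := by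
  simp [tl, gl]

lemma tl_inj {m : ℕ} {g h : GL (Fin m) F} (H : tl g = tl h) : g = h :=
  Units.ext (Matrix.toLin'.injective H)

lemma tl_mul {m : ℕ} (g h : GL (Fin m) F) : tl (g * h) = tl g ∘ₗ tl h := by
  simp [tl, Matrix.toLin'_mul]

lemma tl_one {m : ℕ} : tl (1 : GL (Fin m) F) = LinearMap.id := by
  simp [tl]

lemma tl_mul_inv {m : ℕ} (g : GL (Fin m) F) (v) : tl g (tl g⁻¹ v) = v := by
  have := congrArg (fun f => f v) (tl_mul g g⁻¹)
  simpa [tl_one] using this.symm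

lemma tl_inv_mul {m : ℕ} (g : GL (Fin m) F) (v) : tl g⁻¹ (tl g v) = v := by
  have := tl_mul_inv g⁻¹ v
  rwa [inv_inv] at this

noncomputable def tlE {m : ℕ} (g : GL (Fin m) F) : (Fin m → F) ≃ₗ[F] (Fin m → F) :=
  LinearEquiv.ofLinearMap (tl g) (tl g⁻¹) (LinearMap.ext fun v => by simp [tl_mul_inv])
    (LinearMap.ext fun v => by simp [tl_inv_mul])

lemma tlE_apply {m : ℕ} (g : GL (Fin m) F) (v) : tlE g v = tl g v := rfl
lemma tlE_symm_apply {m : ℕ} (g : GL (Fin m) F) (v) : (tlE g).symm v = tl g⁻¹ v := rfl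

/-- character extended by zero to all matrices -/
noncomputable def chm {m : ℕ} (w : Ir F m) (M : Matrix (Fin m) (Fin m) F) : ℂ :=
  open Classical in if h : IsUnit M then (wd F m).χ w h.unit else 0

lemma chm_coe {m : ℕ} (w : Ir F m) (g : GL (Fin m) F) : chm w g.1 = (wd F m).χ w g := by
  rw [chm, dif_pos g.isUnit]; congr 1; exact IsUnit.unit_of_val_units g.isUnit

lemma chm_conj {m : ℕ} (w : Ir F m) (g : GL (Fin m) F) (M : Matrix (Fin m) (Fin m) F) :
    chm w (g.1 * M * g⁻¹.1) = chm w M := by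
  by_cases h : IsUnit M
  · obtain ⟨M, rfl⟩ := h
    rw [← Units.val_mul, ← Units.val_mul, chm_coe, chm_coe, WD.χ_class, ← mul_assoc, inv_mul_cancel,
      one_mul]
  · rw [chm, chm, dif_neg h, dif_neg]
    intro h'; apply h
    have := (Units.isUnit g⁻¹).mul (h'.mul (Units.isUnit g))
    simpa [mul_assoc] using this

/-- the character on all endomorphisms of all spaces -/
noncomputable def X {m : ℕ} (w : Ir F m) (V : Type) [AddCommGroup V] [Module F V] (x : V →ₗ[F] V) : ℂ :=
  open Classical in if h : Nonempty ((Fin m → F) ≃ₗ[F] V) then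
    chm w (LinearMap.toMatrix' (h.some.symm.toLinearMap ∘ₗ x ∘ₗ h.some.toLinearMap)) else 0

variable {V V' : Type} [AddCommGroup V] [Module F V] [AddCommGroup V'] [Module F V']

lemma X_frame {m : ℕ} (w : Ir F m) (x : V →ₗ[F] V) (e : (Fin m → F) ≃ₗ[F] V) :
    X w V x = chm w (LinearMap.toMatrix' (e.symm.toLinearMap ∘ₗ x ∘ₗ e.toLinearMap)) := by
  have h : Nonempty ((Fin m → F) ≃ₗ[F] V) := ⟨e⟩
  rw [X, dif_pos h]
  generalize h.some = e'
  rw [← chm_conj w (gl (e'.trans e.symm))]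
  congr 1
  change LinearMap.toMatrix' _ * _ * LinearMap.toMatrix' _ = _
  rw [← LinearMap.toMatrix'_comp, ← LinearMap.toMatrix'_comp]
  congr 1
  refine LinearMap.ext fun v => ?_
  simp

lemma X_iso {m : ℕ} (w : Ir F m) {x : V →ₗ[F] V} {x' : V' →ₗ[F] V'} (e : V ≃ₗ[F] V')
    (h : ∀ v, e (x v) = x' (e v)) : X w V x = X w V' x' := by
  by_cases hV : Nonempty ((Fin m → F) ≃ₗ[F] V)
  · obtain ⟨f⟩ := hV
    rw [X_frame w x f, X_frame w x' (f.trans e)]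
    congr 2
    apply LinearMap.ext
    intro v
    simp [← h]
  · rw [X, dif_neg hV, X, dif_neg]
    rintro ⟨f⟩; exact hV ⟨f.trans e.symm⟩

lemma X_std {m : ℕ} (w : Ir F m) (g : GL (Fin m) F) : X w (Fin m → F) (tl g) = (wd F m).χ w g := by
  rw [X_frame w _ (LinearEquiv.refl F _), ← chm_coe]
  congr 1
  simp [tl]

lemma X_dim {m : ℕ} (w : Ir F m) (x : V →ₗ[F] V) (h : Module.finrank F V ≠ m) : X w V x = 0 := by
  rw [X, dif_neg]
  rintro ⟨e⟩
  apply h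
  rw [← e.finrank_eq]; simp

lemma X_unit {m : ℕ} (w : Ir F m) (x : V →ₗ[F] V) (h : X w V x ≠ 0) : Function.Bijective x := by
  by_cases hV : Nonempty ((Fin m → F) ≃ₗ[F] V)
  · obtain ⟨f⟩ := hV
    rw [X_frame w x f, chm] at h
    split_ifs at h with hu
    · obtain ⟨u, hu⟩ := hu
      have e : x = f.toLinearMap ∘ₗ (tlE u).toLinearMap ∘ₗ f.symm.toLinearMap := by
        have : (tlE u).toLinearMap = f.symm.toLinearMap ∘ₗ x ∘ₗ f.toLinearMap := by
          apply LinearMap.toMatrix'.injective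
          rw [← hu]
          change LinearMap.toMatrix' (Matrix.toLin' u.1) = _
          simp
        rw [this]
        ext1 v; simp
      rw [e]
      simp only [LinearMap.coe_comp, LinearEquiv.coe_coe]
      exact f.bijective.comp ((tlE u).bijective.comp f.symm.bijective)
    · exact absurd rfl h
  · rw [X, dif_neg hV] at h; exact absurd rfl h

/-- frame of a space of given dimension -/
lemma exists_frame [Finite V] {m : ℕ} (h : Module.finrank F V = m) : Nonempty ((Fin m → F) ≃ₗ[F] V) := by
  have : Module.Finite F V := Module.Finite.of_finite
  exact ⟨LinearEquiv.ofFinrankEq _ _ (by simp [h])⟩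

/-- transport a bijective endo to GL -/
lemma exists_gl {m : ℕ} (e : (Fin m → F) ≃ₗ[F] V) (x : V →ₗ[F] V) (hx : Function.Bijective x) :
    ∃ g : GL (Fin m) F, ∀ v, e (tl g v) = x (e v) := by
  refine ⟨gl (e.trans ((LinearEquiv.ofBijective x hx).trans e.symm)), fun v => ?_⟩
  rw [tl_gl]; simp

/-! ### block operators -/
variable {Y Z Y' Z' : Type} [AddCommGroup Y] [Module F Y] [AddCommGroup Z] [Module F Z]
  [AddCommGroup Y'] [Module F Y'] [AddCommGroup Z'] [Module F Z']

def bl (y : Y →ₗ[F] Y) (u : Z →ₗ[F] Y) (z : Z →ₗ[F] Z) : Y × Z →ₗ[F] Y × Z :=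
  LinearMap.prod (y ∘ₗ LinearMap.fst F Y Z + u ∘ₗ LinearMap.snd F Y Z) (z ∘ₗ LinearMap.snd F Y Z)

@[simp] lemma bl_apply (y : Y →ₗ[F] Y) (u : Z →ₗ[F] Y) (z : Z →ₗ[F] Z) (p : Y × Z) :
    bl y u z p = (y p.1 + u p.2, z p.2) := rfl

lemma bl_bij [Finite Y] [Finite Z] {y : Y →ₗ[F] Y} {u : Z →ₗ[F] Y} {z : Z →ₗ[F] Z} :
    Function.Bijective (bl y u z) ↔ Function.Bijective y ∧ Function.Bijective z := by
  constructor
  · intro h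
    constructor
    · rw [← Finite.injective_iff_bijective, injective_iff_map_eq_zero]
      intro a ha
      have := (injective_iff_map_eq_zero _).1 h.1 (a, 0) (by simp [ha])
      simpa using this
    · rw [← Finite.surjective_iff_bijective]
      intro a
      obtain ⟨p, hp⟩ := h.2 (0, a)
      exact ⟨p.2, by simpa using congrArg Prod.snd hp⟩
  · rintro ⟨hy, hz⟩
    rw [← Finite.injective_iff_bijective, injective_iff_map_eq_zero]
    rintro ⟨a, b⟩ h
    rw [bl_apply, Prod.mk_eq_zero] at h
    have hb := (injective_iff_map_eq_zero z).1 hz.1 b h.2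
    subst hb
    have ha := (injective_iff_map_eq_zero y).1 hy.1 a (by simpa using h.1)
    subst ha; rfl

/-! ### comultiplication -/

/-- average over the unipotent radical -/
noncomputable def Dl {m : ℕ} (w : Ir F m) (Y : Type) [AddCommGroup Y] [Module F Y] [Finite Y]
    (y : Y →ₗ[F] Y) (Z : Type) [AddCommGroup Z] [Module F Z] [Finite Z] (z : Z →ₗ[F] Z) : ℂ :=
  (∑ u : Z →ₗ[F] Y, X w (Y × Z) (bl y u z)) / Fintype.card (Z →ₗ[F] Y)

lemma Dl_iso [Finite Y] [Finite Z] [Finite Y'] [Finite Z'] {m : ℕ} (w : Ir F m)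
    {y : Y →ₗ[F] Y} {z : Z →ₗ[F] Z} {y' : Y' →ₗ[F] Y'} {z' : Z' →ₗ[F] Z'} (e : Y ≃ₗ[F] Y') (f : Z ≃ₗ[F] Z')
    (he : ∀ v, e (y v) = y' (e v)) (hf : ∀ v, f (z v) = z' (f v)) :
    Dl w Y y Z z = Dl w Y' y' Z' z' := by
  rw [Dl, Dl]
  have E : (Z →ₗ[F] Y) ≃ (Z' →ₗ[F] Y') := (LinearEquiv.arrowCongr f e).toEquiv
  congr 1
  · refine Fintype.sum_equiv (LinearEquiv.arrowCongr f e).toEquiv _ _ fun u => ?_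
    refine X_iso w (e.prodCongr f) fun v => ?_
    ext <;> simp [he, hf, LinearEquiv.arrowCongr_apply]
  · rw [Fintype.card_congr E]

lemma Dl_bij [Finite Y] [Finite Z] {m : ℕ} (w : Ir F m) {y : Y →ₗ[F] Y} {z : Z →ₗ[F] Z}
    (h : Dl w Y y Z z ≠ 0) : Function.Bijective y ∧ Function.Bijective z := by
  by_contra hc
  apply h
  rw [Dl, sum_eq_zero, zero_div]
  intro u _
  by_contra hx
  exact hc (bl_bij.1 (X_unit w _ hx))

/-- structure constants -/
noncomputable def cc {k l m : ℕ} (a : Ir F k) (b : Ir F l) (w : Ir F m) : ℂ :=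
  ∑ h : GL (Fin l) F, (wd F l).ε b h * ∑ g : GL (Fin k) F, (wd F k).ε a g *
    Dl w (Fin k → F) (tl g) (Fin l → F) (tl h)

lemma Dl_std {k l m : ℕ} (w : Ir F m) (g : GL (Fin k) F) (h : GL (Fin l) F) :
    Dl w (Fin k → F) (tl g) (Fin l → F) (tl h) =
      ∑ a : Ir F k, ∑ b : Ir F l, cc a b w * ((wd F k).χ a g * (wd F l).χ b h) := by
  have conj : ∀ {k : ℕ} (g h : GL (Fin k) F) v, tlE h (tl (g * h) v) = tl (h * g) (tlE h v) := by
    intro k g h v; rw [tlE_apply, tlE_apply, tl_mul, tl_mul]; rfl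
  rw [(wd F k).class_expand (fun g => Dl w (Fin k → F) (tl g) (Fin l → F) (tl h))
    (fun g g' => Dl_iso w (tlE g') (LinearEquiv.refl F _) (conj g g') (fun _ => rfl)) g]
  refine sum_congr rfl fun a _ => ?_
  rw [(wd F l).class_expand (fun h => ∑ x, (wd F k).ε a x * Dl w (Fin k → F) (tl x) (Fin l → F) (tl h))
    (fun h h' => sum_congr rfl fun x _ => 
      congrArg _ (Dl_iso w (y := tl x) (y' := tl x) (LinearEquiv.refl F _) (tlE h') (fun _ => rfl) (conj h h'))) h, sum_mul]
  refine sum_congr rfl fun b _ => ?_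
  rw [cc]; ring

lemma cc_deg {k l m : ℕ} (a : Ir F k) (b : Ir F l) (w : Ir F m) (h : cc a b w ≠ 0) : m = k + l := by
  by_contra hc
  apply h
  rw [cc, sum_eq_zero]
  intro g _
  rw [sum_eq_zero, mul_zero]
  intro g' _
  rw [Dl, sum_eq_zero, zero_div, mul_zero]
  intro u _
  apply X_dim
  simp; omega

/-- expansion of the comultiplication in any dimension -/
lemma Dl_expand [Finite Y] [Finite Z] {k l m : ℕ} (w : Ir F m) (y : Y →ₗ[F] Y) (z : Z →ₗ[F] Z)
    (hk : Module.finrank F Y = k) (hl : Module.finrank F Z = l) :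
    Dl w Y y Z z = ∑ a : Ir F k, ∑ b : Ir F l, cc a b w * (X a Y y * X b Z z) := by
  by_cases h : Function.Bijective y ∧ Function.Bijective z
  · obtain ⟨e⟩ := exists_frame hk
    obtain ⟨f⟩ := exists_frame hl
    obtain ⟨g, hg⟩ := exists_gl e y h.1
    obtain ⟨g', hg'⟩ := exists_gl f z h.2
    rw [← Dl_iso w e f hg hg', Dl_std]
    refine sum_congr rfl fun a _ => sum_congr rfl fun b _ => ?_
    rw [← X_iso a e hg, ← X_iso b f hg', X_std, X_std]
  · have h1 : Dl w Y y Z z = 0 := by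
      by_contra hc; exact h (Dl_bij w hc)
    rw [h1]; symm
    refine sum_eq_zero fun a _ => sum_eq_zero fun b _ => ?_
    by_cases hy : X a Y y = 0
    · simp [hy]
    by_cases hz : X b Z z = 0
    · simp [hz]
    exact absurd ⟨X_unit a y hy, X_unit b z hz⟩ h

/-- extraction of coefficients -/
lemma two_indep {k l : ℕ} (c c' : Ir F k → Ir F l → ℂ)
    (h : ∀ g h, ∑ a, ∑ b, c a b * ((wd F k).χ a g * (wd F l).χ b h) =
      ∑ a, ∑ b, c' a b * ((wd F k).χ a g * (wd F l).χ b h)) : c = c' := by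
  have h1 : ∀ h, (fun a => ∑ b, c a b * (wd F l).χ b h) = fun a => ∑ b, c' a b * (wd F l).χ b h := by
    intro h'
    refine (wd F k).lin_indep _ _ fun g => ?_
    have := h g h'
    simp only [sum_mul]
    refine Eq.trans (sum_congr rfl fun a _ => sum_congr rfl fun b _ => ?_)
      (this.trans (sum_congr rfl fun a _ => sum_congr rfl fun b _ => ?_)) <;> ring
  funext a
  exact (wd F l).lin_indep _ _ fun h' => congrFun (h1 h') a

end
end TCV

open scoped MatrixGroups
namespace TCV
open Finset
set_option linter.unusedSectionVars false
set_option linter.unusedSimpArgs false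
set_option linter.unusedVariables false

lemma avg_surj {A B : Type} [AddCommGroup A] [AddCommGroup B] [Fintype A] [Fintype B] (f : A →+ B)
    (hf : Function.Surjective f) (g : B → ℂ) :
    (∑ a, g (f a)) / Fintype.card A = (∑ b, g b) / Fintype.card B := by
  classical
  have key : ∀ b, #{a | f a = b} = #{a | f a = 0} := by
    intro b
    obtain ⟨a0, rfl⟩ := hf b
    refine card_bij' (fun a _ => a - a0) (fun a _ => a + a0) ?_ ?_ ?_ ?_ <;> simp
    intro a ha; rw [ha, sub_self]
  have h1 : ∀ g : B → ℂ, ∑ a, g (f a) = #{a | f a = 0} * ∑ b, g b := by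
    intro g
    rw [← sum_fiberwise univ f, mul_sum]
    refine sum_congr rfl fun b _ => ?_
    rw [← key b, ← nsmul_eq_mul, ← sum_const]
    refine sum_congr rfl fun a ha => ?_
    rw [(mem_filter.1 ha).2]
  have h2 := h1 (fun _ => 1)
  simp only [sum_const, card_univ, nsmul_eq_mul, mul_one] at h2
  rw [h1, h2]
  have h3 : ((Fintype.card A : ℕ) : ℂ) ≠ 0 := by
    rw [Nat.cast_ne_zero]; exact Fintype.card_ne_zero
  rw [h2] at h3
  rw [mul_div_mul_left _ _ (left_ne_zero_of_mul h3)]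

section
variable {F : Type} [Field F] [Fintype F] [DecidableEq F]
variable {V V' : Type} [AddCommGroup V] [Module F V] [AddCommGroup V'] [Module F V']
variable {Y Z Y' Z' : Type} [AddCommGroup Y] [Module F Y] [AddCommGroup Z] [Module F Z]
  [AddCommGroup Y'] [Module F Y'] [AddCommGroup Z'] [Module F Z']

/-- the summand of the induced character -/
noncomputable def T {k l : ℕ} (a : Ir F k) (b : Ir F l) (x : V →ₗ[F] V) (W : Submodule F V) : ℂ :=
  open Classical in if h : ∀ v ∈ W, x v ∈ W then
    X a W (x.restrict h) * X b (V ⧸ W) (W.mapQ W x h) else 0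

lemma T_eq {k l : ℕ} (a : Ir F k) (b : Ir F l) {x : V →ₗ[F] V} {W : Submodule F V}
    (h : ∀ v ∈ W, x v ∈ W) {y : Y →ₗ[F] Y} {z : Z →ₗ[F] Z} (e : W ≃ₗ[F] Y) (f : (V ⧸ W) ≃ₗ[F] Z)
    (he : ∀ v : W, e ⟨x v, h v v.2⟩ = y (e v)) (hf : ∀ v : V, f (W.mkQ (x v)) = z (f (W.mkQ v))) :
    T a b x W = X a Y y * X b Z z := by
  rw [T, dif_pos h]
  congr 1
  · exact X_iso a e he
  · refine X_iso b f fun v => ?_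
    obtain ⟨v, rfl⟩ := W.mkQ_surjective v
    exact hf v

lemma T_bl {k l : ℕ} (a : Ir F k) (b : Ir F l) {x : V →ₗ[F] V} {W : Submodule F V}
    (E : (Y × Z) ≃ₗ[F] V) (hW : ∀ v, v ∈ W ↔ (E.symm v).2 = 0) {y : Y →ₗ[F] Y} {u : Z →ₗ[F] Y} {z : Z →ₗ[F] Z}
    (hx : ∀ p, x (E p) = E (bl y u z p)) : T a b x W = X a Y y * X b Z z := by
  have hx' : ∀ v, E.symm (x v) = bl y u z (E.symm v) := by
    intro v
    obtain ⟨p, rfl⟩ := E.surjective v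
    rw [hx]; simp
  have h : ∀ v ∈ W, x v ∈ W := by
    intro v hv
    rw [hW] at hv ⊢
    rw [hx']; simp [hv]
  let e : W ≃ₗ[F] Y := 
    { toFun := fun v => (E.symm v).1
      map_add' := by intro u v; simp
      map_smul' := by intro u v; simp
      invFun := fun v => ⟨E (v, 0), by rw [hW]; simp⟩
      left_inv := by
        intro v
        have := (hW v).1 v.2
        apply Subtype.ext
        change E ((E.symm v).1, 0) = v
        rw [← this]; simp
      right_inv := by intro v; simp }
  have hk : W = LinearMap.ker (LinearMap.snd F Y Z ∘ₗ E.symm.toLinearMap) := by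
    ext v; rw [hW]; simp
  have hr : LinearMap.range (LinearMap.snd F Y Z ∘ₗ E.symm.toLinearMap) = ⊤ := by
    rw [LinearMap.range_eq_top]
    intro v; exact ⟨E (0, v), by simp⟩
  let f : (V ⧸ W) ≃ₗ[F] Z := (Submodule.quotEquivOfEq _ _ hk).trans (LinearMap.quotKerEquivOfSurjective _
    (LinearMap.range_eq_top.1 hr))
  have hf : ∀ v, f (W.mkQ v) = (E.symm v).2 := by
    intro v; simp [f]
  refine T_eq a b h e f ?_ ?_
  · intro v
    change (E.symm (x v)).1 = y (E.symm v).1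
    rw [hx', bl_apply, (hW v).1 v.2]; simp
  · intro v
    rw [hf, hf, hx', bl_apply]

lemma T_conj {k l : ℕ} (a : Ir F k) (b : Ir F l) {x : V →ₗ[F] V} {x' : V' →ₗ[F] V'} {W : Submodule F V}
    {W' : Submodule F V'} (e : V ≃ₗ[F] V') (hx : ∀ v, e (x v) = x' (e v)) (hW : ∀ v, v ∈ W ↔ e v ∈ W') :
    T a b x W = T a b x' W' := by
  have hm : W.map e.toLinearMap = W' := by
    ext v; constructor
    · rintro ⟨u, hu, rfl⟩; exact (hW u).1 hu
    · intro hv; exact ⟨e.symm v, (hW _).2 (by simpa using hv), by simp⟩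
  by_cases h : ∀ v ∈ W, x v ∈ W
  · have h' : ∀ v ∈ W', x' v ∈ W' := by
      intro v hv
      obtain ⟨u, rfl⟩ := e.surjective v
      rw [← hx, ← hW]; exact h u ((hW u).2 hv)
    rw [show T a b x' W' = _ from dif_pos h']
    let f1 : W ≃ₗ[F] W' := e.submoduleMap W |>.trans (LinearEquiv.ofEq _ _ hm)
    refine T_eq a b h f1 (Submodule.Quotient.equiv W W' e hm) ?_ ?_
    · intro v; apply Subtype.ext; exact hx v
    · intro v; 
      simp [hx]
  · rw [T, T, dif_neg h, dif_neg]
    intro h'; apply h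
    intro v hv
    rw [hW, hx]; exact h' _ ((hW v).1 hv)

end
end TCV

open scoped MatrixGroups
namespace TCV
open Finset
set_option linter.unusedSectionVars false
set_option linter.unusedSimpArgs false
set_option linter.unusedVariables false

section
variable {F : Type} [Field F] [Fintype F] [DecidableEq F]
variable {V V' : Type} [AddCommGroup V] [Module F V] [AddCommGroup V'] [Module F V']

lemma tl_bij {m : ℕ} (g : GL (Fin m) F) : Function.Bijective (tl g) := (tlE g).bijective

/-- parameters of the parabolic -/
abbrev PP (F : Type) [Field F] [Fintype F] [DecidableEq F] (k l : ℕ) : Type :=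
  (GL (Fin k) F × GL (Fin l) F) × ((Fin l → F) →ₗ[F] (Fin k → F))

noncomputable def blp {k l : ℕ} (p : PP F k l) : ((Fin k → F) × (Fin l → F)) →ₗ[F] ((Fin k → F) × (Fin l → F)) :=
  bl (tl p.1.1) p.2 (tl p.1.2)

lemma blp_bij {k l : ℕ} (p : PP F k l) : Function.Bijective (blp p) :=
  bl_bij.2 ⟨tl_bij _, tl_bij _⟩

variable {k l m : ℕ} (E : ((Fin k → F) × (Fin l → F)) ≃ₗ[F] (Fin m → F))

noncomputable def QQ (p : PP F k l) : GL (Fin m) F :=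
  gl (E.symm.trans ((LinearEquiv.ofBijective (blp p) (blp_bij p)).trans E))

lemma tl_QQ (p : PP F k l) (q) : tl (QQ E p) (E q) = E (bl (tl p.1.1) p.2 (tl p.1.2) q) := by
  rw [QQ, tl_gl]; simp [blp]

lemma QQ_inj : Function.Injective (QQ E) := by
  rintro ⟨⟨y, z⟩, u⟩ ⟨⟨y', z'⟩, u'⟩ h
  have h1 : ∀ q, bl (tl y) u (tl z) q = bl (tl y') u' (tl z') q := by
    intro q
    have := tl_QQ E ((y, z), u) q
    rw [h, tl_QQ] at this
    exact (E.injective this).symm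
  have hy : y = y' := tl_inj (LinearMap.ext fun v => by simpa using congrArg Prod.fst (h1 (v, 0)))
  have hz : z = z' := tl_inj (LinearMap.ext fun v => by simpa using congrArg Prod.snd (h1 (0, v)))
  have hu : u = u' := LinearMap.ext fun v => by simpa using congrArg Prod.fst (h1 (0, v))
  subst hy hz hu; rfl

/-- the base subspace -/
def W0 : Submodule F (Fin m → F) := LinearMap.ker (LinearMap.snd F _ _ ∘ₗ E.symm.toLinearMap)

lemma mem_W0 (v) : v ∈ W0 E ↔ (E.symm v).2 = 0 := by simp [W0]

lemma QQ_range (g : GL (Fin m) F) : (∃ p, QQ E p = g) ↔ ∀ v ∈ W0 E, tl g v ∈ W0 E := by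
  constructor
  · rintro ⟨p, rfl⟩ v hv
    obtain ⟨q, rfl⟩ := E.surjective v
    rw [mem_W0] at hv ⊢
    rw [tl_QQ]
    simp at hv
    simp [hv]
  · intro h
    let x : ((Fin k → F) × (Fin l → F)) →ₗ[F] ((Fin k → F) × (Fin l → F)) :=
      E.symm.toLinearMap ∘ₗ tl g ∘ₗ E.toLinearMap
    have hxb : Function.Bijective x := by
      simp only [x, LinearMap.coe_comp, LinearEquiv.coe_coe]
      exact E.symm.bijective.comp ((tl_bij g).comp E.bijective)
    have h0 : ∀ v, (x (v, 0)).2 = 0 := by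
      intro v
      have := h (E (v, 0)) (by rw [mem_W0]; simp)
      rwa [mem_W0] at this
    let y := LinearMap.fst F _ _ ∘ₗ x ∘ₗ LinearMap.inl F (Fin k → F) (Fin l → F)
    let u := LinearMap.fst F _ _ ∘ₗ x ∘ₗ LinearMap.inr F (Fin k → F) (Fin l → F)
    let z := LinearMap.snd F _ _ ∘ₗ x ∘ₗ LinearMap.inr F (Fin k → F) (Fin l → F)
    have hx : x = bl y u z := by
      refine LinearMap.ext fun ⟨a, b⟩ => ?_
      have : x (a, b) = x (a, 0) + x (0, b) := by rw [← map_add]; simp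
      rw [this, bl_apply]
      ext1
      · simp [y, u]
      · simp [z, h0]
    rw [hx] at hxb
    obtain ⟨hy, hz⟩ := bl_bij.1 hxb
    refine ⟨((gl (LinearEquiv.ofBijective y hy), gl (LinearEquiv.ofBijective z hz)), u), ?_⟩
    apply tl_inj
    refine LinearMap.ext fun v => ?_
    obtain ⟨q, rfl⟩ := E.surjective v
    rw [tl_QQ]
    dsimp only
    rw [tl_gl, tl_gl]
    change E (bl y u z q) = _
    rw [← hx]; simp [x]

lemma stab_sum (f : GL (Fin m) F → ℂ) (hf : ∀ g, (¬ ∀ v ∈ W0 E, tl g v ∈ W0 E) → f g = 0) :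
    ∑ g, f g = ∑ p, f (QQ E p) := by
  symm
  refine Fintype.sum_of_injective (QQ E) (QQ_inj E) _ _ ?_ (fun _ => rfl)
  intro g hg
  apply hf
  rw [← QQ_range]
  exact hg

lemma map_W0 (g : GL (Fin m) F) (W : Submodule F (Fin m → F)) :
    (W0 E).map (tl g) = W ↔ ∀ v, v ∈ W0 E ↔ tl g v ∈ W := by
  constructor
  · rintro rfl v
    exact ⟨fun h => ⟨v, h, rfl⟩, fun ⟨v', h, e⟩ => (tl_bij g).1 e ▸ h⟩
  · intro h
    ext v
    constructor
    · rintro ⟨u, hu, rfl⟩; exact (h u).1 hu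
    · intro hv
      obtain ⟨u, rfl⟩ := (tl_bij g).2 v
      exact ⟨u, (h u).2 hv, rfl⟩

lemma stab_iff (g : GL (Fin m) F) :
    (W0 E).map (tl g) = W0 E ↔ ∀ v ∈ W0 E, tl g v ∈ W0 E := by
  rw [map_W0]
  constructor
  · intro h v hv; exact (h v).1 hv
  · intro h
    obtain ⟨p, rfl⟩ := (QQ_range E g).2 h
    intro v
    obtain ⟨q, rfl⟩ := E.surjective v
    rw [tl_QQ, mem_W0, mem_W0]
    simp only [LinearEquiv.symm_apply_apply, bl_apply]
    rw [map_eq_zero_iff _ (tl_bij _).1]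

lemma finrank_W0 : Module.finrank F (W0 E) = k := by
  let e : (Fin k → F) ≃ₗ[F] W0 E :=
    { toFun := fun v => ⟨E (v, 0), by rw [mem_W0]; simp⟩
      map_add' := by intro u v; apply Subtype.ext; simp [← map_add]
      map_smul' := by intro u v; apply Subtype.ext; simp [← map_smul]
      invFun := fun v => (E.symm v).1
      right_inv := by
        intro v
        have := (mem_W0 E v).1 v.2
        apply Subtype.ext
        change E ((E.symm v).1, 0) = v
        rw [← this]; simp
      left_inv := by intro v; simp }
  rw [← e.finrank_eq]; simp

/-- transitivity on subspaces -/
lemma exists_map {W W' : Submodule F V} [Finite V] (h : Module.finrank F W = Module.finrank F W') :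
    ∃ e : V ≃ₗ[F] V, W.map e.toLinearMap = W' := by
  have : Module.Finite F V := Module.Finite.of_finite
  obtain ⟨C, hC⟩ := W.exists_isCompl
  obtain ⟨C', hC'⟩ := W'.exists_isCompl
  have h2 : Module.finrank F C = Module.finrank F C' := by
    have := Submodule.finrank_add_eq_of_isCompl hC
    have := Submodule.finrank_add_eq_of_isCompl hC'
    omega
  let f := LinearEquiv.ofFinrankEq W W' h
  let f' := LinearEquiv.ofFinrankEq C C' h2
  let e := (Submodule.prodEquivOfIsCompl W C hC).symm.trans ((f.prodCongr f').trans
    (Submodule.prodEquivOfIsCompl W' C' hC'))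
  have he : ∀ w : W, e w = f w := by
    intro w; simp [e]
  refine ⟨e, ?_⟩
  ext v; constructor
  · rintro ⟨u, hu, rfl⟩
    have := he ⟨u, hu⟩
    change e u = _ at this
    change e u ∈ W'
    rw [this]; exact (f _).2
  · intro hv
    refine ⟨f.symm ⟨v, hv⟩, (f.symm _).2, ?_⟩
    change e _ = v
    rw [he]; simp

lemma sum_grass (Φ : Submodule F (Fin m → F) → ℂ) (hΦ : ∀ W : Submodule F (Fin m → F), Module.finrank F W ≠ k → Φ W = 0) :
    (Fintype.card (PP F k l) : ℂ) * ∑ W, Φ W = ∑ g : GL (Fin m) F, Φ ((W0 E).map (tl g)) := by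
  classical
  have h0 : (#{g : GL (Fin m) F | (W0 E).map (tl g) = W0 E} : ℂ) = Fintype.card (PP F k l) := by
    have := stab_sum E (fun g => if (W0 E).map (tl g) = W0 E then 1 else 0)
      (by intro g hg; rw [← stab_iff] at hg; simp [hg])
    rw [sum_boole] at this
    rw [this, sum_congr rfl fun p _ => if_pos ((stab_iff E _).2 ((QQ_range E _).1 ⟨p, rfl⟩))]
    simp
  have h1 : ∀ W : Submodule F (Fin m → F), Module.finrank F W = k →
      #{g : GL (Fin m) F | (W0 E).map (tl g) = W} = #{g : GL (Fin m) F | (W0 E).map (tl g) = W0 E} := by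
    intro W hW
    obtain ⟨e, he⟩ := exists_map (W := W0 E) (W' := W) ((finrank_W0 E).trans hW.symm)
    rw [← tl_gl] at he
    set g0 := gl e
    have hinv : W.map (tl g0⁻¹) = W0 E := by
      rw [← he, ← Submodule.map_comp, ← tl_mul, inv_mul_cancel, tl_one, Submodule.map_id]
    refine card_bij' (fun g _ => g0⁻¹ * g) (fun g _ => g0 * g) ?_ ?_ ?_ ?_
    · intro g hg
      rw [mem_filter] at hg ⊢
      refine ⟨mem_univ _, ?_⟩
      rw [tl_mul, Submodule.map_comp, hg.2, hinv]
    · intro g hg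
      rw [mem_filter] at hg ⊢
      refine ⟨mem_univ _, ?_⟩
      rw [tl_mul, Submodule.map_comp, hg.2, he]
    · intro g _; simp
    · intro g _; simp
  rw [← sum_fiberwise univ (fun g => (W0 E).map (tl g)), mul_sum]
  refine sum_congr rfl fun W _ => ?_
  have : ∑ g : GL (Fin m) F with (W0 E).map (tl g) = W, Φ ((W0 E).map (tl g)) =
      #{g : GL (Fin m) F | (W0 E).map (tl g) = W} * Φ W := by
    rw [← nsmul_eq_mul, ← sum_const]
    refine sum_congr rfl fun g hg => ?_
    rw [(mem_filter.1 hg).2]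
  rw [this]
  by_cases hW : Module.finrank F W = k
  · rw [h1 W hW, h0]
  · rw [hΦ W hW, mul_zero, mul_zero]

lemma cc_eq (a : Ir F k) (b : Ir F l) (w : Ir F m) : cc a b w =
    (∑ p : PP F k l, (wd F m).χ w (QQ E p) * ((wd F k).χ a p.1.1⁻¹ * (wd F l).χ b p.1.2⁻¹)) /
      Fintype.card (PP F k l) := by
  have conj : ∀ {k : ℕ} (g h : GL (Fin k) F) v, tlE h (tl (g * h) v) = tl (h * g) (tlE h v) := by
    intro k g h v; rw [tlE_apply, tlE_apply, tl_mul, tl_mul]; rfl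
  rw [cc, (wd F l).class_coeff (fun h => ∑ g : GL (Fin k) F, (wd F k).ε a g *
    Dl w (Fin k → F) (tl g) (Fin l → F) (tl h)) (fun h h' => sum_congr rfl fun x _ =>
      congrArg _ (Dl_iso w (y := tl x) (y' := tl x) (LinearEquiv.refl F _) (tlE h') (fun _ => rfl) (conj h h')))]
  simp_rw [(wd F k).class_coeff (fun g => Dl w (Fin k → F) (tl g) (Fin l → F) (tl _))
    (fun g g' => Dl_iso w (tlE g') (LinearEquiv.refl F _) (conj g g') (fun _ => rfl))]
  have hX : ∀ p : PP F k l, X w _ (bl (tl p.1.1) p.2 (tl p.1.2)) = (wd F m).χ w (QQ E p) := by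
    intro p
    rw [← X_std]
    exact X_iso w E fun q => (tl_QQ E p q).symm
  simp_rw [← hX, Dl]
  rw [Fintype.sum_prod_type, Fintype.sum_prod_type_right, Fintype.card_prod, Fintype.card_prod]
  simp only [div_eq_mul_inv, sum_mul, Nat.cast_mul, mul_inv]
  refine sum_congr rfl fun h _ => sum_congr rfl fun g _ => sum_congr rfl fun u _ => ?_
  ring

lemma T_dim [Finite V] (a : Ir F k) (b : Ir F l) (x : V →ₗ[F] V) (W : Submodule F V)
    (h : Module.finrank F W ≠ k) : T a b x W = 0 := by
  rw [T]; split_ifs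
  · rw [X_dim a _ h, zero_mul]
  · rfl

lemma T_dim' [Finite V] (a : Ir F k) (b : Ir F l) (x : V →ₗ[F] V) (W : Submodule F V)
    (h : Module.finrank F V ≠ k + l) : T a b x W = 0 := by
  have : Module.Finite F V := Module.Finite.of_finite
  by_cases h1 : Module.finrank F W = k
  · rw [T]; split_ifs
    · rw [X_dim b _, mul_zero]
      have := Submodule.finrank_quotient_add_finrank W
      omega
    · rfl
  · exact T_dim a b x W h1

lemma adj_std (a : Ir F k) (b : Ir F l) (g : GL (Fin m) F) :
    ∑ W, T a b (tl g) W = ∑ w : Ir F m, cc a b w * (wd F m).χ w g := by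
  by_cases hm : m = k + l
  swap
  · rw [sum_eq_zero, sum_eq_zero]
    · intro w _; by_cases h : cc a b w = 0
      · rw [h, zero_mul]
      · exact absurd (cc_deg a b w h) hm
    · intro W _; apply T_dim'; simpa using hm
  obtain ⟨E⟩ : Nonempty (((Fin k → F) × (Fin l → F)) ≃ₗ[F] (Fin m → F)) :=
    ⟨LinearEquiv.ofFinrankEq _ _ (by simp [hm])⟩
  have hcl : ∀ g h : GL (Fin m) F, ∑ W, T a b (tl (g * h)) W = ∑ W, T a b (tl (h * g)) W := by
    intro g h
    refine Fintype.sum_equiv (Submodule.orderIsoMapComap (tlE h)).toEquiv _ _ fun W => ?_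
    refine T_conj a b (tlE h) ?_ ?_
    · intro v; rw [tlE_apply, tlE_apply, tl_mul, tl_mul]; rfl
    · intro v
      change _ ↔ _ ∈ W.map (tlE h).toLinearMap
      constructor
      · intro hv; exact ⟨v, hv, rfl⟩
      · rintro ⟨v', hv', e⟩
        have := (tlE h).injective e
        exact this ▸ hv'
  rw [(wd F m).class_expand (fun g => ∑ W, T a b (tl g) W) hcl g]
  refine sum_congr rfl fun w _ => ?_
  congr 1
  rw [(wd F m).class_coeff _ hcl, cc_eq E]
  have hP : (Fintype.card (PP F k l) : ℂ) ≠ 0 := by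
    rw [Nat.cast_ne_zero]; exact Fintype.card_ne_zero
  have hG : (Fintype.card (GL (Fin m) F) : ℂ) ≠ 0 := by
    rw [Nat.cast_ne_zero]; exact Fintype.card_ne_zero
  rw [div_eq_div_iff hG hP]
  have h1 : ∀ x h : GL (Fin m) F, T a b (tl x) ((W0 E).map (tl h)) = T a b (tl (h⁻¹ * x * h)) (W0 E) := by
    intro x h
    symm
    refine T_conj a b (tlE h) ?_ ?_
    · intro v; rw [tlE_apply, tlE_apply, ← LinearMap.comp_apply, ← LinearMap.comp_apply, ← tl_mul, ← tl_mul]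
      congr 2; group
    · exact (map_W0 E h _).1 rfl
  have h2 : ∀ p : PP F k l, T a b (tl (QQ E p)⁻¹) (W0 E) =
      (wd F k).χ a p.1.1⁻¹ * (wd F l).χ b p.1.2⁻¹ := by
    intro p
    rw [← X_std, ← X_std]
    refine T_bl a b E (mem_W0 E) (u := -(tl p.1.1⁻¹ ∘ₗ p.2 ∘ₗ tl p.1.2⁻¹)) ?_
    intro q
    apply (tl_bij (QQ E p)).1
    rw [tl_mul_inv, tl_QQ]
    congr 1
    simp [tl_mul_inv]
  calc _ = ∑ x : GL (Fin m) F, (wd F m).χ w x⁻¹ * (Fintype.card (PP F k l) * ∑ W, T a b (tl x) W) := by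
        rw [sum_mul]; exact sum_congr rfl fun x _ => by ring
    _ = ∑ x : GL (Fin m) F, ∑ h : GL (Fin m) F, (wd F m).χ w x⁻¹ * T a b (tl (h⁻¹ * x * h)) (W0 E) := by
        refine sum_congr rfl fun x _ => ?_
        rw [sum_grass E _ (fun W hW => T_dim a b _ W hW), mul_sum]
        simp_rw [h1]
    _ = ∑ h : GL (Fin m) F, ∑ x : GL (Fin m) F, (wd F m).χ w x * T a b (tl x⁻¹) (W0 E) := by
        rw [sum_comm]
        refine sum_congr rfl fun h _ => ?_
        refine Fintype.sum_equiv ((MulAut.conj h⁻¹).toEquiv.trans (Equiv.inv _)) _ _ fun x => ?_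
        simp only [Equiv.trans_apply, MulEquiv.toEquiv_eq_coe, MulEquiv.coe_toEquiv, MulAut.conj_apply, inv_inv,
          Equiv.inv_apply]
        congr 1
        rw [mul_inv_rev, mul_inv_rev, inv_inv, (wd F m).χ_class, mul_assoc, mul_inv_cancel, mul_one]
    _ = _ := by
        rw [sum_const, card_univ, nsmul_eq_mul, mul_comm]
        congr 1
        rw [stab_sum E]
        · exact sum_congr rfl fun p _ => by rw [h2]
        · intro x hx
          rw [T, dif_neg, mul_zero]
          intro hc
          apply hx
          have h3 := (stab_iff E _).2 hc
          rw [← stab_iff]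
          conv_lhs => rw [← h3]
          rw [← Submodule.map_comp, ← tl_mul, mul_inv_cancel, tl_one, Submodule.map_id]

lemma adj [Finite V] (a : Ir F k) (b : Ir F l) (x : V →ₗ[F] V) (hm : Module.finrank F V = m) :
    ∑ W, T a b x W = ∑ w : Ir F m, cc a b w * X w V x := by
  by_cases hx : Function.Bijective x
  · obtain ⟨e⟩ := exists_frame hm
    obtain ⟨g, hg⟩ := exists_gl e x hx
    simp_rw [← fun w => X_iso w e hg, X_std]
    rw [← adj_std]
    symm
    refine Fintype.sum_equiv (Submodule.orderIsoMapComap e).toEquiv _ _ fun W => ?_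
    refine T_conj a b e hg ?_
    intro v
    change _ ↔ _ ∈ W.map e.toLinearMap
    constructor
    · intro hv; exact ⟨v, hv, rfl⟩
    · rintro ⟨v', hv', e'⟩
      have := e.injective e'
      exact this ▸ hv'
  · rw [sum_eq_zero, sum_eq_zero]
    · intro w _
      by_contra h
      exact hx (X_unit w x (right_ne_zero_of_mul h))
    · intro W _
      by_contra h
      apply hx
      rw [T] at h
      split_ifs at h with hW
      · have h1 := X_unit _ _ (left_ne_zero_of_mul h)
        have h2 := X_unit _ _ (right_ne_zero_of_mul h)
        rw [← Finite.injective_iff_bijective, injective_iff_map_eq_zero]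
        intro v hv
        have h3 : W.mkQ v = 0 := by
          apply (injective_iff_map_eq_zero _).1 h2.1
          simp [hv]
        have h4 : v ∈ W := by simpa using h3
        have h5 := (injective_iff_map_eq_zero _).1 h1.1 ⟨v, h4⟩ (Subtype.ext (by simpa using hv))
        simpa using h5
      · exact (h rfl).elim

end
end TCV

open scoped MatrixGroups
namespace TCV
open Finset
set_option linter.unusedSectionVars false
set_option linter.unusedSimpArgs false
set_option linter.unusedVariables false

section
variable {F : Type} [Field F] [Fintype F] [DecidableEq F]
variable {Y Z : Type} [AddCommGroup Y] [Module F Y] [AddCommGroup Z] [Module F Z] [Finite Y] [Finite Z]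

/-- sheared product subspace -/
def NS (V1 : Submodule F Y) (V2 : Submodule F Z) (φ : Z →ₗ[F] Y) : Submodule F (Y × Z) :=
  (V1.prod V2).comap (bl LinearMap.id (-φ) LinearMap.id)

lemma mem_NS (V1 : Submodule F Y) (V2 : Submodule F Z) (φ : Z →ₗ[F] Y) (p : Y × Z) :
    p ∈ NS V1 V2 φ ↔ p.1 - φ p.2 ∈ V1 ∧ p.2 ∈ V2 := by
  simp [NS, sub_eq_add_neg]

/-- homs mapping `V2` to `V1` -/
def KK (V1 : Submodule F Y) (V2 : Submodule F Z) : Submodule F (Z →ₗ[F] Y) where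
  carrier := {φ | ∀ v ∈ V2, φ v ∈ V1}
  add_mem' := fun h h' v hv => V1.add_mem (h v hv) (h' v hv)
  zero_mem' := fun v hv => V1.zero_mem
  smul_mem' := fun c f h v hv => V1.smul_mem c (h v hv)

lemma mem_KK (V1 : Submodule F Y) (V2 : Submodule F Z) (φ : Z →ₗ[F] Y) :
    φ ∈ KK V1 V2 ↔ ∀ v ∈ V2, φ v ∈ V1 := Iff.rfl

lemma NS_fst (V1 : Submodule F Y) (V2 : Submodule F Z) (φ : Z →ₗ[F] Y) :
    (NS V1 V2 φ).comap (LinearMap.inl F Y Z) = V1 := by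
  ext v; simp [mem_NS]

lemma NS_snd (V1 : Submodule F Y) (V2 : Submodule F Z) (φ : Z →ₗ[F] Y) :
    (NS V1 V2 φ).map (LinearMap.snd F Y Z) = V2 := by
  ext v; constructor
  · rintro ⟨p, hp, rfl⟩; exact ((mem_NS _ _ _ _).1 hp).2
  · intro hv; exact ⟨(φ v, v), (mem_NS _ _ _ _).2 (by simpa using hv), rfl⟩

lemma NS_exists (W : Submodule F (Y × Z)) :
    ∃ φ, NS (W.comap (LinearMap.inl F Y Z)) (W.map (LinearMap.snd F Y Z)) φ = W := by
  let V2 := W.map (LinearMap.snd F Y Z)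
  let r : W →ₗ[F] V2 := (LinearMap.snd F Y Z).restrict (fun v hv => ⟨v, hv, rfl⟩)
  have hr : LinearMap.range r = ⊤ := by
    rw [LinearMap.range_eq_top]
    rintro ⟨_, ⟨p, hp, rfl⟩⟩
    exact ⟨⟨p, hp⟩, rfl⟩
  obtain ⟨s, hs⟩ := r.exists_rightInverse_of_surjective hr
  obtain ⟨φ, hφ⟩ := LinearMap.exists_extend (LinearMap.fst F Y Z ∘ₗ W.subtype ∘ₗ s)
  have h1 : ∀ v : V2, ((φ v, (v : Z)) : Y × Z) = (s v : Y × Z) := by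
    intro v
    have e1 := congrArg (fun f => f v) hφ
    have e2 := congrArg (fun f => ((f v : V2) : Z)) hs
    ext1
    · exact e1
    · exact e2.symm
  refine ⟨φ, ?_⟩
  ext p
  rw [mem_NS]
  constructor
  · rintro ⟨ha, hb⟩
    have h2 := h1 ⟨p.2, hb⟩
    have h3 : (φ p.2, p.2) ∈ W := by
      rw [show ((φ p.2, p.2) : Y × Z) = _ from h2]; exact (s _).2
    have h4 : ((p.1 - φ p.2, 0) : Y × Z) ∈ W := ha
    have := W.add_mem h4 h3
    simpa using this
  · intro hp
    have hb : p.2 ∈ V2 := ⟨p, hp, rfl⟩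
    refine ⟨?_, hb⟩
    have h2 := h1 ⟨p.2, hb⟩
    have h3 : (φ p.2, p.2) ∈ W := by
      rw [show ((φ p.2, p.2) : Y × Z) = _ from h2]; exact (s _).2
    have := W.sub_mem hp h3
    change ((p.1 - φ p.2, 0) : Y × Z) ∈ W
    convert this using 1
    ext1 <;> simp

lemma NS_eq_iff (V1 : Submodule F Y) (V2 : Submodule F Z) (φ φ' : Z →ₗ[F] Y) :
    NS V1 V2 φ = NS V1 V2 φ' ↔ φ - φ' ∈ KK V1 V2 := by
  rw [mem_KK]
  constructor
  · intro h v hv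
    have : (φ v, v) ∈ NS V1 V2 φ := (mem_NS _ _ _ _).2 (by simpa using hv)
    rw [h, mem_NS] at this
    exact this.1
  · intro h
    ext p
    rw [mem_NS, mem_NS]
    refine and_congr_left fun hp => ?_
    have := h _ hp
    have e : p.1 - φ p.2 = (p.1 - φ' p.2) - (φ - φ') p.2 := by simp
    rw [e]
    exact Submodule.sub_mem_iff_left _ this

noncomputable instance fK (V1 : Submodule F Y) (V2 : Submodule F Z) : Fintype (KK V1 V2) :=
  Fintype.ofFinite _

lemma sum_sub (Φ : Submodule F (Y × Z) → ℂ) :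
    ∑ W, Φ W = ∑ V1, ∑ V2, (∑ φ, Φ (NS V1 V2 φ)) / Fintype.card (KK (F := F) (Y := Y) (Z := Z) V1 V2) := by
  classical
  have h1 : ∀ (V1 : Submodule F Y) (V2 : Submodule F Z), ∑ φ, Φ (NS V1 V2 φ) =
      ∑ W, #{φ | NS V1 V2 φ = W} * Φ W := by
    intro V1 V2
    rw [← sum_fiberwise univ (NS V1 V2)]
    refine sum_congr rfl fun W _ => ?_
    rw [← nsmul_eq_mul, ← sum_const]
    refine sum_congr rfl fun g hg => ?_
    rw [(mem_filter.1 hg).2]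
  simp_rw [h1, sum_div]
  symm
  rw [sum_congr rfl fun V1 _ => sum_comm]
  rw [sum_comm]
  refine sum_congr rfl fun W _ => ?_
  rw [sum_eq_single (W.comap (LinearMap.inl F Y Z)), sum_eq_single (W.map (LinearMap.snd F Y Z))]
  · have hK : (Fintype.card (KK (W.comap (LinearMap.inl F Y Z)) (W.map (LinearMap.snd F Y Z))) : ℂ) ≠ 0 := by
      rw [Nat.cast_ne_zero]; exact Fintype.card_ne_zero
    obtain ⟨φ0, h0⟩ := NS_exists W
    have : #{φ | NS (W.comap (LinearMap.inl F Y Z)) (W.map (LinearMap.snd F Y Z)) φ = W} =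
        Fintype.card (KK (W.comap (LinearMap.inl F Y Z)) (W.map (LinearMap.snd F Y Z))) := by
      rw [← card_univ]
      refine card_bij' (fun φ h => ⟨φ - φ0, ?_⟩) (fun φ _ => φ + φ0) ?_ ?_ ?_ ?_
      · have := (mem_filter.1 h).2
        rw [← h0, NS_fst, NS_snd] at this
        exact (NS_eq_iff _ _ _ _).1 this
      · intro φ h; simp
      · intro φ h
        rw [mem_filter]
        refine ⟨mem_univ _, ?_⟩
        refine Eq.trans ((NS_eq_iff _ _ _ _).2 ?_) h0
        simp
      · intro φ h; simp
      · intro φ h; simp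
    rw [this]
    field_simp
  · intro V2 _ h
    rw [filter_false_of_mem, card_empty]; · simp
    intro φ _ e
    rw [← e, NS_snd] at h
    exact h rfl
  · simp
  · intro V1 _ h
    refine sum_eq_zero fun V2 _ => ?_
    rw [filter_false_of_mem, card_empty]; · simp
    intro φ _ e
    rw [← e, NS_fst] at h
    exact h rfl
  · simp

/-- shear equivalence -/
def nnE (φ : Z →ₗ[F] Y) : (Y × Z) ≃ₗ[F] (Y × Z) where
  toFun := fun p => (p.1 + φ p.2, p.2)
  map_add' := by intro p q; ext1 <;> simp; abel
  map_smul' := by intro c q; ext1 <;> simp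
  invFun := fun p => (p.1 - φ p.2, p.2)
  left_inv := by intro p; simp
  right_inv := by intro p; simp

variable {k l : ℕ} (a : Ir F k) (b : Ir F l)

lemma T_shift (y : Y →ₗ[F] Y) (z : Z →ₗ[F] Z) (V1 : Submodule F Y) (V2 : Submodule F Z) (φ : Z →ₗ[F] Y) :
    ∑ u, T a b (bl y u z) (NS V1 V2 φ) = ∑ u, T a b (bl y u z) (V1.prod V2) := by
  refine Fintype.sum_equiv (Equiv.addRight (y ∘ₗ φ - φ ∘ₗ z)) _ _ fun u => ?_
  symm
  refine T_conj a b (nnE φ) ?_ ?_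
  · intro p
    ext1 <;> simp [nnE]
    abel
  · intro p
    simp [nnE, mem_NS]

instance fQ (V1 : Submodule F Y) : Finite (Y ⧸ V1) := Finite.of_surjective _ V1.mkQ_surjective

/-- product of comultiplications on a stable pair -/
noncomputable def S (y : Y →ₗ[F] Y) (z : Z →ₗ[F] Z) (V1 : Submodule F Y) (V2 : Submodule F Z) : ℂ :=
  open Classical in if h : (∀ v ∈ V1, y v ∈ V1) ∧ (∀ v ∈ V2, z v ∈ V2) then
    Dl a V1 (y.restrict h.1) V2 (z.restrict h.2) *
      Dl b (Y ⧸ V1) (V1.mapQ V1 y h.1) (Z ⧸ V2) (V2.mapQ V2 z h.2) else 0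

noncomputable def ρ (V1 : Submodule F Y) (V2 : Submodule F Z) :
    KK V1 V2 →+ (V2 →ₗ[F] V1) × ((Z ⧸ V2) →ₗ[F] (Y ⧸ V1)) where
  toFun := fun φ => (φ.1.restrict φ.2, V2.mapQ V1 φ.1 φ.2)
  map_zero' := by
    ext1
    · rfl
    · refine LinearMap.ext fun v => ?_
      obtain ⟨v, rfl⟩ := V2.mkQ_surjective v
      simp
  map_add' := by
    intro p q
    ext1
    · rfl
    · refine LinearMap.ext fun v => ?_
      obtain ⟨v, rfl⟩ := V2.mkQ_surjective v
      rfl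

lemma ρ_surj (V1 : Submodule F Y) (V2 : Submodule F Z) : Function.Surjective (ρ V1 V2) := by
  rintro ⟨α, β⟩
  obtain ⟨s, hs⟩ := V1.mkQ.exists_rightInverse_of_surjective V1.range_mkQ
  obtain ⟨α', hα⟩ := LinearMap.exists_extend α
  have hs' : ∀ v, V1.mkQ (s v) = v := fun v => congrArg (fun f => f v) hs
  have hα' : ∀ v : V2, α' v = α v := fun v => congrArg (fun f => f v) hα
  let φ : Z →ₗ[F] Y := V1.subtype ∘ₗ α' + s ∘ₗ β ∘ₗ V2.mkQ
  have hφ : ∀ v : V2, φ v = α v := by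
    intro v
    have : V2.mkQ (v : Z) = 0 := by simp
    simp only [φ, LinearMap.add_apply, LinearMap.comp_apply, this]
    simp [hα']
  refine ⟨⟨φ, fun v hv => ?_⟩, ?_⟩
  · rw [hφ ⟨v, hv⟩]; exact (α _).2
  · refine Prod.ext ?_ ?_
    · refine LinearMap.ext fun v => Subtype.ext ?_
      exact hφ v
    · refine LinearMap.ext fun v => ?_
      obtain ⟨v, rfl⟩ := V2.mkQ_surjective v
      change V1.mkQ (φ v) = _
      simp only [φ, LinearMap.add_apply, LinearMap.comp_apply, map_add, hs']
      simp

lemma T_S (y : Y →ₗ[F] Y) (z : Z →ₗ[F] Z) (V1 : Submodule F Y) (V2 : Submodule F Z) :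
    (∑ u, T a b (bl y u z) (V1.prod V2)) / Fintype.card (KK V1 V2) = S a b y z V1 V2 := by
  have hst : ∀ u, (∀ p ∈ V1.prod V2, bl y u z p ∈ V1.prod V2) ↔
      ((∀ v ∈ V1, y v ∈ V1) ∧ (∀ v ∈ V2, z v ∈ V2)) ∧ u ∈ KK V1 V2 := by
    intro u
    rw [mem_KK]
    constructor
    · intro h
      refine ⟨⟨fun v hv => ?_, fun v hv => ?_⟩, fun v hv => ?_⟩
      · simpa using (h (v, 0) (by simpa using hv))
      · exact (h (0, v) (by simpa using hv)).2
      · simpa using (h (0, v) (by simpa using hv)).1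
    · rintro ⟨⟨h1, h2⟩, h3⟩ p ⟨hp1, hp2⟩
      exact ⟨V1.add_mem (h1 _ hp1) (h3 _ hp2), h2 _ hp2⟩
  by_cases h : (∀ v ∈ V1, y v ∈ V1) ∧ (∀ v ∈ V2, z v ∈ V2)
  swap
  · rw [S, dif_neg h, sum_eq_zero, zero_div]
    intro u _
    rw [T, dif_neg]
    rw [hst]; exact fun h' => h h'.1
  rw [S, dif_pos h, Dl, Dl, div_mul_div_comm, sum_mul_sum, ← Nat.cast_mul, ← Fintype.card_prod,
    ← Fintype.sum_prod_type' (f := fun α β => X a _ (bl (y.restrict h.1) α (z.restrict h.2)) *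
      X b _ (bl (V1.mapQ V1 y h.1) β (V2.mapQ V2 z h.2)))]
  rw [← avg_surj (ρ V1 V2) (ρ_surj V1 V2)]
  congr 1
  symm
  refine Fintype.sum_of_injective (fun φ : KK V1 V2 => φ.1) Subtype.val_injective _ _ ?_ ?_
  · intro u hu
    rw [T, dif_neg]
    rw [hst]
    rintro ⟨_, h'⟩
    exact hu ⟨⟨u, h'⟩, rfl⟩
  · intro u
    symm
    have hk : V1.prod V2 = LinearMap.ker (V1.mkQ.prodMap V2.mkQ) := by
      rw [LinearMap.ker_prodMap]; simp
    have hr : Function.Surjective (V1.mkQ.prodMap V2.mkQ) := by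
      rw [LinearMap.coe_prodMap]
      exact Function.Surjective.prodMap V1.mkQ_surjective V2.mkQ_surjective
    refine T_eq a b ((hst u).2 ⟨h, u.2⟩)
      { toFun := fun p => (⟨p.1.1, p.2.1⟩, ⟨p.1.2, p.2.2⟩)
        map_add' := by intro p q; rfl
        map_smul' := by intro p q; rfl
        invFun := fun p => ⟨(p.1, p.2), ⟨p.1.2, p.2.2⟩⟩
        left_inv := by intro p; rfl
        right_inv := by intro p; rfl } 
      ((Submodule.quotEquivOfEq _ _ hk).trans (LinearMap.quotKerEquivOfSurjective _ hr)) ?_ ?_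
    · intro p; rfl
    · intro p; simp [ρ]; rfl

/-- Mackey formula -/
lemma mackey (y : Y →ₗ[F] Y) (z : Z →ₗ[F] Z) :
    (∑ u : Z →ₗ[F] Y, ∑ W, T a b (bl y u z) W) / Fintype.card (Z →ₗ[F] Y) = ∑ V1, ∑ V2, S a b y z V1 V2 := by
  have hH : (Fintype.card (Z →ₗ[F] Y) : ℂ) ≠ 0 := by
    rw [Nat.cast_ne_zero]; exact Fintype.card_ne_zero
  rw [div_eq_iff hH, sum_mul]
  simp_rw [sum_sub]
  rw [sum_comm]
  refine sum_congr rfl fun V1 _ => ?_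
  rw [sum_comm, sum_mul]
  refine sum_congr rfl fun V2 _ => ?_
  rw [← sum_div, sum_comm]
  simp_rw [T_shift]
  rw [← T_S, sum_const, card_univ, nsmul_eq_mul]
  ring

end
end TCV

open scoped MatrixGroups
namespace TCV
open Finset
set_option linter.unusedSectionVars false
set_option linter.unusedSimpArgs false
set_option linter.unusedVariables false

section
variable {F : Type} [Field F] [Fintype F] [DecidableEq F]
variable {V Y Z : Type} [AddCommGroup Y] [Module F Y] [AddCommGroup Z] [Module F Z] [Finite Y] [Finite Z]
  [AddCommGroup V] [Module F V] [Finite V]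

abbrev JJ (F : Type) [Field F] [Fintype F] [DecidableEq F] (n : ℕ) : Type := Σ m : Fin (n + 1), Ir F m

variable {n : ℕ}

noncomputable abbrev cJ (a b w : JJ F n) : ℂ := cc a.2 b.2 w.2

lemma cJ_deg {a b w : JJ F n} (h : cJ a b w ≠ 0) : (w.1 : ℕ) = a.1 + b.1 := cc_deg _ _ _ h

lemma sum_JJ {M : Type*} [AddCommMonoid M] {m : ℕ} (hm : m ≤ n) (f : JJ F n → M) (hf : ∀ w : JJ F n, (w.1 : ℕ) ≠ m → f w = 0) :
    ∑ w, f w = ∑ w : Ir F m, f ⟨⟨m, by omega⟩, w⟩ := by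
  rw [Fintype.sum_sigma]
  refine (sum_eq_single (⟨m, by omega⟩ : Fin (n + 1)) ?_ ?_)
  · intro i _ hi
    refine sum_eq_zero fun w _ => hf _ ?_
    intro h; exact hi (Fin.ext h)
  · simp

lemma adjJ {k l : ℕ} (a : Ir F k) (b : Ir F l) (x : V →ₗ[F] V) (h : Module.finrank F V ≤ n) :
    ∑ w : JJ F n, cc a b w.2 * X w.2 V x = ∑ W, T a b x W := by
  rw [adj a b x rfl, sum_JJ h]
  intro w hw
  rw [X_dim _ _ (Ne.symm hw), mul_zero]

lemma Dl_expandJ {m : ℕ} (w : Ir F m) (y : Y →ₗ[F] Y) (z : Z →ₗ[F] Z)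
    (hk : Module.finrank F Y ≤ n) (hl : Module.finrank F Z ≤ n) :
    ∑ a : JJ F n, ∑ b : JJ F n, cc a.2 b.2 w * (X a.2 Y y * X b.2 Z z) = Dl w Y y Z z := by
  rw [Dl_expand w y z rfl rfl, sum_JJ hk]
  · refine sum_congr rfl fun a _ => ?_
    rw [sum_JJ hl]
    intro b hb
    rw [X_dim b.2 z (Ne.symm hb), mul_zero, mul_zero]
  · intro a ha
    refine sum_eq_zero fun b _ => ?_
    rw [X_dim a.2 y (Ne.symm ha), zero_mul, mul_zero]

lemma S_expand {k l : ℕ} (a : Ir F k) (b : Ir F l) (y : Y →ₗ[F] Y) (z : Z →ₗ[F] Z)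
    (hk : Module.finrank F Y ≤ n) (hl : Module.finrank F Z ≤ n) (V1 : Submodule F Y) (V2 : Submodule F Z) :
    S a b y z V1 V2 = ∑ p : JJ F n, ∑ r : JJ F n, ∑ p' : JJ F n, ∑ r' : JJ F n,
      cc p.2 r.2 a * cc p'.2 r'.2 b * (T p.2 p'.2 y V1 * T r.2 r'.2 z V2) := by
  have : Module.Finite F Y := Module.Finite.of_finite
  have : Module.Finite F Z := Module.Finite.of_finite
  by_cases h : (∀ v ∈ V1, y v ∈ V1) ∧ (∀ v ∈ V2, z v ∈ V2)
  · rw [S, dif_pos h]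
    rw [← Dl_expandJ a (n := n) _ _ ((Submodule.finrank_le V1).trans hk) ((Submodule.finrank_le V2).trans hl),
      ← Dl_expandJ b (n := n) _ _ ((Submodule.finrank_quotient_le V1).trans hk)
        ((Submodule.finrank_quotient_le V2).trans hl), sum_mul]
    refine sum_congr rfl fun p _ => ?_
    rw [sum_mul]
    refine sum_congr rfl fun r _ => ?_
    rw [mul_sum]
    refine sum_congr rfl fun p' _ => ?_
    rw [mul_sum]
    refine sum_congr rfl fun r' _ => ?_
    rw [T, T, dif_pos h.1, dif_pos h.2]
    ring
  · rw [S, dif_neg h]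
    symm
    refine sum_eq_zero fun p _ => sum_eq_zero fun r _ => sum_eq_zero fun p' _ => sum_eq_zero fun r' _ => ?_
    rw [not_and_or] at h
    rcases h with h | h
    · rw [T, dif_neg h]; ring
    · rw [T, T, dif_neg h]; ring

lemma hopfC (a b u v : JJ F n) (hab : (a.1 : ℕ) + b.1 ≤ n) :
    ∑ w, cJ a b w * cJ u v w = ∑ p, ∑ r, ∑ p', ∑ r', cJ p r a * cJ p' r' b * (cJ p p' u * cJ r r' v) := by
  by_cases hd : (a.1 : ℕ) + b.1 = u.1 + v.1
  swap
  · rw [sum_eq_zero]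
    · symm
      refine sum_eq_zero fun p _ => sum_eq_zero fun r _ => sum_eq_zero fun p' _ => sum_eq_zero fun r' _ => ?_
      by_contra h
      have h1 := cJ_deg (left_ne_zero_of_mul (left_ne_zero_of_mul h))
      have h2 := cJ_deg (right_ne_zero_of_mul (left_ne_zero_of_mul h))
      have h3 := cJ_deg (left_ne_zero_of_mul (right_ne_zero_of_mul h))
      have h4 := cJ_deg (right_ne_zero_of_mul (right_ne_zero_of_mul h))
      omega
    · intro w _
      by_contra h
      have h1 := cJ_deg (left_ne_zero_of_mul h)
      have h2 := cJ_deg (right_ne_zero_of_mul h)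
      omega
  obtain ⟨k, u⟩ := u
  obtain ⟨l, v⟩ := v
  dsimp only at hd
  have key := two_indep (F := F) (k := k) (l := l)
    (fun u v => ∑ w, cJ a b w * cJ ⟨k, u⟩ ⟨l, v⟩ w)
    (fun u v => ∑ p, ∑ r, ∑ p', ∑ r', cJ p r a * cJ p' r' b * (cJ p p' ⟨k, u⟩ * cJ r r' ⟨l, v⟩)) ?_
  · exact congrFun (congrFun key u) v
  intro g h
  have hY : Module.finrank F (Fin k → F) ≤ n := by have := k.2; simp; omega
  have hZ : Module.finrank F (Fin l → F) ≤ n := by have := l.2; simp; omega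
  calc _ = ∑ w : JJ F n, cJ a b w * Dl w.2 _ (tl g) _ (tl h) := by
        simp_rw [Dl_std, mul_sum, sum_mul]
        rw [sum_congr rfl fun _ _ => sum_comm, sum_comm]
        refine sum_congr rfl fun w _ => sum_congr rfl fun u _ => sum_congr rfl fun v _ => ?_
        ring
    _ = ∑ V1, ∑ V2, S a.2 b.2 (tl g) (tl h) V1 V2 := by
        rw [← mackey]
        simp_rw [← adjJ (n := n) a.2 b.2 (bl (tl g) _ (tl h)) (by simp; omega), Dl]
        rw [sum_comm, sum_div]
        refine sum_congr rfl fun w _ => ?_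
        rw [← mul_sum, mul_div_assoc]
    _ = ∑ p : JJ F n, ∑ r : JJ F n, ∑ p' : JJ F n, ∑ r' : JJ F n, cJ p r a * cJ p' r' b *
          ((∑ V1, T p.2 p'.2 (tl g) V1) * (∑ V2, T r.2 r'.2 (tl h) V2)) := by
        simp_rw [fun V1 V2 => S_expand a.2 b.2 (tl g) (tl h) hY hZ V1 V2]
        simp_rw [sum_mul_sum, mul_sum]
        rw [sum_congr rfl fun _ _ => sum_comm, sum_comm]
        refine sum_congr rfl fun p _ => ?_
        rw [sum_congr rfl fun _ _ => sum_comm, sum_comm]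
        refine sum_congr rfl fun r _ => ?_
        rw [sum_congr rfl fun _ _ => sum_comm, sum_comm]
        refine sum_congr rfl fun p' _ => ?_
        rw [sum_congr rfl fun _ _ => sum_comm, sum_comm]
    _ = _ := by
        simp_rw [adj_std, sum_mul_sum, mul_sum, sum_mul]
        symm
        rw [sum_congr rfl fun _ _ => sum_comm, sum_comm]
        refine sum_congr rfl fun p _ => ?_
        rw [sum_congr rfl fun _ _ => sum_comm, sum_comm]
        refine sum_congr rfl fun r _ => ?_
        rw [sum_congr rfl fun _ _ => sum_comm, sum_comm]
        refine sum_congr rfl fun p' _ => ?_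
        rw [sum_congr rfl fun _ _ => sum_comm, sum_comm]
        refine sum_congr rfl fun r' _ => ?_
        refine sum_congr rfl fun u _ => sum_congr rfl fun v _ => ?_
        ring

/-! ### coassociativity -/

lemma three_indep {i j k : ℕ} (c c' : Ir F i → Ir F j → Ir F k → ℂ)
    (h : ∀ g g' g'', ∑ a, ∑ b, ∑ d, c a b d * ((wd F i).χ a g * (wd F j).χ b g' * (wd F k).χ d g'') =
      ∑ a, ∑ b, ∑ d, c' a b d * ((wd F i).χ a g * (wd F j).χ b g' * (wd F k).χ d g'')) : c = c' := by
  have h1 : ∀ g'', (fun a b => ∑ d, c a b d * (wd F k).χ d g'') = fun a b => ∑ d, c' a b d * (wd F k).χ d g'' := by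
    intro g''
    refine two_indep _ _ fun g g' => ?_
    have := h g g' g''
    simp only [sum_mul]
    refine Eq.trans (sum_congr rfl fun a _ => sum_congr rfl fun b _ => sum_congr rfl fun d _ => ?_)
      (this.trans (sum_congr rfl fun a _ => sum_congr rfl fun b _ => sum_congr rfl fun d _ => ?_)) <;> ring
  funext a b
  exact (wd F k).lin_indep _ _ fun h' => congrFun (congrFun (h1 h') a) b

variable {Y1 Y2 Y3 : Type} [AddCommGroup Y1] [Module F Y1] [Finite Y1] [AddCommGroup Y2] [Module F Y2] [Finite Y2]
  [AddCommGroup Y3] [Module F Y3] [Finite Y3]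

def assocE : ((Y2 →ₗ[F] Y1) × (Y3 →ₗ[F] Y1 × Y2)) ≃ ((Y3 →ₗ[F] Y2) × (Y2 × Y3 →ₗ[F] Y1)) where
  toFun p := (LinearMap.snd F _ _ ∘ₗ p.2, LinearMap.coprod p.1 (LinearMap.fst F _ _ ∘ₗ p.2))
  invFun p := (p.2 ∘ₗ LinearMap.inl F _ _, LinearMap.prod (p.2 ∘ₗ LinearMap.inr F _ _) p.1)
  left_inv p := by
    refine Prod.ext (LinearMap.ext fun v => ?_) (LinearMap.ext fun v => ?_) <;> simp
  right_inv p := by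
    refine Prod.ext (LinearMap.ext fun v => ?_) (LinearMap.ext fun v => ?_)
    · simp
    · simp [← map_add]

lemma coassoc {m : ℕ} (w : Ir F m) (y1 : Y1 →ₗ[F] Y1) (y2 : Y2 →ₗ[F] Y2) (y3 : Y3 →ₗ[F] Y3) :
    (∑ u, Dl w (Y1 × Y2) (bl y1 u y2) Y3 y3) / Fintype.card (Y2 →ₗ[F] Y1) =
    (∑ u, Dl w Y1 y1 (Y2 × Y3) (bl y2 u y3)) / Fintype.card (Y3 →ₗ[F] Y2) := by
  simp_rw [Dl]
  rw [← sum_div, ← sum_div, div_div, div_div, ← Nat.cast_mul, ← Nat.cast_mul, ← Fintype.card_prod,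
    ← Fintype.card_prod,
    ← Fintype.sum_prod_type' (f := fun u t => X w _ (bl (bl y1 u y2) t y3)),
    ← Fintype.sum_prod_type' (f := fun u t => X w _ (bl y1 t (bl y2 u y3)))]
  congr 1
  · refine Fintype.sum_equiv assocE _ _ fun p => ?_
    refine X_iso w (LinearEquiv.prodAssoc F Y1 Y2 Y3) fun v => ?_
    simp [assocE, add_assoc]
  · have e : ((Y2 →ₗ[F] Y1) × (Y3 →ₗ[F] Y1 × Y2)) ≃ ((Y3 →ₗ[F] Y2) × (Y2 × Y3 →ₗ[F] Y1)) := assocE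
    rw [Fintype.card_congr ((Equiv.prodComm _ _).trans (e.trans (Equiv.prodComm _ _)))]

lemma assocC (a b d w : JJ F n) : ∑ x, cJ a b x * cJ x d w = ∑ x, cJ b d x * cJ a x w := by
  by_cases hd : (w.1 : ℕ) = a.1 + b.1 + d.1
  swap
  · rw [sum_eq_zero, sum_eq_zero]
    · intro x _
      by_contra h
      have h1 := cJ_deg (left_ne_zero_of_mul h)
      have h2 := cJ_deg (right_ne_zero_of_mul h)
      omega
    · intro x _
      by_contra h
      have h1 := cJ_deg (left_ne_zero_of_mul h)
      have h2 := cJ_deg (right_ne_zero_of_mul h)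
      omega
  have hw := w.1.2
  obtain ⟨i, a⟩ := a
  obtain ⟨j, b⟩ := b
  obtain ⟨k, d⟩ := d
  dsimp only at hd
  have key := three_indep (F := F) (i := i) (j := j) (k := k)
    (fun a b d => ∑ x, cJ ⟨i, a⟩ ⟨j, b⟩ x * cJ x ⟨k, d⟩ w)
    (fun a b d => ∑ x, cJ ⟨j, b⟩ ⟨k, d⟩ x * cJ ⟨i, a⟩ x w) ?_
  · exact congrFun (congrFun (congrFun key a) b) d
  intro g g' g''
  have h1 := coassoc w.2 (tl g) (tl g') (tl g'')
  have hf : ∀ (j : Fin (n + 1)) (d : JJ F n) (g : GL (Fin j) F), (d.1 : ℕ) ≠ j → X d.2 _ (tl g) = 0 := by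
    intro j d g hd
    apply X_dim; simp; omega
  have e1 : ∀ u, Dl w.2 _ (bl (tl g) u (tl g')) _ (tl g'') =
      ∑ x : JJ F n, ∑ d : Ir F k, cJ x ⟨k, d⟩ w * (X x.2 _ (bl (tl g) u (tl g')) * (wd F k).χ d g'') := by
    intro u
    rw [← Dl_expandJ (n := n) _ _ _ (by simp; omega) (by simp; omega)]
    refine sum_congr rfl fun x _ => ?_
    rw [sum_JJ (n := n) (m := k) (by omega)]
    · refine sum_congr rfl fun d _ => ?_
      dsimp only
      rw [X_std]
    · intro d hd; rw [hf k d g'' hd]; ring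
  have e2 : ∀ u, Dl w.2 _ (tl g) _ (bl (tl g') u (tl g'')) =
      ∑ x : JJ F n, ∑ a : Ir F i, cJ ⟨i, a⟩ x w * (X x.2 _ (bl (tl g') u (tl g'')) * (wd F i).χ a g) := by
    intro u
    rw [← Dl_expandJ (n := n) _ _ _ (by simp; omega) (by simp; omega), sum_comm]
    refine sum_congr rfl fun x _ => ?_
    rw [sum_JJ (n := n) (m := i) (by omega)]
    · refine sum_congr rfl fun d _ => ?_
      dsimp only
      rw [X_std, mul_comm ((wd F i).χ d g)]
    · intro d hd; rw [hf i d g hd]; ring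
  have a1 : (∑ u, Dl w.2 _ (bl (tl g) u (tl g')) _ (tl g'')) / Fintype.card ((Fin j → F) →ₗ[F] (Fin i → F)) =
      ∑ x : JJ F n, ∑ d : Ir F k, cJ x ⟨k, d⟩ w * (Dl x.2 _ (tl g) _ (tl g') * (wd F k).χ d g'') := by
    simp_rw [e1, Dl, sum_div, sum_mul, mul_sum]
    rw [sum_comm]
    refine sum_congr rfl fun x _ => ?_
    rw [sum_comm]
    refine sum_congr rfl fun d _ => sum_congr rfl fun u _ => ?_
    ring
  have a2 : (∑ u, Dl w.2 _ (tl g) _ (bl (tl g') u (tl g''))) / Fintype.card ((Fin k → F) →ₗ[F] (Fin j → F)) =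
      ∑ x : JJ F n, ∑ a : Ir F i, cJ ⟨i, a⟩ x w * (Dl x.2 _ (tl g') _ (tl g'') * (wd F i).χ a g) := by
    simp_rw [e2, Dl, sum_div, sum_mul, mul_sum]
    rw [sum_comm]
    refine sum_congr rfl fun x _ => ?_
    rw [sum_comm]
    refine sum_congr rfl fun d _ => sum_congr rfl fun u _ => ?_
    ring
  rw [a1, a2] at h1
  simp_rw [Dl_std, sum_mul, mul_sum] at h1
  simp_rw [sum_mul]
  have s1 : ∀ (f : Ir F i → Ir F j → Ir F k → JJ F n → ℂ),
      ∑ a, ∑ b, ∑ d, ∑ x, f a b d x = ∑ x, ∑ d, ∑ a, ∑ b, f a b d x := by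
    intro f
    calc _ = ∑ a, ∑ b, ∑ x, ∑ d, f a b d x := sum_congr rfl fun a _ => sum_congr rfl fun b _ => sum_comm
      _ = ∑ a, ∑ x, ∑ b, ∑ d, f a b d x := sum_congr rfl fun a _ => sum_comm
      _ = ∑ x, ∑ a, ∑ b, ∑ d, f a b d x := sum_comm
      _ = ∑ x, ∑ a, ∑ d, ∑ b, f a b d x := sum_congr rfl fun x _ => sum_congr rfl fun a _ => sum_comm
      _ = _ := sum_congr rfl fun x _ => sum_comm
  have s2 : ∀ (f : Ir F i → Ir F j → Ir F k → JJ F n → ℂ),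
      ∑ a, ∑ b, ∑ d, ∑ x, f a b d x = ∑ x, ∑ a, ∑ b, ∑ d, f a b d x := by
    intro f
    calc _ = ∑ a, ∑ b, ∑ x, ∑ d, f a b d x := sum_congr rfl fun a _ => sum_congr rfl fun b _ => sum_comm
      _ = ∑ a, ∑ x, ∑ b, ∑ d, f a b d x := sum_congr rfl fun a _ => sum_comm
      _ = ∑ x, ∑ a, ∑ b, ∑ d, f a b d x := sum_comm
  rw [s1, s2]
  refine Eq.trans (sum_congr rfl fun x _ => sum_congr rfl fun d _ => sum_congr rfl fun a _ =>
    sum_congr rfl fun b _ => ?_) (h1.trans (sum_congr rfl fun x _ => sum_congr rfl fun d _ => sum_congr rfl fun a _ =>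
    sum_congr rfl fun b _ => ?_)) <;> ring

end
end TCV

open scoped MatrixGroups
namespace TCV
open Finset
set_option linter.unusedSectionVars false
set_option linter.unusedSimpArgs false
set_option linter.unusedVariables false

section
variable {F : Type} [Field F] [Fintype F] [DecidableEq F]

/-! ### integrality of the structure constants -/
section nat
variable {k l m : ℕ} (E : ((Fin k → F) × (Fin l → F)) ≃ₗ[F] (Fin m → F))

lemma QQ_mul (p p' : PP F k l) : QQ E p * QQ E p' =
    QQ E ((p.1.1 * p'.1.1, p.1.2 * p'.1.2), tl p.1.1 ∘ₗ p'.2 + p.2 ∘ₗ tl p'.1.2) := by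
  apply tl_inj
  refine LinearMap.ext fun v => ?_
  obtain ⟨q, rfl⟩ := E.surjective v
  rw [tl_mul, LinearMap.comp_apply, tl_QQ, tl_QQ, tl_QQ]
  congr 1
  simp [tl_mul, add_assoc]

lemma QQ_one : QQ E ((1, 1), 0) = 1 := by
  apply tl_inj
  refine LinearMap.ext fun v => ?_
  obtain ⟨q, rfl⟩ := E.surjective v
  rw [tl_QQ]
  simp [tl_one]

noncomputable def L1 : GL (Fin k) F →* GL (Fin m) F where
  toFun g := QQ E ((g, 1), 0)
  map_one' := QQ_one E
  map_mul' g h := by rw [QQ_mul]; simp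

noncomputable def L2 : GL (Fin l) F →* GL (Fin m) F where
  toFun g := QQ E ((1, g), 0)
  map_one' := QQ_one E
  map_mul' g h := by rw [QQ_mul]; simp

noncomputable def L3 : Multiplicative ((Fin l → F) →ₗ[F] (Fin k → F)) →* GL (Fin m) F where
  toFun u := QQ E ((1, 1), u.toAdd)
  map_one' := QQ_one E
  map_mul' g h := by rw [QQ_mul]; simp [tl_one, add_comm]

lemma cc_nat' (a : Ir F k) (b : Ir F l) (w : Ir F m) : ∃ c : ℕ, cc a b w = c := by
  by_cases hm : m = k + l
  swap
  · refine ⟨0, ?_⟩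
    by_contra h
    exact hm (cc_deg a b w (by simpa using h))
  obtain ⟨E⟩ : Nonempty (((Fin k → F) × (Fin l → F)) ≃ₗ[F] (Fin m → F)) :=
    ⟨LinearEquiv.ofFinrankEq _ _ (by simp [hm])⟩
  let W := wd F m
  let A := ∑ g, (wd F k).ε a g • W.π w (L1 E g)
  let B := ∑ h, (wd F l).ε b h • W.π w (L2 E h)
  let H := (Fin l → F) →ₗ[F] (Fin k → F)
  let _ : Fintype (Multiplicative H) := (inferInstance : Fintype H)
  let C := ∑ u : Multiplicative H, ((Fintype.card (Multiplicative H) : ℂ)⁻¹ * (1 : Multiplicative H →* ℂ) u) • W.π w (L3 E u)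
  have hA : A * A = A := (wd F k).ε_idem ((W.π w).comp (L1 E)) a
  have hB : B * B = B := (wd F l).ε_idem ((W.π w).comp (L2 E)) b
  have hC : C * C = C := theta_idem ((W.π w).comp (L3 E)) 1
  have hAB : Commute A B := by
    refine Commute.sum_left _ _ _ fun g _ => Commute.sum_right _ _ _ fun h _ => ?_
    refine (Commute.smul_left ?_ _).smul_right _
    refine (show Commute _ _ from ?_).map (W.π w)
    change QQ E _ * QQ E _ = QQ E _ * QQ E _
    rw [QQ_mul, QQ_mul]; simp
  have conj : ∀ (g : GL (Fin k) F) (h : GL (Fin l) F) (u : H), QQ E ((1, 1), u) * QQ E ((g, h), 0) =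
      QQ E ((g, h), 0) * QQ E ((1, 1), tl g⁻¹ ∘ₗ u ∘ₗ tl h) := by
    intro g h u
    rw [QQ_mul, QQ_mul]
    have e : u ∘ₗ tl h = tl g ∘ₗ tl g⁻¹ ∘ₗ u ∘ₗ tl h := LinearMap.ext fun v => by simp [tl_mul_inv]
    simp [← e, tl_one]
  let ce (g : GL (Fin k) F) (h : GL (Fin l) F) : Multiplicative H ≃ Multiplicative H :=
    { toFun := fun u => Multiplicative.ofAdd (tl g⁻¹ ∘ₗ u.toAdd ∘ₗ tl h)
      invFun := fun u => Multiplicative.ofAdd (tl g ∘ₗ u.toAdd ∘ₗ tl h⁻¹)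
      left_inv := fun u => LinearMap.ext fun v => by
        change tl g (tl g⁻¹ (u.toAdd (tl h (tl h⁻¹ v)))) = u.toAdd v
        rw [tl_mul_inv, tl_mul_inv]
      right_inv := fun u => LinearMap.ext fun v => by
        change tl g⁻¹ (tl g (u.toAdd (tl h⁻¹ (tl h v)))) = u.toAdd v
        rw [tl_inv_mul, tl_inv_mul] }
  have hCg : ∀ g h, Commute C (W.π w (QQ E ((g, h), 0))) := by
    intro g h
    change C * _ = _ * C
    rw [sum_mul, mul_sum]
    refine Fintype.sum_equiv (ce g h) _ _ fun u => ?_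
    rw [smul_mul_assoc, mul_smul_comm, ← map_mul, ← map_mul]
    congr 2
    exact conj g h u.toAdd
  have hCA : Commute C A := Commute.sum_right _ _ _ fun g _ => (hCg g 1).smul_right _
  have hCB : Commute C B := Commute.sum_right _ _ _ fun g _ => (hCg 1 g).smul_right _
  have hid : (C * (B * A)) * (C * (B * A)) = C * (B * A) := by
    have h1 : IsIdempotentElem (B * A) := IsIdempotentElem.mul_of_commute hAB.symm hB hA
    exact IsIdempotentElem.mul_of_commute (hCB.mul_right hCA) hC h1
  obtain ⟨c, hc⟩ := trace_idem _ hid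
  refine ⟨c, ?_⟩
  rw [← hc, cc]
  have : C * (B * A) = ∑ h, (wd F l).ε b h • ∑ g, (wd F k).ε a g • C * W.π w (QQ E ((g, h), 0)) := by
    rw [show B * A = _ from sum_mul _ _ _, show C * _ = _ from mul_sum _ _ _]
    refine sum_congr rfl fun h _ => ?_
    rw [mul_sum, mul_sum, smul_sum]
    refine sum_congr rfl fun g _ => ?_
    rw [smul_mul_smul_comm, mul_smul_comm, ← map_mul, ← smul_smul, smul_mul_assoc]
    congr 4
    change QQ E _ * QQ E _ = _
    rw [QQ_mul]; simp
  rw [this, Matrix.trace_sum]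
  refine sum_congr rfl fun h _ => ?_
  rw [Matrix.trace_smul, smul_eq_mul]
  congr 1
  rw [Matrix.trace_sum]
  refine sum_congr rfl fun g _ => ?_
  rw [smul_mul_assoc, Matrix.trace_smul, smul_eq_mul]
  congr 1
  rw [sum_mul, Matrix.trace_sum, Dl, sum_div]
  let ce' : H ≃ Multiplicative H :=
    { toFun := fun u => Multiplicative.ofAdd (u ∘ₗ tl h⁻¹)
      invFun := fun u => (u.toAdd ∘ₗ tl h)
      left_inv := fun u => LinearMap.ext fun v => by
        change (u (tl h⁻¹ (tl h v))) = u v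
        rw [tl_inv_mul]
      right_inv := fun u => LinearMap.ext fun v => by
        change (u.toAdd (tl h (tl h⁻¹ v))) = u.toAdd v
        rw [tl_mul_inv] }
  refine Fintype.sum_equiv ce' _ _ fun u => ?_
  have e1 : X w _ (bl (tl g) u (tl h)) = W.χ w (QQ E ((g, h), u)) := by
    rw [← X_std]; exact X_iso w E fun q => (tl_QQ E ((g, h), u) q).symm
  have e2 : L3 E (ce' u) * QQ E ((g, h), 0) = QQ E ((g, h), u) := by
    change QQ E ((1, 1), u ∘ₗ tl h⁻¹) * _ = _
    rw [QQ_mul]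
    have e : (u ∘ₗ tl h⁻¹) ∘ₗ tl h = u := LinearMap.ext fun v => by simp [tl_inv_mul]
    simp [e]
  rw [smul_mul_assoc, ← map_mul, e2, e1, Matrix.trace_smul, smul_eq_mul]
  have : Fintype.card (Multiplicative H) = Fintype.card H := rfl
  rw [this]
  change _ = _ * W.χ w _
  simp only [MonoidHom.one_apply]
  ring

end nat

noncomputable def cn {k l m : ℕ} (a : Ir F k) (b : Ir F l) (w : Ir F m) : ℕ := (cc_nat' a b w).choose

lemma cn_eq {k l m : ℕ} (a : Ir F k) (b : Ir F l) (w : Ir F m) : (cn a b w : ℂ) = cc a b w :=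
  (cc_nat' a b w).choose_spec.symm

/-! ### degree zero -/

lemma sum_d2 (m : ℕ) : ∑ i : Ir F m, (wd F m).d i ^ 2 = Fintype.card (GL (Fin m) F) := by
  have := (wd F m).reg 1
  rw [if_pos rfl] at this
  have h2 : ((∑ i : Ir F m, (wd F m).d i ^ 2 : ℕ) : ℂ) = Fintype.card (GL (Fin m) F) := by
    rw [← this]; push_cast
    refine sum_congr rfl fun i _ => ?_
    rw [WD.χ_one]; ring
  exact_mod_cast h2

lemma card_GL0 : Fintype.card (GL (Fin 0) F) = 1 := by
  rw [Fintype.card_eq_one_iff]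
  exact ⟨1, fun g => Subsingleton.elim _ _⟩

lemma card_Ir0 : Fintype.card (Ir F 0) = 1 := by
  have h := sum_d2 (F := F) 0
  rw [card_GL0] at h
  have h1 : Fintype.card (Ir F 0) ≤ 1 := by
    rw [← h, ← card_univ, card_eq_sum_ones]
    refine sum_le_sum fun i _ => ?_
    exact Nat.one_le_pow _ _ ((wd F 0).d_pos i)
  have h2 : Fintype.card (Ir F 0) ≠ 0 := by
    intro h0
    have : IsEmpty (Ir F 0) := Fintype.card_eq_zero_iff.1 h0
    rw [univ_eq_empty, sum_empty] at h
    exact absurd h (by norm_num)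
  omega

noncomputable instance : Unique (Ir F 0) := (Fintype.card_eq_one_iff_nonempty_unique.1 card_Ir0).some

lemma d_o (i : Ir F 0) : (wd F 0).d i = 1 := by
  have h := sum_d2 (F := F) 0
  rw [card_GL0, Fintype.sum_unique, Nat.pow_eq_one] at h
  replace h := h.resolve_right (by norm_num)
  rw [Subsingleton.elim i default, h]

lemma χ_o (i : Ir F 0) (g) : (wd F 0).χ i g = 1 := by
  rw [Subsingleton.elim g 1, WD.χ_one, d_o]; simp

lemma lin_indep' {m : ℕ} (w : Ir F m) (c : Ir F m → ℂ) (h : ∀ g, ∑ i, c i * (wd F m).χ i g = (wd F m).χ w g)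
    (a : Ir F m) : c a = if a = w then 1 else 0 := by
  have := (wd F m).lin_indep c (fun a => if a = w then 1 else 0) (fun g => by rw [h]; simp)
  exact congrFun this a

lemma card_sub {A : Type} [Fintype A] [Subsingleton A] [Nonempty A] : Fintype.card A = 1 := by
  rw [Fintype.card_eq_one_iff]
  exact ⟨Classical.arbitrary A, fun g => Subsingleton.elim _ _⟩

lemma cc_o_left {m : ℕ} (o : Ir F 0) (a w : Ir F m) : cc o a w = if a = w then 1 else 0 := by
  refine lin_indep' w (fun a => cc o a w) (fun h => ?_) a
  have := Dl_std w (1 : GL (Fin 0) F) h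
  rw [Fintype.sum_unique, Subsingleton.elim default o] at this
  simp only [χ_o, one_mul] at this
  rw [← this, Dl]
  have : Subsingleton ((Fin m → F) →ₗ[F] (Fin 0 → F)) := ⟨fun f g => LinearMap.ext fun v => Subsingleton.elim _ _⟩
  have h1 : Fintype.card ((Fin m → F) →ₗ[F] (Fin 0 → F)) = 1 := card_sub
  rw [h1, Nat.cast_one, div_one, sum_eq_single 0 (fun b _ hb => absurd (Subsingleton.elim b 0) hb) (by simp), ← X_std]
  refine X_iso w
    { toFun := fun p => p.2
      map_add' := fun _ _ => rfl
      map_smul' := fun _ _ => rfl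
      invFun := fun v => (0, v)
      left_inv := fun p => Prod.ext (Subsingleton.elim _ _) rfl
      right_inv := fun p => rfl } fun v => rfl

lemma cc_o_right {m : ℕ} (o : Ir F 0) (a w : Ir F m) : cc a o w = if a = w then 1 else 0 := by
  refine lin_indep' w (fun a => cc a o w) (fun h => ?_) a
  have := Dl_std w h (1 : GL (Fin 0) F)
  rw [sum_congr rfl fun _ _ => Fintype.sum_unique _] at this
  rw [Subsingleton.elim default o] at this
  simp only [χ_o, mul_one] at this
  rw [← this, Dl]
  have : Subsingleton ((Fin 0 → F) →ₗ[F] (Fin m → F)) := ⟨fun f g => LinearMap.ext fun v => by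
    rw [Subsingleton.elim v 0, map_zero, map_zero]⟩
  have h1 : Fintype.card ((Fin 0 → F) →ₗ[F] (Fin m → F)) = 1 := card_sub
  rw [h1, Nat.cast_one, div_one, sum_eq_single 0 (fun b _ hb => absurd (Subsingleton.elim b 0) hb) (by simp), ← X_std]
  refine X_iso w
    { toFun := fun p => p.1
      map_add' := fun _ _ => rfl
      map_smul' := fun _ _ => rfl
      invFun := fun v => (v, 0)
      left_inv := fun p => Prod.ext rfl (Subsingleton.elim _ _)
      right_inv := fun p => rfl } fun v => by simp

/-! ### central characters -/

noncomputable def scal (m : ℕ) : Fˣ →* GL (Fin m) F := Units.map (Matrix.scalar (Fin m)).toMonoidHom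

lemma scal_comm (m : ℕ) (z : Fˣ) (g : GL (Fin m) F) : scal m z * g = g * scal m z := by
  apply Units.ext
  exact Matrix.scalar_comm (z : F) (fun r' => mul_comm _ _) g.1

lemma tl_scal (m : ℕ) (z : Fˣ) (v) : tl (scal m z) v = (z : F) • v := by
  change Matrix.toLin' (Matrix.scalar (Fin m) (z : F)) v = _
  simp

noncomputable def om {m : ℕ} (w : Ir F m) : Fˣ →* ℂ := (wd F m).cen (scal m) (scal_comm m) w

lemma X_scal {V : Type} [AddCommGroup V] [Module F V] [Finite V] {m : ℕ} (w : Ir F m) (z : Fˣ) (x : V →ₗ[F] V) :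
    X w V ((z : F) • x) = om w z * X w V x := by
  by_cases hm : Module.finrank F V = m
  swap
  · rw [X_dim w _ hm, X_dim w _ hm, mul_zero]
  have hz : (z : F) ≠ 0 := z.ne_zero
  by_cases hx : Function.Bijective x
  · obtain ⟨e⟩ := exists_frame hm
    obtain ⟨g, hg⟩ := exists_gl e x hx
    rw [← X_iso w e hg, ← X_iso w (x := tl (scal m z * g)) e, X_std, X_std]
    · exact (wd F m).cen_mul _ _ _ _ _
    · intro v
      rw [tl_mul, LinearMap.comp_apply, tl_scal, map_smul, hg]; rfl
  · have h1 : X w V x = 0 := by by_contra h; exact hx (X_unit w x h)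
    rw [h1, mul_zero]
    by_contra h
    apply hx
    have h2 := X_unit w _ h
    rw [← Finite.injective_iff_bijective] at h2 ⊢
    intro u v huv
    apply h2
    change (z : F) • x u = (z : F) • x v
    rw [huv]

lemma om_mul {k l m : ℕ} (a : Ir F k) (b : Ir F l) (w : Ir F m) (h : cc a b w ≠ 0) : om w = om a * om b := by
  ext z
  have key := two_indep (F := F) (fun a b => cc a b w * (om a z * om b z)) (fun a b => cc a b w * om w z) ?_ (k := k) (l := l)
  · have := congrFun (congrFun key a) b
    exact (mul_left_cancel₀ h this).symm
  intro g h
  have e1 := Dl_std w (scal k z * g) (scal l z * h)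
  have e2 := Dl_std w g h
  have e3 : Dl w _ (tl (scal k z * g)) _ (tl (scal l z * h)) = om w z * Dl w _ (tl g) _ (tl h) := by
    rw [Dl, Dl, ← mul_div_assoc, mul_sum]
    congr 1
    symm
    refine Fintype.sum_equiv ((LinearEquiv.smulOfUnit (R := F) z).toEquiv) _ _ fun u => ?_
    rw [← X_scal]
    congr 1
    refine LinearMap.ext fun v => ?_
    simp [tl_mul, tl_scal]
    rfl
  rw [e1, e2, mul_sum] at e3
  refine Eq.trans (sum_congr rfl fun a _ => sum_congr rfl fun b _ => ?_) (e3.trans ?_)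
  · rw [show (wd F k).χ a (scal k z * g) = om a z * (wd F k).χ a g from (wd F k).cen_mul _ _ _ _ _,
      show (wd F l).χ b (scal l z * h) = om b z * (wd F l).χ b h from (wd F l).cen_mul _ _ _ _ _]
    ring
  · refine sum_congr rfl fun a _ => ?_
    rw [mul_sum]
    exact sum_congr rfl fun b _ => by ring

end
end TCV

open scoped MatrixGroups
namespace TCV
open Finset
set_option linter.unusedSectionVars false
set_option linter.unusedSimpArgs false
set_option linter.unusedVariables false

section
variable {F : Type} [Field F] [Fintype F] [DecidableEq F]

lemma card_GL (m : ℕ) : (Fintype.card (GL (Fin m) F) : ℚ) =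
    (Fintype.card F : ℚ) ^ (m.choose 2) * psi m (Fintype.card F) := by
  have hq : 1 < Fintype.card F := Fintype.one_lt_card
  rw [← Nat.card_eq_fintype_card, Matrix.card_GL_field, Nat.cast_prod, Fin.prod_univ_eq_prod_range
    (fun i => (((Fintype.card F) ^ m - (Fintype.card F) ^ i : ℕ) : ℚ))]
  have h1 : ∀ i ∈ range m, (((Fintype.card F) ^ m - (Fintype.card F) ^ i : ℕ) : ℚ) =
      (Fintype.card F : ℚ) ^ i * ((Fintype.card F : ℚ) ^ (m - 1 - i + 1) - 1) := by
    intro i hi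
    rw [mem_range] at hi
    rw [Nat.cast_sub (Nat.pow_le_pow_right (by omega) (by omega)), mul_sub, ← pow_add]
    push_cast
    rw [show i + (m - 1 - i + 1) = m by omega, mul_one]
  rw [prod_congr rfl h1, prod_mul_distrib, prod_pow_eq_pow_sum, Finset.sum_range_id, psi,
    Finset.prod_range_reflect (fun i => (Fintype.card F : ℚ) ^ (i + 1) - 1), Nat.choose_two_right]

lemma card_Hom (k l : ℕ) : Fintype.card ((Fin l → F) →ₗ[F] (Fin k → F)) = Fintype.card F ^ (k * l) := by
  rw [Module.card_eq_pow_finrank (K := F), Module.finrank_linearMap, Module.finrank_fin_fun,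
    Module.finrank_fin_fun, mul_comm]

lemma deg_sum {k l : ℕ} (a : Ir F k) (b : Ir F l) :
    (Fintype.card (PP F k l) : ℂ) * ∑ w : Ir F (k + l), cc a b w * (wd F (k + l)).d w =
      Fintype.card (GL (Fin (k + l)) F) * ((wd F k).d a * (wd F l).d b) := by
  obtain ⟨E⟩ : Nonempty (((Fin k → F) × (Fin l → F)) ≃ₗ[F] (Fin (k + l) → F)) :=
    ⟨LinearEquiv.ofFinrankEq _ _ (by simp)⟩
  simp_rw [← WD.χ_one]
  rw [← adj_std a b, sum_grass E _ (fun W hW => T_dim a b _ W hW), sum_congr rfl (g := fun _ =>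
    (wd F k).χ a 1 * (wd F l).χ b 1), sum_const, card_univ, nsmul_eq_mul]
  intro h _
  rw [← X_std, ← X_std, ← T_bl a b E (mem_W0 E) (y := tl 1) (u := 0) (z := tl 1) (x := tl 1)]
  · symm
    refine T_conj a b (tlE h) ?_ ((map_W0 E h _).1 rfl)
    intro v; simp [tl_one]
  · intro p; simp [tl_one]

lemma card_PP (k l : ℕ) : (Fintype.card (GL (Fin (k + l)) F) : ℚ) * (psi k (Fintype.card F) * psi l (Fintype.card F)) =
    Fintype.card (PP F k l) * psi (k + l) (Fintype.card F) := by
  rw [Fintype.card_prod, Fintype.card_prod, card_Hom]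
  push_cast
  rw [card_GL, card_GL, card_GL]
  have : (k + l).choose 2 = k.choose 2 + l.choose 2 + k * l := by
    rw [Nat.add_choose_eq]
    simp [Finset.Nat.antidiagonal_succ]
    ring
  rw [this]; ring

/-- normalised degree -/
noncomputable def dl {m : ℕ} (w : Ir F m) : ℚ := (wd F m).d w / psi m (Fintype.card F)

lemma q_gt : (1 : ℚ) < Fintype.card F := by exact_mod_cast Fintype.one_lt_card

lemma psi_ne (m : ℕ) : psi m (Fintype.card F : ℚ) ≠ 0 := (psi_pos q_gt).ne'

lemma dl_pos {m : ℕ} (w : Ir F m) : 0 < dl w :=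
  div_pos (by exact_mod_cast (wd F m).d_pos w) (psi_pos q_gt)

lemma dl_mul {k l : ℕ} (a : Ir F k) (b : Ir F l) :
    ∑ w : Ir F (k + l), (cn a b w : ℚ) * dl w = dl a * dl b := by
  have h1 := deg_sum a b
  simp_rw [← cn_eq] at h1
  have h2 : (Fintype.card (PP F k l) : ℚ) * ∑ w : Ir F (k + l), (cn a b w : ℚ) * (wd F (k + l)).d w =
      Fintype.card (GL (Fin (k + l)) F) * ((wd F k).d a * (wd F l).d b) := by exact_mod_cast h1
  have h3 := card_PP (F := F) k l
  have hP : (Fintype.card (PP F k l) : ℚ) ≠ 0 := by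
    rw [Nat.cast_ne_zero]; exact Fintype.card_ne_zero
  have h4 : ∑ w : Ir F (k + l), (cn a b w : ℚ) * dl w =
      (∑ w : Ir F (k + l), (cn a b w : ℚ) * (wd F (k + l)).d w) / psi (k + l) (Fintype.card F) := by
    rw [sum_div]
    refine sum_congr rfl fun w _ => ?_
    rw [dl, mul_div_assoc]
  rw [h4, dl, dl, div_mul_div_comm, div_eq_div_iff (psi_ne _) (mul_ne_zero (psi_ne _) (psi_ne _))]
  apply mul_left_cancel₀ hP
  linear_combination (psi k (Fintype.card F : ℚ) * psi l (Fintype.card F : ℚ)) * h2 + ((wd F k).d a * (wd F l).d b) * h3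

lemma dl_o (w : Ir F 0) : dl w = 1 := by
  rw [dl, d_o, psi]; simp

lemma sum_sqC {m : ℕ} (hm : 1 ≤ m) (z : Fˣ) (hz : z ≠ 1) : ∑ w : Ir F m, om w z * (dl w : ℂ) ^ 2 = 0 := by
  have h := (wd F m).reg (scal m z)
  rw [if_neg] at h
  · have e : ∀ w : Ir F m, om w z * (dl w : ℂ) ^ 2 = ((wd F m).d w * (wd F m).χ w (scal m z)) / ((psi m (Fintype.card F) : ℚ) : ℂ) ^ 2 := by
      intro w
      rw [show (wd F m).χ w (scal m z) = om w z * (wd F m).d w from (wd F m).cen_χ _ _ _ _, dl]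
      push_cast
      ring
    simp_rw [e]
    rw [← sum_div, h, zero_div]
  · intro h1
    apply hz
    apply Units.ext
    have h2 := tl_scal m z (fun _ => 1)
    rw [h1, tl_one] at h2
    have := congrFun h2 ⟨0, by omega⟩
    simpa using this.symm

lemma sum_sq1 : ∑ w : Ir F 1, (dl w) ^ 2 = 1 / ((Fintype.card F : ℚ) - 1) := by
  have h : ((∑ i : Ir F 1, (wd F 1).d i ^ 2 : ℕ) : ℚ) = Fintype.card (GL (Fin 1) F) := by rw [sum_d2]
  rw [card_GL] at h
  have hq := q_gt (F := F)
  have hq' : (Fintype.card F : ℚ) - 1 ≠ 0 := by linarith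
  simp only [dl, div_pow, psi] at h ⊢
  rw [← sum_div]
  push_cast at h
  rw [h]
  simp
  field_simp

end
end TCV

open scoped MatrixGroups
namespace TCV
open Finset
set_option linter.unusedSectionVars false
set_option linter.unusedSimpArgs false
set_option linter.unusedVariables false

/-- one block of a layered permutation -/
lemma layered_step {A : Type} (m : ℕ) (ρ : ℕ → ℕ) (a : ℕ → A) (hρ : ∀ x < m, ρ x < m)
    (inj : ∀ x < m, ∀ y < m, ρ x = ρ y → x = y) (sur : ∀ y < m, ∃ x < m, ρ x = y)
    (H : ∀ x, x + 1 < m → ρ (x + 1) < ρ x → ρ x = ρ (x + 1) + 1 ∧ a x = a (x + 1))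
    (j : ℕ) (hj : j < m) (hs : ∀ x < j, ρ x < j ∧ ρ (ρ x) = x ∧ a (ρ x) = a x) :
    ∃ p, j ≤ p ∧ p < m ∧ ∀ x < p + 1, ρ x < p + 1 ∧ ρ (ρ x) = x ∧ a (ρ x) = a x := by
  obtain ⟨p, hpm, hp⟩ := sur j hj
  have hjp : j ≤ p := by
    by_contra h
    have := (hs p (by omega)).1
    omega
  have hge : ∀ x, j ≤ x → x < m → j ≤ ρ x := by
    intro x hx hxm
    by_contra h
    have h1 := hs (ρ x) (by omega)
    have := inj _ (by have := hρ _ hxm; exact hρ _ this) _ hxm h1.2.1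
    omega
  have hdec : ∀ t, j ≤ t → t < p → ρ (t + 1) < ρ t := by
    intro t ht htp
    by_contra h
    have h0 : ρ t < ρ (t + 1) := by
      rcases Nat.lt_or_ge (ρ t) (ρ (t + 1)) with h' | h'
      · exact h'
      · have := inj t (by omega) (t + 1) (by omega) (by omega)
        omega
    have : ∀ s, t + 1 + s ≤ p → ρ t < ρ (t + 1 + s) := by
      intro s
      induction s with
      | zero => intro _; exact h0
      | succ s ih =>
        intro hs'
        have h1 := ih (by omega)
        rcases Nat.lt_or_ge (ρ (t + 1 + s + 1)) (ρ (t + 1 + s)) with h2 | h2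
        · have h3 := (H _ (by omega) h2).1
          have h4 : ρ (t + 1 + s + 1) ≠ ρ t := fun h' => by
            have := inj _ (by omega) _ (by omega) h'
            omega
          show ρ t < ρ (t + 1 + s + 1)
          omega
        · show ρ t < ρ (t + 1 + s + 1)
          omega
    have h5 := this (p - (t + 1)) (by omega)
    rw [show t + 1 + (p - (t + 1)) = p by omega, hp] at h5
    have := hge t ht (by omega)
    omega
  have hval : ∀ s, j + s ≤ p → ρ (j + s) + s = ρ j ∧ a (j + s) = a j := by
    intro s
    induction s with
    | zero => intro _; simp
    | succ s ih =>
      intro hs'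
      have h1 := ih (by omega)
      have h2 := H (j + s) (by omega) (hdec _ (by omega) (by omega))
      refine ⟨?_, h2.2.symm.trans h1.2⟩
      have e : j + (s + 1) = j + s + 1 := rfl
      rw [e]
      omega
  have hpj : ρ j = p := by
    have := (hval (p - j) (by omega)).1
    rw [show j + (p - j) = p by omega, hp] at this
    omega
  refine ⟨p, hjp, hpm, fun x hx => ?_⟩
  rcases Nat.lt_or_ge x j with h | h
  · exact ⟨by have := (hs x h).1; omega, (hs x h).2⟩
  · have h1 := hval (x - j) (by omega)
    rw [show j + (x - j) = x by omega] at h1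
    have h2 := hval (p - x) (by omega)
    have h3 : ρ x = j + (p - x) := by omega
    rw [h3]
    exact ⟨by omega, by omega, h2.2.trans h1.2.symm⟩

lemma layered {A : Type} (m : ℕ) (ρ : ℕ → ℕ) (a : ℕ → A) (hρ : ∀ x < m, ρ x < m)
    (inj : ∀ x < m, ∀ y < m, ρ x = ρ y → x = y) (sur : ∀ y < m, ∃ x < m, ρ x = y)
    (H : ∀ x, x + 1 < m → ρ (x + 1) < ρ x → ρ x = ρ (x + 1) + 1 ∧ a x = a (x + 1)) :
    ∀ x < m, ρ (ρ x) = x ∧ a (ρ x) = a x := by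
  have key : ∀ k ≤ m, ∃ j, k ≤ j ∧ j ≤ m ∧ ∀ x < j, ρ x < j ∧ ρ (ρ x) = x ∧ a (ρ x) = a x := by
    intro k
    induction k with
    | zero => intro _; exact ⟨0, le_rfl, by omega, fun x hx => by omega⟩
    | succ k ih =>
      intro hk
      obtain ⟨j, h1, h2, h3⟩ := ih (by omega)
      rcases Nat.lt_or_ge j (k + 1) with h | h
      · obtain ⟨p, h4, h5, h6⟩ := layered_step m ρ a hρ inj sur H j (by omega) h3
        exact ⟨p + 1, by omega, by omega, h6⟩
      · exact ⟨j, h, h2, h3⟩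
  obtain ⟨j, h1, h2, h3⟩ := key m le_rfl
  intro x hx
  exact (h3 x (by omega)).2

lemma layered_fin {A : Type} {m : ℕ} (ρ : Fin m → Fin m) (a : Fin m → A) (inj : Function.Injective ρ)
    (H : ∀ x y : Fin m, (y : ℕ) = x + 1 → ρ y < ρ x → (ρ x : ℕ) = ρ y + 1 ∧ a x = a y) (x : Fin m) :
    ρ (ρ x) = x ∧ a (ρ x) = a x := by
  have sur := Finite.injective_iff_surjective.1 inj
  have h := layered m (fun x => if h : x < m then (ρ ⟨x, h⟩ : ℕ) else x)
    (fun y => if h : y < m then a ⟨y, h⟩ else a x) ?_ ?_ ?_ ?_ x x.2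
  · simpa [Fin.ext_iff] using h
  · intro x hx
    simp only [hx, dif_pos]
    exact (ρ ⟨x, hx⟩).2
  · intro x hx y hy hxy
    simp only [hx, hy, dif_pos] at hxy
    have := inj (Fin.ext hxy)
    simpa using this
  · intro y hy
    obtain ⟨z, hz⟩ := sur ⟨y, hy⟩
    exact ⟨z, z.2, by simp [hz]⟩
  · intro x hx hlt
    have hx' : x < m := by omega
    simp only [hx, hx', dif_pos] at hlt ⊢
    exact H ⟨x, hx'⟩ ⟨x + 1, hx⟩ rfl hlt

/-- an idempotent with commutative corner has trace at most one -/
lemma trace_le {d : ℕ} (E : Matrix (Fin d) (Fin d) ℂ) (hE : E * E = E)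
    (hc : ∀ M N : Matrix (Fin d) (Fin d) ℂ, E * M * E * N * E = E * N * E * M * E) :
    E.trace ^ 3 = E.trace := by
  have key : ∀ a i j k l b, E a i * E j k * E l b = E a k * E l i * E j b := by
    intro a i j k l b
    have := congrFun (congrFun (hc (Matrix.single i j 1) (Matrix.single k l 1)) a) b
    simpa [Matrix.mul_apply, Matrix.single_apply, Finset.sum_ite_eq, Finset.sum_mul, ite_and] using this
  have hE' : ∀ x y, ∑ z, E x z * E z y = E x y := fun x y => by
    have := congrFun (congrFun hE x) y
    rwa [Matrix.mul_apply] at this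
  have k1 : ∀ j k l b, E.trace * (E j k * E l b) = E l k * E j b := by
    intro j k l b
    rw [← hE' l k, Matrix.trace, sum_mul, sum_mul]
    refine sum_congr rfl fun a _ => ?_
    have := key a a j k l b
    rw [Matrix.diag_apply]
    linear_combination this
  have k2 : ∀ l b, E.trace * (E.trace * E l b) = E l b := by
    intro l b
    have e : E.trace * (E.trace * E l b) = ∑ j, E.trace * (E j j * E l b) := by
      rw [← mul_sum, ← sum_mul]; rfl
    rw [e, ← hE' l b, hE' l b]
    conv_rhs => rw [← hE' l b]
    refine sum_congr rfl fun j _ => ?_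
    exact k1 j j l b
  calc E.trace ^ 3 = ∑ l, E.trace * (E.trace * E l l) := by
        rw [← mul_sum, ← mul_sum]; simp only [Matrix.trace, Matrix.diag_apply]; ring
    _ = E.trace := sum_congr rfl fun l _ => k2 l l
end TCV

open scoped MatrixGroups
namespace TCV
open Finset
set_option linter.unusedSectionVars false
set_option linter.unusedSimpArgs false
set_option linter.unusedVariables false

section
variable {F : Type} [Field F] [Fintype F] [DecidableEq F] {m : ℕ}

/-- upper unitriangular matrices which are trivial in the columns before `c` -/
def NU (c : ℕ) (M : Matrix (Fin m) (Fin m) F) : Prop :=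
  ∀ i j : Fin m, ((j : ℕ) < c ∨ j ≤ i) → M i j = if i = j then 1 else 0

/-- sum of the superdiagonal entries in columns after `c` -/
def sg (c : ℕ) (M : Matrix (Fin m) (Fin m) F) : F :=
  ∑ i : Fin m, ∑ j : Fin m, if (i : ℕ) + 1 = j ∧ c < (j : ℕ) then M i j else 0

lemma NU.mono {c : ℕ} {M : Matrix (Fin m) (Fin m) F} (h : NU c M) : NU 0 M :=
  fun i j hij => h i j (by omega)

lemma NU_det {M : Matrix (Fin m) (Fin m) F} (h : NU 0 M) : M.det = 1 := by
  rw [Matrix.det_of_isUpperTriangular]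
  · refine prod_eq_one fun i _ => ?_
    rw [h i i (Or.inr le_rfl), if_pos rfl]
  · intro i j hij
    have hij : j < i := hij
    rw [h i j (Or.inr hij.le), if_neg hij.ne']

lemma NU_one : NU 0 (1 : Matrix (Fin m) (Fin m) F) := fun i j _ => by
  rw [Matrix.one_apply]

lemma NU_mul {M N : Matrix (Fin m) (Fin m) F} (hM : NU 0 M) (hN : NU 0 N) : NU 0 (M * N) := by
  intro i j hij
  have hij : j ≤ i := by omega
  rw [Matrix.mul_apply, sum_eq_single i]
  · rw [hM i i (Or.inr le_rfl), hN i j (Or.inr hij), if_pos rfl, one_mul]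
  · intro k _ hk
    rcases lt_or_gt_of_ne hk with h | h
    · rw [hM i k (Or.inr h.le), if_neg hk.symm, zero_mul]
    · rw [hN k j (Or.inr (hij.trans h.le)), if_neg (by omega), mul_zero]
  · simp

lemma NU_mul_super {M N : Matrix (Fin m) (Fin m) F} (hM : NU 0 M) (hN : NU 0 N) (i j : Fin m)
    (hij : (i : ℕ) + 1 = j) : (M * N) i j = M i j + N i j := by
  rw [Matrix.mul_apply, Fintype.sum_eq_add i j (by omega)]
  · rw [hM i i (Or.inr le_rfl), hN j j (Or.inr le_rfl), if_pos rfl, if_pos rfl, one_mul, mul_one, add_comm]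
  · rintro k ⟨h1, h2⟩
    rcases lt_or_gt_of_ne h1 with h | h
    · rw [hM i k (Or.inr h.le), if_neg h1.symm, zero_mul]
    · rw [hN k j (Or.inr (by omega)), if_neg (by omega), mul_zero]

lemma sg_mul {M N : Matrix (Fin m) (Fin m) F} (hM : NU 0 M) (hN : NU 0 N) (c : ℕ) :
    sg c (M * N) = sg c M + sg c N := by
  simp only [sg, ← sum_add_distrib]
  refine sum_congr rfl fun i _ => sum_congr rfl fun j _ => ?_
  split_ifs with h
  · exact NU_mul_super hM hN i j h.1
  · simp

lemma sg_one (c : ℕ) : sg c (1 : Matrix (Fin m) (Fin m) F) = 0 := by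
  refine sum_eq_zero fun i _ => sum_eq_zero fun j _ => ?_
  split_ifs with h
  · rw [Matrix.one_apply_ne]; omega
  · rfl

variable (F m) in
/-- the group of upper unitriangular matrices -/
def Ut : Subgroup (GL (Fin m) F) where
  carrier := {g | NU 0 g.1}
  one_mem' := NU_one
  mul_mem' := fun h1 h2 => NU_mul h1 h2
  inv_mem' := by
    intro g hg
    have e : g⁻¹ = g ^ (orderOf g - 1) := by
      rw [inv_eq_iff_mul_eq_one, ← pow_succ', Nat.sub_add_cancel (orderOf_pos g), pow_orderOf_eq_one]
    rw [e]
    generalize orderOf g - 1 = k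
    induction k with
    | zero => exact NU_one
    | succ k ih => rw [pow_succ]; exact NU_mul ih hg

variable (F) in
noncomputable def ps : AddChar F ℂ := AddChar.FiniteField.primitiveChar_to_Complex F

lemma ps_prim : (ps F).IsPrimitive := AddChar.FiniteField.primitiveChar_to_Complex_isPrimitive F

lemma ps_inj {b b' : F} (h : ∀ t : F, ps F (t * b) = ps F (t * b')) : b = b' := by
  have h1 := AddChar.sum_mulShift (b - b') (ps_prim (F := F))
  rw [sum_congr rfl (g := fun _ => 1)] at h1
  · by_contra hb
    rw [if_neg (sub_ne_zero.2 hb)] at h1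
    simp at h1
  · intro x _
    rw [mul_sub, AddChar.map_sub_eq_div, h, div_self]
    exact ((AddChar.val_isUnit (ps F) _)).ne_zero

lemma ps_ne (x : F) : ps F x ≠ 0 := ((AddChar.val_isUnit (ps F) _)).ne_zero

noncomputable instance : Fintype (Ut F m) := Fintype.ofFinite _

noncomputable def th : Ut F m →* ℂ where
  toFun v := ps F (-sg 0 v.1.1)
  map_one' := by
    show ps F (-sg 0 (1 : Matrix (Fin m) (Fin m) F)) = 1
    rw [sg_one]; simp
  map_mul' a b := by
    show ps F (-sg 0 (a.1.1 * b.1.1)) = _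
    rw [sg_mul a.2 b.2, neg_add, AddChar.map_add_eq_mul]

/-- image of the Whittaker idempotent -/
noncomputable def Ew (w : Ir F m) : Matrix (Fin ((wd F m).d w)) (Fin ((wd F m).d w)) ℂ :=
  ∑ h : Ut F m, ((Fintype.card (Ut F m) : ℂ)⁻¹ * th h) • ((wd F m).π w h.1)

lemma Ew_idem (w : Ir F m) : Ew w * Ew w = Ew w :=
  theta_idem (((wd F m).π w).comp (Ut F m).subtype) th

lemma th_ps (u : Ut F m) : ps F (sg 0 u.1.1) * th u = 1 := by
  show ps F (sg 0 u.1.1) * ps F (-sg 0 u.1.1) = 1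
  rw [← AddChar.map_add_eq_mul]; simp

lemma theta_l {H A : Type*} [Group H] [Fintype H] [Ring A] [Algebra ℂ A] (T : H →* A)
    (θ : H →* ℂ) (u : H) (c : ℂ) (hc : c * θ u = 1) (b : ℂ) :
    T u * (∑ h, (b * θ h) • T h) = c • (∑ h, (b * θ h) • T h) := by
  rw [mul_sum, smul_sum]
  refine Fintype.sum_equiv (Equiv.mulLeft u) _ _ fun h => ?_
  simp only [Equiv.coe_mulLeft, mul_smul_comm, smul_smul, map_mul]
  congr 1
  linear_combination -b * θ h * hc

lemma theta_r {H A : Type*} [Group H] [Fintype H] [Ring A] [Algebra ℂ A] (T : H →* A)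
    (θ : H →* ℂ) (u : H) (c : ℂ) (hc : c * θ u = 1) (b : ℂ) :
    (∑ h, (b * θ h) • T h) * T u = c • (∑ h, (b * θ h) • T h) := by
  rw [sum_mul, smul_sum]
  refine Fintype.sum_equiv (Equiv.mulRight u) _ _ fun h => ?_
  simp only [Equiv.coe_mulRight, smul_mul_assoc, smul_smul, map_mul]
  congr 1
  linear_combination -b * θ h * hc

lemma Ew_l (w : Ir F m) (u : GL (Fin m) F) (hu : NU 0 u.1) :
    (wd F m).π w u * Ew w = ps F (sg 0 u.1) • Ew w :=
  theta_l (((wd F m).π w).comp (Ut F m).subtype) th ⟨u, hu⟩ _ (th_ps ⟨u, hu⟩) _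

lemma Ew_r (w : Ir F m) (u : GL (Fin m) F) (hu : NU 0 u.1) :
    Ew w * (wd F m).π w u = ps F (sg 0 u.1) • Ew w :=
  theta_r (((wd F m).π w).comp (Ut F m).subtype) th ⟨u, hu⟩ _ (th_ps ⟨u, hu⟩) _

/-! The anti-automorphism -/

def tauM (M : Matrix (Fin m) (Fin m) F) : Matrix (Fin m) (Fin m) F :=
  fun i j => M j.rev i.rev

lemma tauM_mul (M N : Matrix (Fin m) (Fin m) F) : tauM (M * N) = tauM N * tauM M := by
  ext i j
  simp only [tauM, Matrix.mul_apply]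
  refine Fintype.sum_equiv Fin.revPerm _ _ fun k => ?_
  simp [mul_comm]

lemma tauM_one : tauM (1 : Matrix (Fin m) (Fin m) F) = 1 := by
  ext i j
  simp only [tauM, Matrix.one_apply]
  congr 1
  simp [eq_comm]

def tau (g : GL (Fin m) F) : GL (Fin m) F where
  val := tauM g.1
  inv := tauM g⁻¹.1
  val_inv := by rw [← tauM_mul, ← Units.val_mul, inv_mul_cancel, Units.val_one, tauM_one]
  inv_val := by rw [← tauM_mul, ← Units.val_mul, mul_inv_cancel, Units.val_one, tauM_one]

lemma tau_mul (g h : GL (Fin m) F) : tau (g * h) = tau h * tau g := Units.ext (tauM_mul _ _)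

lemma tau_tau (g : GL (Fin m) F) : tau (tau g) = g := by
  refine Units.ext ?_
  ext i j
  show g.1 (i.rev.rev) (j.rev.rev) = g.1 i j
  simp

lemma NU_tau {M : Matrix (Fin m) (Fin m) F} (h : NU 0 M) : NU 0 (tauM M) := by
  intro i j hij
  have hij : j ≤ i := by omega
  show M j.rev i.rev = _
  rw [h _ _ (Or.inr (by simpa using hij))]
  congr 1
  simp [eq_comm]

lemma sg_tau (M : Matrix (Fin m) (Fin m) F) : sg 0 (tauM M) = sg 0 M := by
  simp only [sg]
  rw [sum_comm]
  refine Fintype.sum_equiv Fin.revPerm _ _ fun i => Fintype.sum_equiv Fin.revPerm _ _ fun j => ?_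
  simp only [tauM, Fin.revPerm_apply]
  congr 1
  simp only [Fin.val_rev, eq_iff_iff]
  omega

/-- the key property for the Gelfand trick -/
def QT (w : Ir F m) (g : GL (Fin m) F) : Prop :=
  Ew w * (wd F m).π w g * Ew w = Ew w * (wd F m).π w (tau g) * Ew w

lemma E_trans (w : Ir F m) (g u v : GL (Fin m) F) (hu : NU 0 u.1) (hv : NU 0 v.1) :
    Ew w * (wd F m).π w (u * g * v) * Ew w = (ps F (sg 0 u.1) * ps F (sg 0 v.1)) • (Ew w * (wd F m).π w g * Ew w) := by
  rw [map_mul, map_mul]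
  calc _ = (Ew w * (wd F m).π w u) * (wd F m).π w g * ((wd F m).π w v * Ew w) := by
        simp only [mul_assoc]
    _ = _ := by
      rw [Ew_l w v hv, Ew_r w u hu, Matrix.smul_mul, Matrix.smul_mul, Matrix.mul_smul, smul_smul]

lemma QT_trans (w : Ir F m) (g u v : GL (Fin m) F) (hu : NU 0 u.1) (hv : NU 0 v.1) (h : QT w g) :
    QT w (u * g * v) := by
  rw [QT, E_trans w g u v hu hv, h, tau_mul, tau_mul, ← mul_assoc,
    E_trans w (tau g) (tau v) (tau u) (NU_tau hv) (NU_tau hu)]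
  show _ = (ps F (sg 0 (tauM v.1)) * ps F (sg 0 (tauM u.1))) • _
  rw [sg_tau, sg_tau, mul_comm (ps F (sg 0 v.1))]

lemma comm_of_QT (w : Ir F m) (H : ∀ g, QT w g) (g h : GL (Fin m) F) :
    Ew w * (wd F m).π w g * Ew w * (wd F m).π w h * Ew w =
      Ew w * (wd F m).π w h * Ew w * (wd F m).π w g * Ew w := by
  have e : ∀ g h : GL (Fin m) F, Ew w * (wd F m).π w g * Ew w * (wd F m).π w h * Ew w =
      ∑ v : Ut F m, ((Fintype.card (Ut F m) : ℂ)⁻¹ * th v) • (Ew w * (wd F m).π w (g * v.1 * h) * Ew w) := by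
    intro g h
    have : Ew w * (wd F m).π w g * Ew w * (wd F m).π w h * Ew w = (Ew w * (wd F m).π w g) *
      (∑ h : Ut F m, ((Fintype.card (Ut F m) : ℂ)⁻¹ * th h) • ((wd F m).π w h.1)) * ((wd F m).π w h * Ew w) := by
      rw [← Ew]; simp only [mul_assoc]
    rw [this, mul_sum, sum_mul]
    refine sum_congr rfl fun v _ => ?_
    rw [Matrix.mul_smul, Matrix.smul_mul, map_mul, map_mul]
    simp only [mul_assoc]
  have e2 : ∀ g : GL (Fin m) F, Ew w * (wd F m).π w g * Ew w = Ew w * (wd F m).π w (tau g) * Ew w := H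
  have e3 : Ew w * (wd F m).π w h * Ew w * (wd F m).π w g * Ew w =
      (Ew w * (wd F m).π w (tau h) * Ew w) * ((wd F m).π w (tau g) * Ew w) := by
    rw [← e2]
    have : Ew w * (wd F m).π w h * Ew w = Ew w * (wd F m).π w h * Ew w * Ew w := by
      rw [mul_assoc _ (Ew w) (Ew w), Ew_idem]
    calc _ = (Ew w * (wd F m).π w h * Ew w) * (Ew w * (wd F m).π w g * Ew w) := by
          rw [← mul_assoc, ← mul_assoc, mul_assoc _ (Ew w) (Ew w), Ew_idem]
      _ = (Ew w * (wd F m).π w h * Ew w) * (Ew w * (wd F m).π w (tau g) * Ew w) := by rw [e2 g]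
      _ = (Ew w * (wd F m).π w h * Ew w * Ew w) * ((wd F m).π w (tau g) * Ew w) := by
          simp only [mul_assoc]
      _ = _ := by rw [← this]
  rw [e3, ← mul_assoc, e, e]
  refine Fintype.sum_equiv (⟨fun v => ⟨tau v.1, NU_tau v.2⟩, fun v => ⟨tau v.1, NU_tau v.2⟩,
    fun v => Subtype.ext (tau_tau _), fun v => Subtype.ext (tau_tau _)⟩ : Ut F m ≃ Ut F m) _ _ fun v => ?_
  rw [e2, tau_mul, tau_mul, ← mul_assoc]
  show _ = ((Fintype.card (Ut F m) : ℂ)⁻¹ * ps F (-sg 0 (tauM v.1.1))) • _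
  rw [sg_tau]
  rfl

lemma Ew_trace (w : Ir F m) (H : ∀ g, QT w g) : ∃ k : ℕ, (Ew w).trace = k ∧ k ≤ 1 := by
  obtain ⟨k, hk⟩ := trace_idem (Ew w) (Ew_idem w)
  refine ⟨k, hk, ?_⟩
  have h := trace_le (Ew w) (Ew_idem w) ?_
  · rw [hk] at h
    have h : k ^ 3 = k := by exact_mod_cast h
    by_contra h2
    push Not at h2
    have : k ^ 1 < k ^ 3 := Nat.pow_lt_pow_right h2 (by omega)
    rw [h, pow_one] at this
    exact lt_irrefl _ this
  · intro M N
    obtain ⟨a, rfl⟩ := (wd F m).π_span w M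
    obtain ⟨b, rfl⟩ := (wd F m).π_span w N
    simp only [mul_sum, sum_mul, Matrix.mul_smul, Matrix.smul_mul]
    rw [sum_comm]
    refine sum_congr rfl fun g _ => sum_congr rfl fun h _ => ?_
    rw [comm_of_QT w H, smul_comm]
end
end TCV

open scoped MatrixGroups
namespace TCV
open Finset
set_option linter.unusedSectionVars false
set_option linter.unusedSimpArgs false
set_option linter.unusedVariables false

section
variable {F : Type} [Field F] [Fintype F] [DecidableEq F] {m : ℕ}

lemma NU_gl {M : Matrix (Fin m) (Fin m) F} (h : NU 0 M) : ∃ u : GL (Fin m) F, u.1 = M := by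
  have : IsUnit M := by rw [Matrix.isUnit_iff_isUnit_det, NU_det h]; exact isUnit_one
  exact this

lemma NU_inv {u : GL (Fin m) F} (h : NU 0 u.1) : NU 0 u⁻¹.1 := (Ut F m).inv_mem h

/-- rows from `r` on are monomial -/
def Inv (r : ℕ) (g : Matrix (Fin m) (Fin m) F) : Prop :=
  ∀ i : Fin m, r ≤ i → ∃ p, g i p ≠ 0 ∧ (∀ q, q ≠ p → g i q = 0) ∧ ∀ k, k ≠ i → g k p = 0

lemma bruhat_step (g : GL (Fin m) F) (i : Fin m) (h : Inv (i + 1) g.1) :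
    ∃ u v : GL (Fin m) F, NU 0 u.1 ∧ NU 0 v.1 ∧ Inv i (u * g * v).1 := by
  -- leftmost nonzero column of row i
  have hex : ∃ p, g.1 i p ≠ 0 := by
    by_contra hh
    push Not at hh
    have h1 : (g.1 * g⁻¹.1) i i = 1 := by
      rw [← Units.val_mul, mul_inv_cancel, Units.val_one, Matrix.one_apply_eq]
    rw [Matrix.mul_apply, sum_eq_zero] at h1
    · exact zero_ne_one h1
    · intro k _; rw [hh k, zero_mul]
  obtain ⟨p, hp, hmin⟩ : ∃ p, g.1 i p ≠ 0 ∧ ∀ q, q < p → g.1 i q = 0 := by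
    have hne : (univ.filter fun p => g.1 i p ≠ 0).Nonempty := by
      obtain ⟨p, hp⟩ := hex
      exact ⟨p, by simpa using hp⟩
    refine ⟨(univ.filter fun p => g.1 i p ≠ 0).min' hne, ?_, ?_⟩
    · have := min'_mem _ hne
      simpa using this
    · intro q hq
      by_contra hq0
      exact absurd (min'_le (univ.filter fun p => g.1 i p ≠ 0) q (by simpa using hq0)) (not_le.2 hq)
  -- the right factor
  let V : Matrix (Fin m) (Fin m) F := fun a b =>
    if a = b then 1 else if a = p then - g.1 i b / g.1 i p else 0
  have hV : NU 0 V := by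
    intro a b hab
    show (if a = b then 1 else if a = p then - g.1 i b / g.1 i p else 0) = _
    split_ifs with h1 h2
    · rfl
    · rw [hmin b (by rw [← h2]; omega)]; simp
    · rfl
  obtain ⟨v, hv⟩ := NU_gl hV
  let U : Matrix (Fin m) (Fin m) F := fun a b =>
    if a = b then 1 else if b = i ∧ a < i then - g.1 a p / g.1 i p else 0
  have hU : NU 0 U := by
    intro a b hab
    show (if a = b then 1 else if b = i ∧ a < i then - g.1 a p / g.1 i p else 0) = _
    split_ifs with h1 h2
    · rfl
    · omega
    · rfl
  obtain ⟨u, hu⟩ := NU_gl hU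
  have gv : ∀ k q, (g.1 * v.1) k q = g.1 k q - (if q = p then 0 else g.1 k p * (g.1 i q / g.1 i p)) := by
    intro k q
    rw [hv, Matrix.mul_apply]
    by_cases hq : q = p
    · subst hq
      rw [if_pos rfl, sum_eq_single q]
      · simp [V]
      · intro b _ hb
        simp [V, hb]
      · simp
    · rw [if_neg hq, Fintype.sum_eq_add q p hq]
      · have : p ≠ q := fun h => hq h.symm
        simp [V, this]
        ring
      · rintro b ⟨h1, h2⟩
        simp [V, h1, h2]
  have ug : ∀ k q, (u.1 * (g.1 * v.1)) k q = (g.1 * v.1) k q - (if k < i then g.1 k p / g.1 i p * (g.1 * v.1) i q else 0) := by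
    intro k q
    rw [hu, Matrix.mul_apply]
    by_cases hk : k < i
    · rw [if_pos hk, Fintype.sum_eq_add k i (ne_of_lt hk)]
      · simp [U, hk, ne_of_lt hk]
        ring
      · rintro b ⟨h1, h2⟩
        have : k ≠ b := fun h => h1 h.symm
        simp [U, this, h2]
    · rw [if_neg hk, sum_eq_single k]
      · simp [U]
      · intro b _ hb
        have : k ≠ b := fun h => hb h.symm
        simp [U, this, hk]
      · simp
  refine ⟨u, v, hu ▸ hU, hv ▸ hV, ?_⟩
  have e : (u * g * v).1 = u.1 * (g.1 * v.1) := by rw [Units.val_mul, Units.val_mul, mul_assoc]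
  rw [e]
  -- facts about lower rows
  have low : ∀ k : Fin m, i < k → g.1 k p = 0 := by
    intro k hk
    obtain ⟨r, h1, h2, h3⟩ := h k (by omega)
    refine h2 p fun hpr => ?_
    subst hpr
    exact hp (h3 i (ne_of_lt hk))
  have rowi : ∀ q, q ≠ p → (g.1 * v.1) i q = 0 := by
    intro q hq
    rw [gv, if_neg hq]
    field_simp
    ring
  have gip : (g.1 * v.1) i p = g.1 i p := by rw [gv, if_pos rfl, sub_zero]
  intro k hk
  rcases eq_or_lt_of_le hk with hk | hk
  · have : k = i := Fin.ext hk.symm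
    subst this
    refine ⟨p, ?_, ?_, ?_⟩
    · rw [ug, if_neg (lt_irrefl _), sub_zero, gip]; exact hp
    · intro q hq
      rw [ug, if_neg (lt_irrefl _), sub_zero, rowi q hq]
    · intro l hl
      rw [ug]
      by_cases hlk : l < k
      · rw [if_pos hlk, gip, gv, if_pos rfl]
        field_simp
        ring
      · rw [if_neg hlk, gv, if_pos rfl, low l (by omega)]; simp
  · obtain ⟨r, h1, h2, h3⟩ := h k (by omega)
    have hrp : r ≠ p := fun hh => h1 (by rw [hh]; exact low k hk)
    have hnk : ¬ k < i := by omega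
    have hir : g.1 i r = 0 := h3 i (by omega)
    refine ⟨r, ?_, ?_, ?_⟩
    · rw [ug, if_neg hnk, gv, if_neg hrp, hir]
      simpa using h1
    · intro q hq
      rw [ug, if_neg hnk, gv, h2 q hq, low k hk]
      simp
    · intro l hl
      rw [ug, rowi r hrp, gv, if_neg hrp, hir, h3 l hl]
      simp

lemma NU_tv {i j : Fin m} (hij : i < j) (t : F) : NU 0 (Matrix.transvection i j t) := by
  intro a b hab
  have : ¬ (i = a ∧ j = b) := by omega
  rw [Matrix.transvection, Matrix.add_apply, Matrix.single_apply, if_neg this, add_zero, Matrix.one_apply]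

lemma sg_tv {i j : Fin m} (hij : i < j) (t : F) :
    sg 0 (Matrix.transvection i j t) = if (i : ℕ) + 1 = j then t else 0 := by
  have e : ∀ a b : Fin m, (if (a : ℕ) + 1 = b ∧ 0 < (b : ℕ) then Matrix.transvection i j t a b else 0) =
      if a = i then (if b = j then (if (i : ℕ) + 1 = j then t else 0) else 0) else 0 := by
    intro a b
    rw [Matrix.transvection, Matrix.add_apply, Matrix.single_apply, Matrix.one_apply]
    by_cases h1 : a = i
    · by_cases h2 : b = j
      · subst h1 h2
        have : a ≠ b := by omega
        have h0 : 0 < (b : ℕ) := by omega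
        simp [this, h0]
      · have h2' : ¬ j = b := fun h => h2 h.symm
        by_cases h3 : a = b
        · have : ¬ ((a : ℕ) + 1 = b ∧ 0 < (b : ℕ)) := by omega
          simp only [if_neg this, if_neg h2]; simp
        · simp [h2, h2', h3]
    · have h1' : ¬ i = a := fun h => h1 h.symm
      by_cases h3 : a = b
      · have : ¬ ((a : ℕ) + 1 = b ∧ 0 < (b : ℕ)) := by omega
        simp only [if_neg this, if_neg h1]
      · simp [h1, h1', h3]
  simp only [sg, e]
  simp

lemma QT_mono' (w : Ir F m) (g : GL (Fin m) F) (h : Inv 0 g.1)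
    (hne : Ew w * (wd F m).π w g * Ew w ≠ 0) : tau g = g := by
  choose p hp hrow hcol using fun i => h i (Nat.zero_le _)
  let b : Fin m → F := fun i => g.1 i (p i)
  have hg : ∀ i j, g.1 i j = if p i = j then b i else 0 := by
    intro i j
    split_ifs with hh
    · rw [← hh]
    · exact hrow i j fun h => hh h.symm
  have inj : Function.Injective p := by
    intro i k hik
    by_contra hh
    exact hp k (by rw [← hik]; exact hcol i k fun h => hh h.symm)
  have key : ∀ x y : Fin m, (y : ℕ) = x + 1 → p x < p y → (p x : ℕ) + 1 = p y ∧ b x = b y := by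
    intro x y hxy hlt
    have hxy' : x < y := by omega
    have h1 : ∀ t : F, ps F (t * 1) = ps F (t * if (p x : ℕ) + 1 = p y then b y / b x else 0) := by
      intro t
      obtain ⟨u, hu⟩ := NU_gl (NU_tv hxy' t)
      obtain ⟨v, hv⟩ := NU_gl (NU_tv hlt (t * (b y / b x)))
      have huv : u * g * 1 = 1 * g * v := by
        rw [mul_one, one_mul]
        refine Units.ext ?_
        rw [Units.val_mul, Units.val_mul, hu, hv, Matrix.transvection, Matrix.transvection, add_mul, mul_add,
          one_mul, mul_one]
        congr 1
        ext i j
        rw [Matrix.mul_apply, Matrix.mul_apply, sum_eq_single y, sum_eq_single (p x), Matrix.single_apply,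
          Matrix.single_apply, hg, hg]
        · by_cases hi : x = i
          · subst hi
            by_cases hj : p y = j
            · have : b x ≠ 0 := hp x
              simp [hj]
              field_simp
            · simp [hj]
          · have : p i ≠ p x := fun hh => hi (inj hh).symm
            simp [hi, this]
        · intro k _ hk
          rw [Matrix.single_apply_of_row_ne hk.symm, mul_zero]
        · simp
        · intro k _ hk
          rw [Matrix.single_apply_of_col_ne _ _ hk.symm, zero_mul]
        · simp
      have e1 := E_trans w g u 1 (hu ▸ NU_tv hxy' t) NU_one
      have e2 := E_trans w g 1 v NU_one (hv ▸ NU_tv hlt _)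
      rw [huv, e2] at e1
      have e3 := smul_left_injective ℂ hne e1
      simp only [Units.val_one, sg_one, hu, hv, sg_tv hxy', sg_tv hlt, if_pos hxy.symm, AddChar.map_zero_eq_one,
        one_mul, mul_one] at e3
      rw [mul_one, ← e3]
      congr 1
      split_ifs <;> simp
    have h2 := ps_inj h1
    by_cases h3 : (p x : ℕ) + 1 = p y
    · rw [if_pos h3] at h2
      refine ⟨h3, ?_⟩
      have : b x ≠ 0 := hp x
      field_simp at h2
      exact h2
    · rw [if_neg h3] at h2
      exact absurd h2 one_ne_zero
  have lay := layered_fin (fun i => (p i).rev) b (fun i k hik => inj (Fin.rev_injective hik)) (by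
    intro x y hxy hlt
    have := key x y hxy (by simpa using hlt)
    refine ⟨?_, this.2⟩
    simp only [Fin.val_rev]
    omega)
  refine Units.ext ?_
  ext i j
  show g.1 j.rev i.rev = g.1 i j
  rw [hg, hg]
  by_cases hh : p i = j
  · have l1 := lay i
    rw [hh] at l1
    rw [if_pos hh, if_pos, l1.2]
    rw [← l1.1, Fin.rev_rev]
  · rw [if_neg hh, if_neg]
    intro h2
    apply hh
    have l1 := lay j.rev
    simp only [h2, Fin.rev_rev] at l1
    have := congrArg Fin.rev l1.1
    simpa using this

lemma Inv_tau (g : GL (Fin m) F) (h : Inv 0 g.1) : Inv 0 (tau g).1 := by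
  choose p hp hrow hcol using fun i => h i (Nat.zero_le _)
  have inj : Function.Injective p := by
    intro i k hik
    by_contra hh
    exact hp k (by rw [← hik]; exact hcol i k fun h => hh h.symm)
  intro i _
  obtain ⟨k, hk⟩ := Finite.injective_iff_surjective.1 inj i.rev
  refine ⟨k.rev, ?_, ?_, ?_⟩
  · show g.1 k.rev.rev i.rev ≠ 0
    rw [Fin.rev_rev, ← hk]; exact hp k
  · intro q hq
    show g.1 q.rev i.rev = 0
    rw [← hk]
    exact hcol k _ fun hh => hq (by rw [← hh, Fin.rev_rev])
  · intro l hl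
    show g.1 k.rev.rev l.rev = 0
    rw [Fin.rev_rev]
    exact hrow k _ fun hh => hl (Fin.rev_injective (by rw [hh, hk]))

lemma QT_mono (w : Ir F m) (g : GL (Fin m) F) (h : Inv 0 g.1) : QT w g := by
  rw [QT]
  by_cases h1 : Ew w * (wd F m).π w g * Ew w = 0
  · by_cases h2 : Ew w * (wd F m).π w (tau g) * Ew w = 0
    · rw [h1, h2]
    · have := QT_mono' w (tau g) (Inv_tau g h) h2
      rw [tau_tau] at this
      rw [← this]
  · rw [QT_mono' w g h h1]

lemma QT_all (w : Ir F m) (g : GL (Fin m) F) : QT w g := by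
  have key : ∀ r ≤ m, ∀ g : GL (Fin m) F, Inv r g.1 → QT w g := by
    intro r
    induction r with
    | zero => intro _ g hg; exact QT_mono w g hg
    | succ r ih =>
      intro hr g hg
      obtain ⟨u, v, hu, hv, hI⟩ := bruhat_step g ⟨r, by omega⟩ hg
      have h1 := QT_trans w _ u⁻¹ v⁻¹ (NU_inv hu) (NU_inv hv) (ih (by omega) _ hI)
      simpa [mul_assoc] using h1
  exact key m le_rfl g fun i hi => absurd i.2 (by omega)

/-- multiplicity of the Whittaker functional -/
noncomputable def gm (w : Ir F m) : ℕ := (Ew_trace w (QT_all w)).choose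

lemma gm_eq (w : Ir F m) : (Ew w).trace = gm w := (Ew_trace w (QT_all w)).choose_spec.1
lemma gm_le (w : Ir F m) : gm w ≤ 1 := (Ew_trace w (QT_all w)).choose_spec.2
end
end TCV

open scoped MatrixGroups
namespace TCV
open Finset
set_option linter.unusedSectionVars false
set_option linter.unusedSimpArgs false
set_option linter.unusedVariables false

section
variable {F : Type} [Field F] [Fintype F] [DecidableEq F] {m : ℕ}

variable (F m) in
open Classical in
noncomputable def NF (c : ℕ) : Finset (Matrix (Fin m) (Fin m) F) := univ.filter (NU c)

lemma mem_NF {c : ℕ} {M : Matrix (Fin m) (Fin m) F} : M ∈ NF F m c ↔ NU c M := by simp [NF]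

lemma sum_Ut {A : Type*} [AddCommMonoid A] (f : Matrix (Fin m) (Fin m) F → A) :
    ∑ h : Ut F m, f h.1.1 = ∑ M ∈ NF F m 0, f M := by
  refine sum_bij (fun h _ => h.1.1) (fun h _ => mem_NF.2 h.2) ?_ ?_ (fun _ _ => rfl)
  · intro a _ b _ hab; exact Subtype.ext (Units.ext hab)
  · intro M hM
    obtain ⟨u, hu⟩ := NU_gl (mem_NF.1 hM)
    exact ⟨⟨u, by rw [← hu] at hM; exact mem_NF.1 hM⟩, mem_univ _, hu⟩

lemma card_Ut : Fintype.card (Ut F m) = #(NF F m 0) := by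
  have := sum_Ut (F := F) (m := m) (fun _ => 1)
  simpa using this

lemma gm_sum (w : Ir F m) : (#(NF F m 0) : ℂ) * gm w = ∑ M ∈ NF F m 0, ps F (-sg 0 M) * chm w M := by
  have h0 : (Fintype.card (Ut F m) : ℂ) ≠ 0 := by exact_mod_cast Fintype.card_ne_zero
  rw [← gm_eq, Ew, Matrix.trace_sum, ← sum_Ut, ← card_Ut, mul_sum]
  refine sum_congr rfl fun h _ => ?_
  rw [Matrix.trace_smul, smul_eq_mul, chm_coe, mul_assoc, mul_inv_cancel_left₀ h0]
  rfl

/-! block matrices -/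
variable {c k : ℕ}

def Bm (u : Matrix (Fin c) (Fin k) F) (v : Matrix (Fin k) (Fin k) F) : Matrix (Fin (c + k)) (Fin (c + k)) F :=
  fun i j => Fin.addCases (fun i' => Fin.addCases (fun j' => if i' = j' then 1 else 0) (fun j' => u i' j') j)
    (fun i' => Fin.addCases (fun _ => 0) (fun j' => v i' j') j) i

lemma Bm_ll (u : Matrix (Fin c) (Fin k) F) (v : Matrix (Fin k) (Fin k) F) (i j : Fin c) :
    Bm u v (Fin.castAdd k i) (Fin.castAdd k j) = if i = j then 1 else 0 := by simp [Bm]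
lemma Bm_lr (u : Matrix (Fin c) (Fin k) F) (v : Matrix (Fin k) (Fin k) F) (i : Fin c) (j : Fin k) :
    Bm u v (Fin.castAdd k i) (Fin.natAdd c j) = u i j := by simp [Bm]
lemma Bm_rl (u : Matrix (Fin c) (Fin k) F) (v : Matrix (Fin k) (Fin k) F) (i : Fin k) (j : Fin c) :
    Bm u v (Fin.natAdd c i) (Fin.castAdd k j) = 0 := by simp [Bm]
lemma Bm_rr (u : Matrix (Fin c) (Fin k) F) (v : Matrix (Fin k) (Fin k) F) (i : Fin k) (j : Fin k) :
    Bm u v (Fin.natAdd c i) (Fin.natAdd c j) = v i j := by simp [Bm]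

lemma Bm_NU (u : Matrix (Fin c) (Fin k) F) (v : Matrix (Fin k) (Fin k) F) (hv : NU 0 v) : NU c (Bm u v) := by
  intro i j
  refine Fin.addCases (fun i => ?_) (fun i => ?_) i <;> refine Fin.addCases (fun j => ?_) (fun j => ?_) j
  · intro _; rw [Bm_ll]; simp
  · intro h; exfalso; simp [Fin.le_def] at h; omega
  · intro _; rw [Bm_rl, if_neg]; simp [Fin.ext_iff]; omega
  · intro h; rw [Bm_rr, hv _ _ (Or.inr (by rw [Fin.le_def]; simp only [Fin.le_def, Fin.val_natAdd] at h; omega))]; simp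

lemma Bm_sg (u : Matrix (Fin c) (Fin k) F) (v : Matrix (Fin k) (Fin k) F) : sg c (Bm u v) = sg 0 v := by
  simp only [sg, Fin.sum_univ_add, Bm_ll, Bm_lr, Bm_rl, Bm_rr]
  rw [sum_eq_zero, zero_add]
  · refine sum_congr rfl fun i _ => ?_
    rw [sum_eq_zero, zero_add]
    · refine sum_congr rfl fun j _ => ?_
      congr 1
      simp only [Fin.val_natAdd, eq_iff_iff]
      omega
    · intro j _; simp
  · intro i _
    rw [sum_eq_zero, sum_eq_zero, zero_add]
    · intro j _; rw [if_neg]; simp only [Fin.val_natAdd, Fin.val_castAdd]; omega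
    · intro j _; rw [if_neg]; simp only [Fin.val_castAdd]; omega

variable (F c k) in
noncomputable def fr : (Fin (c + k) → F) ≃ₗ[F] (Fin c → F) × (Fin k → F) where
  toFun x := (fun i => x (Fin.castAdd k i), fun j => x (Fin.natAdd c j))
  invFun p := Fin.addCases p.1 p.2
  map_add' x y := rfl
  map_smul' a x := rfl
  left_inv x := by
    funext i
    refine Fin.addCases (fun i => ?_) (fun i => ?_) i <;> simp
  right_inv p := by simp

lemma Bm_X {m : ℕ} (w : Ir F (c + k)) (u : Matrix (Fin c) (Fin k) F) (v : Matrix (Fin k) (Fin k) F) :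
    X w ((Fin c → F) × (Fin k → F)) (bl (tl 1) (Matrix.toLin' u) (Matrix.toLin' v)) = chm w (Bm u v) := by
  rw [X_frame w _ (fr F c k)]
  congr 1
  apply Matrix.toLin'.injective
  rw [Matrix.toLin'_toMatrix']
  refine LinearMap.ext fun x => ?_
  rw [LinearMap.comp_apply, LinearMap.comp_apply, LinearEquiv.coe_coe, LinearEquiv.symm_apply_eq, bl_apply, tl_one]
  refine Prod.ext ?_ ?_
  · funext i
    show x (Fin.castAdd k i) + (u.mulVec fun j => x (Fin.natAdd c j)) i = (Bm u v).mulVec x (Fin.castAdd k i)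
    simp only [Matrix.mulVec, dotProduct, Fin.sum_univ_add, Bm_ll, Bm_lr]
    simp
  · funext i
    show (v.mulVec fun j => x (Fin.natAdd c j)) i = (Bm u v).mulVec x (Fin.natAdd c i)
    simp only [Matrix.mulVec, dotProduct, Fin.sum_univ_add, Bm_rl, Bm_rr]
    simp

lemma sum_NF_block {A : Type*} [AddCommMonoid A] (f : Matrix (Fin (c + k)) (Fin (c + k)) F → A) :
    ∑ M ∈ NF F (c + k) c, f M = ∑ v ∈ NF F k 0, ∑ u : Matrix (Fin c) (Fin k) F, f (Bm u v) := by
  rw [← sum_product']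
  symm
  refine sum_bij (fun p _ => Bm p.2 p.1) ?_ ?_ ?_ (fun _ _ => rfl)
  · intro p hp
    exact mem_NF.2 (Bm_NU _ _ (mem_NF.1 (mem_product.1 hp).1))
  · intro p _ p' _ h
    refine Prod.ext ?_ ?_
    · ext i j
      have := congrFun (congrFun h (Fin.natAdd c i)) (Fin.natAdd c j)
      rwa [Bm_rr, Bm_rr] at this
    · ext i j
      have := congrFun (congrFun h (Fin.castAdd k i)) (Fin.natAdd c j)
      rwa [Bm_lr, Bm_lr] at this
  · intro M hM
    rw [mem_NF] at hM
    refine ⟨(fun i j => M (Fin.natAdd c i) (Fin.natAdd c j), fun i j => M (Fin.castAdd k i) (Fin.natAdd c j)), ?_, ?_⟩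
    · refine mem_product.2 ⟨mem_NF.2 ?_, mem_univ _⟩
      intro i j hij
      have := hM (Fin.natAdd c i) (Fin.natAdd c j) (Or.inr (by rw [Fin.le_def] at hij ⊢; simp only [Fin.val_natAdd]; omega))
      simpa using this
    · ext i j
      refine Fin.addCases (fun i => ?_) (fun i => ?_) i <;> refine Fin.addCases (fun j => ?_) (fun j => ?_) j
      · rw [Bm_ll, hM _ _ (Or.inl (by simp))]; simp
      · rw [Bm_lr]
      · rw [Bm_rl, hM _ _ (Or.inl (by simp)), if_neg]; simp [Fin.ext_iff]; omega
      · rw [Bm_rr]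

/-- the level `c` Whittaker sum -/
noncomputable def Zc {m : ℕ} (w : Ir F m) (c k : ℕ) : ℂ :=
  ∑ a : Ir F c, ∑ b : Ir F k, cc a b w * ((wd F c).d a * gm b)

lemma S_zero (w : Ir F (c + k)) :
    ∑ M ∈ NF F (c + k) c, ps F (-sg c M) * chm w M = #(NF F (c + k) c) * Zc w c k := by
  have hcard : #(NF F (c + k) c) = #(NF F k 0) * Fintype.card (Matrix (Fin c) (Fin k) F) := by
    have := sum_NF_block (F := F) (c := c) (k := k) (fun _ => 1)
    simpa using this
  have hH : Fintype.card (Matrix (Fin c) (Fin k) F) = Fintype.card ((Fin k → F) →ₗ[F] (Fin c → F)) :=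
    Fintype.card_congr Matrix.toLin'.toEquiv
  have h0 : (Fintype.card ((Fin k → F) →ₗ[F] (Fin c → F)) : ℂ) ≠ 0 := by exact_mod_cast Fintype.card_ne_zero
  have h1 : ∀ v ∈ NF F k 0, ∑ u : Matrix (Fin c) (Fin k) F, ps F (-sg c (Bm u v)) * chm w (Bm u v) =
      Fintype.card (Matrix (Fin c) (Fin k) F) *
        ∑ a : Ir F c, ∑ b : Ir F k, cc a b w * (wd F c).d a * (ps F (-sg 0 v) * chm b v) := by
    intro v hv
    obtain ⟨g, rfl⟩ := NU_gl (mem_NF.1 hv)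
    have h2 := Dl_std w (1 : GL (Fin c) F) g
    rw [Dl, div_eq_iff h0] at h2
    rw [hH]
    simp only [Bm_sg]
    rw [← mul_sum]
    have h3 : ∑ u : Matrix (Fin c) (Fin k) F, chm w (Bm u g.1) = ∑ u : (Fin k → F) →ₗ[F] (Fin c → F),
        X w ((Fin c → F) × (Fin k → F)) (bl (tl 1) u (tl g)) := by
      refine Fintype.sum_equiv Matrix.toLin'.toEquiv _ _ fun u => ?_
      exact (Bm_X (m := 0) w u g.1).symm
    rw [h3, h2, mul_comm _ (Fintype.card _ : ℂ), mul_left_comm, mul_sum]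
    congr 1
    refine sum_congr rfl fun a _ => ?_
    rw [mul_sum]
    refine sum_congr rfl fun b _ => ?_
    rw [WD.χ_one, chm_coe]; ring
  rw [sum_NF_block, sum_congr rfl h1, ← mul_sum, hcard, sum_comm, Zc]
  push_cast
  rw [mul_comm (#(NF F k 0) : ℂ), mul_assoc]
  congr 1
  rw [mul_sum]
  refine sum_congr rfl fun a _ => ?_
  rw [sum_comm, mul_sum]
  refine sum_congr rfl fun b _ => ?_
  rw [← mul_sum, ← gm_sum]; ring
end
end TCV

open scoped MatrixGroups
namespace TCV
open Finset
set_option linter.unusedSectionVars false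
set_option linter.unusedSimpArgs false
set_option linter.unusedVariables false

section
variable {F : Type} [Field F] [Fintype F] [DecidableEq F] {m : ℕ}

/-- sum over the unipotent group with a general linear character on column `c` -/
noncomputable def Sη (w : Ir F m) (c : Fin m) (η : Fin m → F) : ℂ :=
  ∑ M ∈ NF F m c, ps F (-(sg c M + ∑ i, η i * M i c)) * chm w M

variable (F) in
def Het (c : Fin m) : Finset (Fin m → F) :=
  Fintype.piFinset fun i => if i < c then univ else {0}

lemma mem_Het {c : Fin m} {η : Fin m → F} : η ∈ Het F c ↔ ∀ i, c ≤ i → η i = 0 := by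
  rw [Het, Fintype.mem_piFinset]
  refine forall_congr' fun i => ?_
  by_cases h : i < c
  · simp [h, not_le.2 h]
  · simp [h, not_lt.1 h]

lemma prod_lt (c : Fin m) (x : ℂ) : ∏ i : Fin m, (if i < c then x else 1) = x ^ (c : ℕ) := by
  rw [prod_ite, prod_const, prod_const_one, mul_one]
  congr 1
  have : (univ.filter fun i : Fin m => i < c) = Iio c := by ext; simp
  rw [this, Fin.card_Iio]

lemma card_Het (c : Fin m) : #(Het F c) = Fintype.card F ^ (c : ℕ) := by
  have h := prod_lt c (Fintype.card F)
  rw [Het, Fintype.card_piFinset]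
  have : (∏ i : Fin m, #(if i < c then (univ : Finset F) else {0}) : ℂ) = (Fintype.card F : ℂ) ^ (c : ℕ) := by
    rw [← h]
    refine prod_congr rfl fun i _ => ?_
    split_ifs <;> simp
  exact_mod_cast this

lemma sum_Het (c : Fin m) (x : Fin m → F) :
    ∑ η ∈ Het F c, ps F (-∑ i, η i * x i) = if ∀ i, i < c → x i = 0 then (Fintype.card F : ℂ) ^ (c : ℕ) else 0 := by
  have h1 : ∀ η : Fin m → F, ps F (-∑ i, η i * x i) = ∏ i, ps F (η i * (-x i)) := by
    intro η
    have h0 : ∀ (S : Finset (Fin m)) (f : Fin m → F), ps F (∑ i ∈ S, f i) = ∏ i ∈ S, ps F (f i) := by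
      intro S f
      induction S using Finset.induction_on with
      | empty => simp
      | insert a S ha ih => rw [sum_insert ha, prod_insert ha, AddChar.map_add_eq_mul, ih]
    rw [← h0, ← sum_neg_distrib]
    simp
  simp_rw [h1]
  have h5 := prod_univ_sum (fun i : Fin m => if i < c then (univ : Finset F) else {0}) (fun i t => ps F (t * (-x i)))
  rw [Het, ← h5]
  have h2 : ∀ i : Fin m, ∑ t ∈ (if i < c then (univ : Finset F) else {0}), ps F (t * (-x i)) =
      if i < c then (if x i = 0 then (Fintype.card F : ℂ) else 0) else 1 := by
    intro i
    split_ifs with h3 h4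
    · simp [h4]
    · rw [AddChar.sum_mulShift _ ps_prim, if_neg (by simpa using h4)]; simp
    · simp
  rw [prod_congr rfl fun i _ => h2 i]
  split_ifs with h
  · rw [← prod_lt]
    refine prod_congr rfl fun i _ => ?_
    split_ifs with h3 h4
    · rfl
    · exact absurd (h i h3) h4
    · rfl
  · push Not at h
    obtain ⟨i, hi, hx⟩ := h
    exact prod_eq_zero (mem_univ i) (by rw [if_pos hi, if_neg hx])

lemma NF_succ (c : Fin m) (M : Matrix (Fin m) (Fin m) F) :
    M ∈ NF F m (c + 1) ↔ M ∈ NF F m c ∧ ∀ i, i < c → M i c = 0 := by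
  rw [mem_NF, mem_NF]
  constructor
  · intro h
    refine ⟨fun i j hij => h i j (by omega), fun i hi => ?_⟩
    rw [h i c (Or.inl (by omega)), if_neg (ne_of_lt hi)]
  · rintro ⟨h1, h2⟩ i j hij
    by_cases hj : j = c
    · subst hj
      by_cases hi : i < j
      · rw [h2 i hi, if_neg (ne_of_lt hi)]
      · exact h1 i j (Or.inr (not_lt.1 hi))
    · exact h1 i j (by omega)

lemma sum_Sη (w : Ir F m) (c : Fin m) :
    ∑ η ∈ Het F c, Sη w c η = (Fintype.card F : ℂ) ^ (c : ℕ) * ∑ M ∈ NF F m (c + 1), ps F (-sg c M) * chm w M := by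
  have h : NF F m (c + 1) = (NF F m c).filter fun M => ∀ i, i < c → M i c = 0 := by
    ext M; rw [NF_succ, mem_filter]
  simp only [Sη]
  rw [sum_comm, h, sum_filter, mul_sum]
  refine sum_congr rfl fun M _ => ?_
  rw [← sum_mul]
  simp_rw [neg_add, AddChar.map_add_eq_mul]
  rw [← mul_sum, sum_Het c (fun i => M i c)]
  split_ifs <;> ring

lemma Sη_conj (w : Ir F m) (c : Fin m) (η : Fin m → F) (hη : η ∈ Het F c) (i : Fin m) (hi : η i ≠ 0) :
    Sη w c η = Sη w c (Pi.single i 1) := by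
  have hic : i < c := by
    by_contra h
    exact hi (mem_Het.1 hη i (not_lt.1 h))
  let H0 : Matrix (Fin m) (Fin m) F := Matrix.updateRow 1 i η
  have hdet : H0.det = η i := by
    rw [← Matrix.cramer_transpose_apply, Matrix.transpose_one, Matrix.cramer_one]; rfl
  obtain ⟨H, hH⟩ : IsUnit H0 := by
    rw [Matrix.isUnit_iff_isUnit_det, hdet]; exact isUnit_iff_ne_zero.2 hi
  -- entries
  have hrow : ∀ k, k ≠ i → ∀ N : Matrix (Fin m) (Fin m) F, ∀ j, (H.1 * N) k j = N k j := by
    intro k hk N j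
    rw [hH, Matrix.mul_apply, sum_eq_single k]
    · simp [H0, hk]
    · intro b _ hb
      simp [H0, hk, Matrix.one_apply, hb.symm]
    · simp
  have hcol : ∀ j, c ≤ j → ∀ N : Matrix (Fin m) (Fin m) F, ∀ k, (N * H.1) k j = N k j := by
    intro j hj N k
    have h1 : ∀ b, H0 b j = if b = j then 1 else 0 := by
      intro b
      by_cases hb : b = i
      · subst hb
        have : b ≠ j := ne_of_lt (lt_of_lt_of_le hic hj)
        simp [H0, this, mem_Het.1 hη j hj]
      · simp [H0, hb, Matrix.one_apply]
    rw [hH, Matrix.mul_apply]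
    simp [h1]
  have hiN : ∀ N : Matrix (Fin m) (Fin m) F, ∀ j, (H.1 * N) i j = ∑ k, η k * N k j := by
    intro N j
    rw [hH, Matrix.mul_apply]
    simp [H0]
  have hHi : ∀ k, k ≠ i → ∀ j, H⁻¹.1 k j = if k = j then 1 else 0 := by
    intro k hk j
    rw [← hrow k hk H⁻¹.1 j, ← Units.val_mul, mul_inv_cancel, Units.val_one, Matrix.one_apply]
  let φ : Matrix (Fin m) (Fin m) F → Matrix (Fin m) (Fin m) F := fun M => H.1 * M * H⁻¹.1
  have hφH : ∀ M, φ M * H.1 = H.1 * M := by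
    intro M
    show H.1 * M * H⁻¹.1 * H.1 = _
    rw [mul_assoc, ← Units.val_mul, inv_mul_cancel, Units.val_one, mul_one]
  have hφ1 : ∀ M k j, c ≤ j → φ M k j = (H.1 * M) k j := by
    intro M k j hj
    rw [← hcol j hj (φ M) k, hφH]
  have hφN : ∀ M, NU c M → NU c (φ M) := by
    intro M hM k j hkj
    by_cases hj : c ≤ j
    · have hjk : j ≤ k := by omega
      have hki : k ≠ i := by omega
      rw [hφ1 M k j hj, hrow k hki]
      exact hM k j hkj
    · have hj' : (j : ℕ) < c := by omega
      have h2 : M * H⁻¹.1 = H⁻¹.1 + (M - 1) * H⁻¹.1 := by rw [sub_mul, one_mul]; abel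
      have h3 : ∀ l, ((M - 1) * H⁻¹.1) l j = 0 := by
        intro l
        rw [Matrix.mul_apply]
        refine sum_eq_zero fun b _ => ?_
        by_cases hb : c ≤ b
        · rw [hHi b (by omega), if_neg (by omega), mul_zero]
        · rw [Matrix.sub_apply, hM l b (Or.inl (by omega)), Matrix.one_apply, sub_self, zero_mul]
      show (H.1 * M * H⁻¹.1) k j = _
      rw [mul_assoc, h2, mul_add, ← Units.val_mul, mul_inv_cancel, Units.val_one, Matrix.add_apply, Matrix.one_apply,
        Matrix.mul_apply, sum_eq_zero, add_zero]
      intro l _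
      rw [h3, mul_zero]
  have hinj : Function.Injective φ := by
    intro M N hMN
    have h2 : H.1 * M = H.1 * N := by rw [← hφH, ← hφH, hMN]
    have h3 := congrArg (fun A => H⁻¹.1 * A) h2
    simp only [← mul_assoc, ← Units.val_mul, inv_mul_cancel, Units.val_one, one_mul] at h3
    exact h3
  have himg : (NF F m c).image φ = NF F m c := by
    refine eq_of_subset_of_card_le ?_ ?_
    · intro N hN
      obtain ⟨M, hM, rfl⟩ := mem_image.1 hN
      exact mem_NF.2 (hφN M (mem_NF.1 hM))
    · rw [card_image_of_injective _ hinj]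
  rw [Sη, Sη]
  conv_rhs => rw [← himg]
  rw [sum_image fun a _ b _ h => hinj h]
  refine sum_congr rfl fun M hM => ?_
  have e1 : chm w (φ M) = chm w M := chm_conj w H M
  have e2 : sg c (φ M) = sg c M := by
    refine sum_congr rfl fun a _ => sum_congr rfl fun b _ => ?_
    split_ifs with hab
    · rw [hφ1 M a b (by omega), hrow a (by omega)]
    · rfl
  have e3 : ∑ k, (Pi.single i 1 : Fin m → F) k * φ M k c = ∑ k, η k * M k c := by
    rw [← hiN, ← hφ1 M i c le_rfl, sum_eq_single i]
    · simp
    · intro b _ hb; simp [hb]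
    · simp
  rw [e1, e2, e3]

lemma Sη_ne (w : Ir F m) (c : Fin m) (η : Fin m → F) (hη : η ∈ Het F c) (h0 : η ≠ 0) (i : Fin m) (hi : i < c) :
    Sη w c η = Sη w c (Pi.single i 1) := by
  by_cases h : η i = 0
  · obtain ⟨j, hj⟩ := Function.ne_iff.1 h0
    have hj : η j ≠ 0 := hj
    have hij : j ≠ i := fun hh => hj (hh ▸ h)
    have hmem : η + Pi.single i 1 ∈ Het F c := by
      rw [mem_Het] at hη ⊢
      intro k hk
      have : k ≠ i := by omega
      simp [hη k hk, this]
    rw [Sη_conj w c η hη j hj, ← Sη_conj w c _ hmem j (by simp [hij, hj]), Sη_conj w c _ hmem i (by simp [h])]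
  · exact Sη_conj w c η hη i h

/-- partial Whittaker sums -/
noncomputable def Tc (w : Ir F m) (c : ℕ) : ℂ := ∑ M ∈ NF F m c, ps F (-sg (c - 1) M) * chm w M

lemma Tc_rec (w : Ir F m) (c : Fin m) :
    (Fintype.card F : ℂ) ^ (c : ℕ) * Tc w (c + 1) =
      Sη w c 0 + ((Fintype.card F : ℂ) ^ (c : ℕ) - 1) * Tc w c := by
  have h := sum_Sη w c
  rw [Tc, Nat.add_sub_cancel, ← h, ← add_sum_erase (Het F c) _ (a := 0) (by rw [mem_Het]; intro i _; rfl)]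
  congr 1
  by_cases hc : (c : ℕ) = 0
  · rw [hc, pow_zero, sub_self, zero_mul]
    refine sum_eq_zero fun η hη => ?_
    rw [mem_erase] at hη
    exfalso
    apply hη.1
    funext i
    exact mem_Het.1 hη.2 i (by omega)
  · let i : Fin m := ⟨c - 1, by omega⟩
    have hi : i < c := by show (c : ℕ) - 1 < c; omega
    have h1 : ∀ η ∈ (Het F c).erase 0, Sη w c η = Tc w c := by
      intro η hη
      rw [mem_erase] at hη
      rw [Sη_ne w c η hη.2 hη.1 i hi, Sη, Tc]
      refine sum_congr rfl fun M _ => ?_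
      congr 3
      rw [Fintype.sum_eq_single i (by intro b hb; simp [hb]), Pi.single_eq_same, one_mul]
      have e : ∀ a b : Fin m, (if (a : ℕ) + 1 = b ∧ (c : ℕ) - 1 < b then M a b else 0) =
          (if (a : ℕ) + 1 = b ∧ (c : ℕ) < b then M a b else 0) + (if a = i then (if b = c then M i c else 0) else 0) := by
        intro a b
        by_cases hb : b = c
        · subst hb
          by_cases ha : a = i
          · subst ha
            have e1 : (i : ℕ) + 1 = b ∧ (b : ℕ) - 1 < b := by
              show (b : ℕ) - 1 + 1 = b ∧ (b : ℕ) - 1 < b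
              omega
            simp [e1.1, e1.2]
          · have : ¬ ((a : ℕ) + 1 = b) := fun hh => ha (Fin.ext (by show (a : ℕ) = (b : ℕ) - 1; omega))
            simp [this, ha]
        · have hb' : (b : ℕ) ≠ c := fun hh => hb (Fin.ext hh)
          have : ((a : ℕ) + 1 = b ∧ (c : ℕ) - 1 < b) ↔ ((a : ℕ) + 1 = b ∧ (c : ℕ) < b) := by omega
          simp only [this, hb, if_false, ite_self, add_zero]
      rw [sg, sg]
      simp only [e, sum_add_distrib]
      simp
    rw [sum_congr rfl h1, sum_const, card_erase_of_mem (by rw [mem_Het]; intro i _; rfl), card_Het, nsmul_eq_mul,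
      Nat.cast_sub (Nat.one_le_pow _ _ Fintype.card_pos)]
    push_cast
    rfl

lemma card_NF (c : Fin m) : #(NF F m c) = Fintype.card F ^ (c : ℕ) * #(NF F m (c + 1)) := by
  rw [← card_Het (F := F) c, mul_comm, ← card_product]
  refine card_nbij' (fun M => (fun a b => if b = c then (if a = b then 1 else 0) else M a b, fun i => if i < c then M i c else 0))
    (fun p a b => if b = c ∧ a < c then p.2 a else p.1 a b) ?_ ?_ ?_ ?_
  · intro M hM
    have hM := mem_NF.1 hM
    refine mem_product.2 ⟨mem_NF.2 ?_, mem_Het.2 ?_⟩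
    · intro a b hab
      show (if b = c then (if a = b then 1 else 0) else M a b) = _
      split_ifs with h1 h2 h2
      · rfl
      · rfl
      · rw [hM a b (by omega), if_pos h2]
      · rw [hM a b (by omega), if_neg h2]
    · intro i hi
      exact if_neg (not_lt.2 hi)
  · rintro ⟨M, η⟩ hp
    have hM := mem_NF.1 (mem_product.1 hp).1
    refine mem_NF.2 ?_
    intro a b hab
    show (if b = c ∧ a < c then η a else M a b) = _
    rw [if_neg (by omega)]
    exact hM a b (by omega)
  · intro M hM
    have hM := mem_NF.1 hM
    ext a b
    show (if b = c ∧ a < c then (if a < c then M a c else 0) else (if b = c then (if a = b then 1 else 0) else M a b)) = M a b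
    by_cases hb : b = c
    · subst hb
      by_cases ha : a < b
      · simp [ha]
      · simp [ha, hM a b (Or.inr (not_lt.1 ha))]
    · simp [hb]
  · rintro ⟨M, η⟩ hp
    have hM := mem_NF.1 (mem_product.1 hp).1
    have hη := mem_Het.1 (mem_product.1 hp).2
    refine Prod.ext ?_ ?_
    · ext a b
      show (if b = c then (if a = b then 1 else 0) else (if b = c ∧ a < c then η a else M a b)) = M a b
      by_cases hb : b = c
      · rw [if_pos hb]; exact (hM a b (Or.inl (by omega))).symm
      · simp [hb]
    · funext i
      show (if i < c then (if c = c ∧ i < c then η i else M i c) else 0) = η i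
      by_cases hi : i < c
      · simp [hi]
      · rw [if_neg hi]; exact (hη i (not_lt.1 hi)).symm

lemma NF_ne (c : ℕ) : (#(NF F m c) : ℂ) ≠ 0 := by
  rw [Nat.cast_ne_zero, card_ne_zero]
  exact ⟨1, mem_NF.2 fun i j _ => Matrix.one_apply⟩

lemma Tc_last (w : Ir F m) : Tc w m = (wd F m).d w ∧ #(NF F m m) = 1 := by
  have : NF F m m = {1} := by
    ext M
    rw [mem_NF, mem_singleton]
    constructor
    · intro h; ext i j; rw [h i j (Or.inl j.2), Matrix.one_apply]
    · rintro rfl i j _; exact Matrix.one_apply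
  refine ⟨?_, by rw [this, card_singleton]⟩
  rw [Tc, this, sum_singleton, sg_one, neg_zero, AddChar.map_zero_eq_one, one_mul, ← Units.val_one, chm_coe, WD.χ_one]

lemma W_rec (w : Ir F m) (c : Fin m) :
    Tc w (c + 1) / #(NF F m (c + 1)) = Zc w c (m - c) +
      ((Fintype.card F : ℂ) ^ (c : ℕ) - 1) * (Tc w c / #(NF F m c)) := by
  have h1 := Tc_rec w c
  have h2 : Sη w c 0 = #(NF F m c) * Zc w c (m - c) := by
    have e : Sη w c 0 = ∑ M ∈ NF F m c, ps F (-sg c M) * chm w M := by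
      rw [Sη]; simp
    rw [e]
    have : ∀ k, ∀ hm : m = c + k, ∑ M ∈ NF F m c, ps F (-sg c M) * chm w M = #(NF F m c) * Zc w c k := by
      intro k hm
      generalize (c : ℕ) = c' at hm ⊢
      subst hm
      exact S_zero w
    exact this _ (by omega)
  rw [h2] at h1
  have hn := NF_ne (F := F) (m := m) (c + 1)
  have hq : ((Fintype.card F : ℂ) ^ (c : ℕ)) ≠ 0 := pow_ne_zero _ (by exact_mod_cast Fintype.card_ne_zero)
  have h3 : (#(NF F m c) : ℂ) = (Fintype.card F : ℂ) ^ (c : ℕ) * #(NF F m (c + 1)) := by exact_mod_cast card_NF c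
  rw [h3] at h1 ⊢
  field_simp
  linear_combination h1

lemma gm_main (w : Ir F m) : (Fintype.card F : ℂ) ^ m * (wd F m).d w / ((psi m (Fintype.card F) : ℚ) : ℂ) =
    ∑ c ∈ range (m + 1), Zc w c (m - c) / ((psi c (Fintype.card F) : ℚ) : ℂ) := by
  have hpsi : ∀ c, ((psi c (Fintype.card F) : ℚ) : ℂ) ≠ 0 := fun c => by
    rw [Rat.cast_ne_zero]; exact psi_ne c
  have hs : ∀ c, ((psi (c + 1) (Fintype.card F) : ℚ) : ℂ) = (psi c (Fintype.card F) : ℚ) * ((Fintype.card F : ℂ) ^ (c + 1) - 1) := by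
    intro c; rw [psi_succ]; push_cast; ring
  have key : ∀ c, c < m → Tc w (c + 1) / #(NF F m (c + 1)) / ((psi c (Fintype.card F) : ℚ) : ℂ) =
      ∑ c ∈ range (c + 1), Zc w c (m - c) / ((psi c (Fintype.card F) : ℚ) : ℂ) := by
    intro c
    induction c with
    | zero =>
      intro h
      have := W_rec w ⟨0, h⟩
      simp only [pow_zero, sub_self, zero_mul, add_zero] at this
      rw [this]; simp
    | succ c ih =>
      intro h
      have h1 := W_rec w ⟨c + 1, h⟩
      have h2 := ih (by omega)
      simp only at h1
      have hp := hpsi (c + 1)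
      rw [sum_range_succ, ← h2, h1, add_div, add_comm]
      congr 1
      rw [hs] at hp ⊢
      have := (mul_ne_zero_iff.1 hp)
      have h3 := this.1
      have h4 := this.2
      field_simp
  have hZ : Zc w m (m - m) = (wd F m).d w := by
    rw [Nat.sub_self, Zc]
    have e : ∀ a : Ir F m, ∑ b : Ir F 0, cc a b w * (((wd F m).d a : ℂ) * gm b) =
        if a = w then ((wd F m).d w : ℂ) * gm (default : Ir F 0) else 0 := by
      intro a
      rw [Fintype.sum_unique, cc_o_right]
      split_ifs with h
      · rw [h]; ring
      · ring
    rw [sum_congr rfl fun a _ => e a, sum_ite_eq' univ w, if_pos (mem_univ _)]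
    have hg := gm_sum (default : Ir F 0)
    have h2 : NF F 0 0 = {1} := by
      ext M; rw [mem_NF, mem_singleton]
      exact ⟨fun _ => Subsingleton.elim _ _, fun _ i => i.elim0⟩
    rw [h2, sum_singleton, sg_one, neg_zero, AddChar.map_zero_eq_one, one_mul, ← Units.val_one, chm_coe, χ_o,
      card_singleton] at hg
    rw [Nat.cast_one, one_mul] at hg
    rw [hg, mul_one]
  rw [sum_range_succ, hZ]
  rcases Nat.eq_zero_or_pos m with h | h
  · subst h; simp
  · obtain ⟨c, rfl⟩ : ∃ c, m = c + 1 := ⟨m - 1, by omega⟩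
    rw [← key c (by omega), (Tc_last w).1, (Tc_last w).2]
    have hp := hpsi (c + 1)
    rw [hs] at hp ⊢
    have := (mul_ne_zero_iff.1 hp)
    have h3 := this.1
    have h4 := this.2
    field_simp
    push_cast
    ring
end
end TCV

open scoped MatrixGroups
namespace TCV
open Finset
set_option linter.unusedSectionVars false
set_option linter.unusedSimpArgs false
set_option linter.unusedVariables false

section
variable (F : Type) [Field F] [Fintype F] [DecidableEq F] (n : ℕ)

variable {F n} in
lemma cn_deg {a b w : JJ F n} (h : cn a.2 b.2 w.2 ≠ 0) : (w.1 : ℕ) = a.1 + b.1 := by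
  refine cJ_deg (a := a) (b := b) (w := w) ?_
  rw [cJ, ← cn_eq]
  exact_mod_cast h

variable {F n} in
lemma cn_ne {k l m : ℕ} {a : Ir F k} {b : Ir F l} {w : Ir F m} (h : cn a b w ≠ 0) : cc a b w ≠ 0 := by
  rw [← cn_eq]
  exact_mod_cast h

variable {F n} in
lemma JJ_eq {w w' : JJ F n} {m : Fin (n + 1)} {x x' : Ir F m} : (⟨m, x⟩ : JJ F n) = ⟨m, x'⟩ ↔ x = x' := by
  simp

variable {F n} in
lemma gam_eq (w : JJ F n) : (Fintype.card F : ℚ) ^ (w.1 : ℕ) * dl w.2 =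
    ∑ a : JJ F n, ∑ b : JJ F n, (cn a.2 b.2 w.2 : ℚ) * (dl a.2 * gm b.2) := by
  obtain ⟨⟨m, hm⟩, w⟩ := w
  have hmn : m ≤ n := by omega
  have key := gm_main (F := F) (m := m) w
  have e1 : ∀ a : JJ F n, ∑ b : JJ F n, (cn a.2 b.2 w : ℚ) * (dl a.2 * gm b.2) =
      if (a.1 : ℕ) ≤ m then ∑ b : Ir F (m - a.1), (cn a.2 b w : ℚ) * (dl a.2 * gm b) else 0 := by
    intro a
    have hz : ∀ b : JJ F n, (m : ℕ) ≠ a.1 + b.1 → cn a.2 b.2 w = 0 := by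
      intro b hb
      by_contra h
      exact hb (cn_deg (w := ⟨⟨m, hm⟩, w⟩) h)
    split_ifs with h
    · rw [sum_JJ (m := m - a.1) (by omega)]
      intro b hb
      rw [hz b (by omega), Nat.cast_zero, zero_mul]
    · refine sum_eq_zero fun b _ => ?_
      rw [hz b (by omega), Nat.cast_zero, zero_mul]
  have e2 : ∑ a : JJ F n, ∑ b : JJ F n, (cn a.2 b.2 w : ℚ) * (dl a.2 * gm b.2) =
      ∑ c ∈ range (m + 1), ∑ a : Ir F c, ∑ b : Ir F (m - c), (cn a b w : ℚ) * (dl a * gm b) := by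
    simp_rw [e1]
    rw [Fintype.sum_sigma, Fin.sum_univ_eq_sum_range (fun c => ∑ a : Ir F c, if c ≤ m then
      ∑ b : Ir F (m - c), (cn a b w : ℚ) * (dl a * gm b) else 0) (n + 1)]
    symm
    have hsub : range (m + 1) ⊆ range (n + 1) := by
      intro x hx; rw [mem_range] at *; omega
    rw [← sum_subset hsub]
    · refine sum_congr rfl fun c hc => sum_congr rfl fun a _ => ?_
      rw [if_pos (by rw [mem_range] at hc; omega)]
    · intro c _ hc
      refine sum_eq_zero fun a _ => if_neg ?_
      rw [mem_range] at hc; omega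
  show (Fintype.card F : ℚ) ^ m * dl w = ∑ a : JJ F n, ∑ b : JJ F n, (cn a.2 b.2 w : ℚ) * (dl a.2 * gm b.2)
  rw [e2]
  have : (((Fintype.card F : ℚ) ^ m * dl w : ℚ) : ℂ) =
      ((∑ c ∈ range (m + 1), ∑ a : Ir F c, ∑ b : Ir F (m - c), (cn a b w : ℚ) * (dl a * gm b) : ℚ) : ℂ) := by
    push_cast
    rw [dl]
    push_cast
    rw [← mul_div_assoc, key]
    refine sum_congr rfl fun c _ => ?_
    rw [Zc, sum_div]
    refine sum_congr rfl fun a _ => ?_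
    rw [sum_div]
    refine sum_congr rfl fun b _ => ?_
    rw [dl, cn_eq]
    push_cast
    ring
  exact_mod_cast this

lemma sum_deg {M : Type*} [AddCommMonoid M] {m : ℕ} (hm : m ≤ n) (f : JJ F n → M) :
    ∑ w : JJ F n with (w.1 : ℕ) = m, f w = ∑ w : Ir F m, f ⟨⟨m, Nat.lt_succ_of_le hm⟩, w⟩ := by
  rw [sum_filter, sum_JJ hm]
  · refine sum_congr rfl fun w _ => ?_
    rw [if_pos rfl]
  · intro w hw
    exact if_neg hw

noncomputable def JD : PSH (JJ F n) Fˣ n (Fintype.card F) where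
  two_le_q := Fintype.one_lt_card
  deg w := w.1
  deg_le w := by omega
  o := ⟨0, (default : Ir F 0)⟩
  deg_eq_zero := by
    rintro ⟨⟨m, hm⟩, w⟩
    constructor
    · intro h
      have h : m = 0 := h
      subst h
      congr 1
      exact Subsingleton.elim (α := Ir F 0) _ _
    · intro h
      rw [h]; rfl
  c a b w := cn a.2 b.2 w.2
  c_deg h := cn_deg h
  c_o_left := by
    rintro ⟨m, a⟩ ⟨m', w⟩
    by_cases hm : m = m'
    · subst hm
      have := cc_o_left (F := F) (m := m) default a w
      rw [← cn_eq] at this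
      simp only [Sigma.mk.injEq, heq_eq_eq, true_and]
      by_cases h : a = w
      · rw [if_pos h] at this ⊢; exact_mod_cast this
      · rw [if_neg h] at this ⊢; exact_mod_cast this
    · rw [if_neg (fun h => hm (congrArg Sigma.fst h))]
      by_contra h
      have := cn_deg (a := ⟨0, (default : Ir F 0)⟩) (b := ⟨m, a⟩) (w := ⟨m', w⟩) h
      apply hm
      apply Fin.ext
      simpa using this.symm
  c_o_right := by
    rintro ⟨m, a⟩ ⟨m', w⟩
    by_cases hm : m = m'
    · subst hm
      have := cc_o_right (F := F) (m := m) default a w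
      rw [← cn_eq] at this
      simp only [Sigma.mk.injEq, heq_eq_eq, true_and]
      by_cases h : a = w
      · rw [if_pos h] at this ⊢; exact_mod_cast this
      · rw [if_neg h] at this ⊢; exact_mod_cast this
    · rw [if_neg (fun h => hm (congrArg Sigma.fst h))]
      by_contra h
      have := cn_deg (b := ⟨0, (default : Ir F 0)⟩) (a := ⟨m, a⟩) (w := ⟨m', w⟩) h
      apply hm
      apply Fin.ext
      simpa using this.symm
  c_assoc a b d w := by
    have := assocC a b d w
    simp only [cJ, ← cn_eq] at this
    exact_mod_cast this
  hopf a b u v h := by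
    have := hopfC a b u v h
    simp only [cJ, ← cn_eq] at this
    exact_mod_cast this
  δ w := dl w.2
  δ_pos w := dl_pos _
  δ_o := dl_o _
  δ_mul a b h := by
    rw [← dl_mul, sum_JJ h]
    intro w hw
    have : cn a.2 b.2 w.2 = 0 := by
      by_contra h2
      exact hw (cn_deg h2)
    rw [this, Nat.cast_zero, zero_mul]
  γ w := gm w.2
  γ_le w := gm_le _
  γ_eq w := gam_eq w
  ω w := om w.2
  ω_mul h := om_mul _ _ _ (cn_ne h)
  sum_sq z hz m h1 h2 := by
    rw [sum_deg F n h2]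
    exact sum_sqC h1 z hz
  sum_sq_one h := by
    rw [sum_deg F n h]
    exact sum_sq1

variable {F n} in
lemma count_main {r : ℕ} {P0 : Polynomial ℤ} (z : Fˣ)
    (h : ((Fintype.card F : ℕ) : ℂ) ^ (2 * r * n.choose 2) * ∑ w with (JD F n).deg w = n, (JD F n).ω w z⁻¹ *
      ((((JD F n).δ w ^ 2)⁻¹ ^ r : ℚ) : ℂ) = ((Fintype.card F : ℂ) - 1) * ((P0.eval (Fintype.card F : ℤ) : ℤ) : ℂ)) :
    (Nat.card {p : (Fin (r + 1) → GL (Fin n) F) × (Fin (r + 1) → GL (Fin n) F) //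
      (List.ofFn fun i => p.1 i * p.2 i * (p.1 i)⁻¹ * (p.2 i)⁻¹).prod = scal n z} : ℂ) =
    (Fintype.card (GL (Fin n) F) : ℂ) * (((Fintype.card F : ℂ) - 1) * ((P0.eval (Fintype.card F : ℤ) : ℤ) : ℂ)) := by
  have h1 : ∑ w with (JD F n).deg w = n, (JD F n).ω w z⁻¹ * ((((JD F n).δ w ^ 2)⁻¹ ^ r : ℚ) : ℂ) =
      ∑ w : Ir F n, om w z⁻¹ * (((dl w ^ 2)⁻¹ ^ r : ℚ) : ℂ) :=
    sum_deg F n le_rfl (fun w => om w.2 z⁻¹ * (((dl w.2 ^ 2)⁻¹ ^ r : ℚ) : ℂ))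
  rw [h1] at h
  rw [← h, (wd F n).count, mul_sum, mul_sum]
  refine sum_congr rfl fun w _ => ?_
  have hG : (Fintype.card (GL (Fin n) F) : ℂ) ≠ 0 := by exact_mod_cast Fintype.card_ne_zero
  have hG' : (Fintype.card (GL (Fin n) F) : ℂ) = (Fintype.card F : ℂ) ^ n.choose 2 * ((psi n (Fintype.card F) : ℚ) : ℂ) := by
    have := card_GL (F := F) (m := n)
    exact_mod_cast congrArg (fun x : ℚ => (x : ℂ)) this
  have hχ : (wd F n).χ w (scal n z)⁻¹ = om w z⁻¹ * (wd F n).d w := by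
    rw [← map_inv]
    exact (wd F n).cen_χ (scal n) (scal_comm n) w z⁻¹
  have hpsi : ((psi n (Fintype.card F) : ℚ) : ℂ) ≠ 0 := by
    rw [Rat.cast_ne_zero]; exact psi_ne n
  have hdl := (dl_pos w).ne'
  have hd : ((wd F n).d w : ℂ) ≠ 0 := by
    intro h0
    apply hdl
    rw [dl, show ((wd F n).d w : ℚ) = 0 by exact_mod_cast h0, zero_div]
  have hq : ((Fintype.card F : ℂ)) ≠ 0 := by exact_mod_cast Fintype.card_ne_zero
  have e : ((Fintype.card (GL (Fin n) F) : ℂ) / (wd F n).d w) ^ 2 =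
      (Fintype.card F : ℂ) ^ (2 * n.choose 2) * ((((dl w ^ 2)⁻¹ : ℚ)) : ℂ) := by
    rw [hG', dl]; push_cast
    field_simp
    rw [← pow_mul, mul_comm]
  rw [hχ, pow_succ, e, mul_pow, ← pow_mul, Rat.cast_pow, ← e]
  rw [show 2 * r * n.choose 2 = 2 * n.choose 2 * r by ring]
  field_simp
end

theorem final (g n : ℕ) (hn : 1 ≤ n) :
    ∃ P : Polynomial ℤ,
      ∀ (F : Type) [Field F] [Fintype F], ∀ ζ : F, orderOf ζ = n →
        (Nat.card {p : (Fin g → GL (Fin n) F) × (Fin g → GL (Fin n) F) //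
            (↑((List.ofFn fun i => p.1 i * p.2 i * (p.1 i)⁻¹ * (p.2 i)⁻¹).prod) :
              Matrix (Fin n) (Fin n) F) = ζ • (1 : Matrix (Fin n) (Fin n) F)} : ℚ)
          = (Nat.card (GL (Fin n) F) : ℚ) / ((Fintype.card F : ℚ) - 1)
              * ((P.eval ((Fintype.card F : ℤ)) : ℤ) : ℚ) := by
  classical
  rcases g with _ | r
  · refine ⟨if n = 1 then 1 else 0, ?_⟩
    intro F _ _ ζ hζ
    have hq : (1 : ℚ) < Fintype.card F := by exact_mod_cast Fintype.one_lt_card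
    have hq0 : (Fintype.card F : ℚ) - 1 ≠ 0 := by linarith
    simp only [List.ofFn_zero, List.prod_nil, Units.val_one]
    by_cases h : n = 1
    · subst h
      have : ζ = 1 := orderOf_eq_one_iff.1 hζ
      subst this
      rw [one_smul, if_pos rfl, Polynomial.eval_one]
      have hc := card_GL (F := F) (m := 1)
      rw [Nat.card_eq_fintype_card (α := GL (Fin 1) F), hc]
      simp [psi]
      rw [div_self hq0]
    · rw [if_neg h, Polynomial.eval_zero]
      have : IsEmpty {p : (Fin 0 → GL (Fin n) F) × (Fin 0 → GL (Fin n) F) //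
          (1 : Matrix (Fin n) (Fin n) F) = ζ • (1 : Matrix (Fin n) (Fin n) F)} := by
        constructor
        rintro ⟨_, hp⟩
        apply h
        rw [← hζ, orderOf_eq_one_iff]
        have := congrFun (congrFun hp ⟨0, hn⟩) ⟨0, hn⟩
        simpa using this.symm
      rw [Nat.card_of_isEmpty]
      simp
  · obtain ⟨P0, hP⟩ := PSH.abstract_main n hn r
    refine ⟨(Polynomial.X - 1) ^ 2 * P0, ?_⟩
    intro F _ _ ζ hζ
    have hq : (1 : ℚ) < Fintype.card F := by exact_mod_cast Fintype.one_lt_card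
    have hq0 : (Fintype.card F : ℚ) - 1 ≠ 0 := by linarith
    have hz0 : ζ ≠ 0 := by
      rintro rfl
      have h1 := pow_orderOf_eq_one (0 : F)
      rw [hζ, zero_pow (by omega)] at h1
      exact zero_ne_one h1
    let z : Fˣ := Units.mk0 ζ hz0
    have hz : orderOf z⁻¹ = n := by
      rw [orderOf_inv, ← orderOf_units]; exact hζ
    have h := count_main z (hP (JJ F n) Fˣ (Fintype.card F) (JD F n) z⁻¹ hz)
    have he : ∀ A : GL (Fin n) F, (A : Matrix (Fin n) (Fin n) F) = ζ • (1 : Matrix (Fin n) (Fin n) F) ↔ A = scal n z := by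
      intro A
      rw [← Units.val_inj]
      have : (scal n z : GL (Fin n) F).1 = ζ • (1 : Matrix (Fin n) (Fin n) F) := by
        show Matrix.scalar (Fin n) ζ = _
        rw [Matrix.smul_one_eq_diagonal]; rfl
      rw [this]
    simp only [he]
    rw [Nat.card_eq_fintype_card (α := GL (Fin n) F)]
    have h2 : (Nat.card {p : (Fin (r + 1) → GL (Fin n) F) × (Fin (r + 1) → GL (Fin n) F) //
      (List.ofFn fun i => p.1 i * p.2 i * (p.1 i)⁻¹ * (p.2 i)⁻¹).prod = scal n z} : ℚ) =
      (Fintype.card (GL (Fin n) F) : ℚ) * (((Fintype.card F : ℚ) - 1) * ((P0.eval (Fintype.card F : ℤ) : ℤ) : ℚ)) := by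
      exact_mod_cast h
    rw [h2]
    simp only [Polynomial.eval_mul, Polynomial.eval_pow, Polynomial.eval_sub, Polynomial.eval_X, Polynomial.eval_one]
    push_cast
    field_simp
end TCV


open scoped MatrixGroups

/-- For `g ≥ 0` and `n ≥ 1` there is a polynomial `P ∈ ℤ[X]` such that
for every finite field `F_q` and every `ζ ∈ F_q^×` of multiplicative order exactly `n`,
the number of `2g`-tuples in `GL(n,F_q)^{2g}` with `[A₁,B₁]⋯[A_g,B_g] = ζ·Iₙ` equals
`(|GL(n,F_q)|/(q−1))·P(q)`; in particular the count is independent of `ζ`. -/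
theorem statement10 (g n : ℕ) (hn : 1 ≤ n) :
    ∃ P : Polynomial ℤ,
      ∀ (F : Type) [Field F] [Fintype F], ∀ ζ : F, orderOf ζ = n →
        (Nat.card {p : (Fin g → GL (Fin n) F) × (Fin g → GL (Fin n) F) //
            (↑((List.ofFn fun i => p.1 i * p.2 i * (p.1 i)⁻¹ * (p.2 i)⁻¹).prod) :
              Matrix (Fin n) (Fin n) F) = ζ • (1 : Matrix (Fin n) (Fin n) F)} : ℚ)
          = (Nat.card (GL (Fin n) F) : ℚ) / ((Fintype.card F : ℚ) - 1)
              * ((P.eval ((Fintype.card F : ℤ)) : ℤ) : ℚ) := by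
  exact TCV.final g n hn
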